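/- arXiv:2003.05270 — 2 statements merged into one kernel-verified Lean document; each statement's English description precedes it below -/
import Mathlib

section
/- Let K₀ ≥ K₁ ≥ K₂ ≥ ... be a nested descending sequence of subgroups of a free group, each of which is free of rank at most n for a fixed n ∈ ℕ. Then the intersection K := ∩_{i=0}^∞ K_i has rank at most n. -/
/-- `rkLe H n` : the (free) subgroup `H` has rank at most `n`, i.e. it is generated by
at most `n` elements. -/
def rkLe {G : Type*} [Group G] (H : Subgroup G) (n : ℕ) : Prop :=
  ∃ S : Finset G, S.card ≤ n ∧ Subgroup.closure (S : Set G) = H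

open Classical in
theorem exists_schreier {α : Type} (H : Subgroup (FreeGroup α)) :
    ∃ (ι : Type) (x : ι → FreeGroup α) (ℓ : ι → ℕ) (φ : FreeGroup α → (ι →₀ ℚ)),
      (∀ i, x i ∈ H) ∧ (∀ i, (x i).norm ≤ ℓ i) ∧
      (∀ g ∈ H, g ∈ Subgroup.closure (x '' {i | ℓ i ≤ g.norm})) ∧
      (∀ g ∈ H, ∀ h ∈ H, φ (g * h) = φ g + φ h) ∧
      (∀ i, φ (x i) = Finsupp.single i 1) := by
  let V := FreeGroup α ⧸ H
  let b : V := ((1 : FreeGroup α) : FreeGroup α ⧸ H)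
  have hb : ∀ g : FreeGroup α, g • b = b ↔ g ∈ H := by
    intro g
    have : g • b = ((g : FreeGroup α) : FreeGroup α ⧸ H) := by
      change ((g * 1 : FreeGroup α) : FreeGroup α ⧸ H) = _
      rw [mul_one]
    rw [this]
    change ((g : FreeGroup α) : FreeGroup α ⧸ H) = ((1 : FreeGroup α) : FreeGroup α ⧸ H) ↔ _
    rw [QuotientGroup.eq]
    simp
  have hsurj : ∀ v : V, ∃ g : FreeGroup α, g • b = v := by
    intro v
    obtain ⟨g, rfl⟩ := QuotientGroup.mk_surjective v
    refine ⟨g, ?_⟩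
    change ((g * 1 : FreeGroup α) : FreeGroup α ⧸ H) = _
    rw [mul_one]
  let d : V → ℕ := fun v => sInf {n | ∃ g : FreeGroup α, g • b = v ∧ g.norm = n}
  have hd1 : ∀ v, ∃ g : FreeGroup α, g • b = v ∧ g.norm = d v := by
    intro v
    have : d v ∈ {n | ∃ g : FreeGroup α, g • b = v ∧ g.norm = n} := by
      apply Nat.sInf_mem
      obtain ⟨g, hg⟩ := hsurj v
      exact ⟨_, g, hg, rfl⟩
    exact this
  have hd2 : ∀ g : FreeGroup α, d (g • b) ≤ g.norm := fun g => Nat.sInf_le ⟨g, rfl, rfl⟩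
  have hd3 : ∀ (g : FreeGroup α) v, d (g • v) ≤ g.norm + d v := by
    intro g v
    obtain ⟨h, rfl, h2⟩ := hd1 v
    rw [← h2, ← mul_smul]
    exact (hd2 _).trans (FreeGroup.norm_mul_le _ _)
  have hdb : d b = 0 := by
    have := hd2 1
    simpa using this
  have hstep : ∀ v, v ≠ b → ∃ s : α × Bool, d ((FreeGroup.mk [s])⁻¹ • v) < d v := by
    intro v hv
    obtain ⟨g, hg, hn⟩ := hd1 v
    rcases hw : g.toWord with _ | ⟨s, l⟩
    · rw [FreeGroup.toWord_eq_nil_iff] at hw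
      subst hw
      simp at hg
      exact absurd hg.symm hv
    · refine ⟨s, ?_⟩
      have hgm : g = FreeGroup.mk [s] * FreeGroup.mk l := by
        rw [FreeGroup.mul_mk, ← FreeGroup.mk_toWord (x := g), hw]; rfl
      rw [← hn, ← hg, hgm, mul_smul, inv_smul_smul]
      refine (hd2 _).trans_lt ?_
      rw [← hgm]
      have h1 : (FreeGroup.mk l).norm ≤ l.length := FreeGroup.norm_mk_le
      have h2 : g.norm = l.length + 1 := by simp [FreeGroup.norm, hw]
      omega
  choose s hs using hstep
  have hwf : WellFounded (fun u v : V => d u < d v) := (measure d).wf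
  obtain ⟨t, htb, hts⟩ : ∃ t : V → FreeGroup α, t b = 1 ∧
      ∀ v, (hv : v ≠ b) → t v = FreeGroup.mk [s v hv] * t ((FreeGroup.mk [s v hv])⁻¹ • v) := by
    let F : (v : V) → ((u : V) → d u < d v → FreeGroup α) → FreeGroup α := fun v r =>
      if h : v = b then 1 else FreeGroup.mk [s v h] * r ((FreeGroup.mk [s v h])⁻¹ • v) (hs v h)
    refine ⟨hwf.fix F, ?_, ?_⟩
    · rw [hwf.fix_eq]; simp [F]
    · intro v hv
      rw [hwf.fix_eq]; simp [F, hv]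
  have ht1 : ∀ v, t v • b = v := by
    intro v
    induction v using hwf.induction with
    | _ v ih =>
    by_cases hv : v = b
    · rw [hv, htb, one_smul]
    · rw [hts v hv, mul_smul, ih _ (hs v hv), smul_inv_smul]
  have ht2 : ∀ v, (t v).norm ≤ d v := by
    intro v
    induction v using hwf.induction with
    | _ v ih =>
    by_cases hv : v = b
    · rw [hv, htb]; simp
    · rw [hts v hv]
      refine (FreeGroup.norm_mul_le _ _).trans ?_
      have h1 : (FreeGroup.mk [s v hv]).norm ≤ 1 := FreeGroup.norm_mk_le
      have := ih _ (hs v hv)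
      have := hs v hv
      omega
  let X : V × α → FreeGroup α := fun e => (t (FreeGroup.of e.2 • e.1))⁻¹ * FreeGroup.of e.2 * t e.1
  let ι := {e : V × α // X e ≠ 1}
  let L : V × α → ℕ := fun e => d e.1 + 1 + d (FreeGroup.of e.2 • e.1)
  let c : V × α → (ι →₀ ℚ) := fun e => if h : X e ≠ 1 then Finsupp.single ⟨e, h⟩ 1 else 0
  let P : α → Equiv.Perm (V × (ι →₀ ℚ)) := fun a =>
    { toFun := fun p => (FreeGroup.of a • p.1, p.2 + c (p.1, a))
      invFun := fun p => ((FreeGroup.of a)⁻¹ • p.1, p.2 - c ((FreeGroup.of a)⁻¹ • p.1, a))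
      left_inv := by intro p; simp
      right_inv := by intro p; simp }
  let Ψ : FreeGroup α →* Equiv.Perm (V × (ι →₀ ℚ)) := FreeGroup.lift P
  let φ : FreeGroup α → V → (ι →₀ ℚ) := fun g v => (Ψ g (v, 0)).2
  have hΨof : ∀ a p, Ψ (FreeGroup.of a) p = (FreeGroup.of a • p.1, p.2 + c (p.1, a)) := by
    intro a p; simp [Ψ, P]
  have hΨinv : ∀ a p, Ψ (FreeGroup.of a)⁻¹ p =
      ((FreeGroup.of a)⁻¹ • p.1, p.2 - c ((FreeGroup.of a)⁻¹ • p.1, a)) := by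
    intro a p
    simp only [Ψ, map_inv, FreeGroup.lift_apply_of]
    rfl
  have hΨ : ∀ g v y, Ψ g (v, y) = (g • v, y + φ g v) := by
    intro g
    induction g using FreeGroup.induction_on with
    | C1 => intro v y; simp [φ]
    | of a =>
      intro v y
      change Ψ (FreeGroup.of a) (v, y) = (FreeGroup.of a • v, y + (Ψ (FreeGroup.of a) (v, 0)).2)
      rw [hΨof, hΨof]; simp
    | inv_of a _ =>
      intro v y
      change Ψ (FreeGroup.of a)⁻¹ (v, y) =
        ((FreeGroup.of a)⁻¹ • v, y + (Ψ (FreeGroup.of a)⁻¹ (v, 0)).2)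
      rw [hΨinv, hΨinv]; simp [sub_eq_add_neg]
    | mul g h hg hh =>
      intro v y
      have : φ (g * h) v = φ h v + φ g (h • v) := by
        simp only [φ] at *
        rw [map_mul, Equiv.Perm.mul_apply, hh, hg, zero_add]
      rw [this, map_mul, Equiv.Perm.mul_apply, hh, hg, mul_smul, add_assoc]
  have hφmul : ∀ g h v, φ (g * h) v = φ h v + φ g (h • v) := by
    intro g h v
    change (Ψ (g * h) (v, 0)).2 = _
    rw [map_mul, Equiv.Perm.mul_apply, hΨ, hΨ]; simp
  have hφone : ∀ v, φ 1 v = 0 := by intro v; simp [φ]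
  have hφof : ∀ a v, φ (FreeGroup.of a) v = c (v, a) := by
    intro a v; simp only [φ]; rw [hΨof]; simp
  have hφinv : ∀ g v, φ g⁻¹ v = - φ g (g⁻¹ • v) := by
    intro g v
    have := hφmul g g⁻¹ v
    rw [mul_inv_cancel, hφone] at this
    exact eq_neg_of_add_eq_zero_left this.symm
  have hc0 : ∀ e, X e = 1 → c e = 0 := by intro e he; simp [c, he]
  have hφt : ∀ v, φ (t v) b = 0 := by
    intro v
    induction v using hwf.induction with
    | _ v ih =>
    by_cases hv : v = b
    · rw [hv, htb, hφone]
    · have h0 := ih _ (hs v hv)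
      have h1 := hts v hv
      rw [h1, hφmul, h0, ht1, zero_add]
      generalize s v hv = q at h1
      obtain ⟨a, _ | _⟩ := q
      · have hq : FreeGroup.mk [(a, false)] = (FreeGroup.of a)⁻¹ := rfl
        rw [hq] at h1 ⊢
        rw [hφinv, hφof, hc0, neg_zero]
        simp only [inv_inv, inv_smul_smul] at h1 ⊢
        simp only [X]
        rw [h1]; group
      · have hq : FreeGroup.mk [(a, true)] = FreeGroup.of a := rfl
        rw [hq] at h1 ⊢
        rw [hφof, hc0]
        simp only [X]
        rw [smul_inv_smul, h1]; group
  have hgen : ∀ (B : ℕ) (l : List (α × Bool)) (v : V),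
      d v + l.length + d (FreeGroup.mk l • v) ≤ B →
      (t (FreeGroup.mk l • v))⁻¹ * FreeGroup.mk l * t v ∈
        Subgroup.closure ((fun i : ι => X i.1) '' {i | L i.1 ≤ B}) := by
    intro B l
    have hX : ∀ e, L e ≤ B → X e ∈ Subgroup.closure ((fun i : ι => X i.1) '' {i | L i.1 ≤ B}) := by
      intro e he
      by_cases h : X e = 1
      · rw [h]; exact one_mem _
      · exact Subgroup.subset_closure ⟨⟨e, h⟩, he, rfl⟩
    induction l with
    | nil =>
      intro v _
      have : FreeGroup.mk ([] : List (α × Bool)) = 1 := rfl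
      simp [this]
    | cons q l ih =>
      intro v hv
      have hm : FreeGroup.mk (q :: l) = FreeGroup.mk [q] * FreeGroup.mk l := by
        rw [FreeGroup.mul_mk]; rfl
      rw [hm, mul_smul] at hv ⊢
      set u := FreeGroup.mk l • v with hu
      have h1 : d u ≤ l.length + d v := (hd3 _ _).trans (by
        have : (FreeGroup.mk l).norm ≤ l.length := FreeGroup.norm_mk_le
        omega)
      have h2 : d u ≤ 1 + d (FreeGroup.mk [q] • u) := by
        have h3 := hd3 (FreeGroup.mk [q])⁻¹ (FreeGroup.mk [q] • u)
        rw [inv_smul_smul, FreeGroup.norm_inv_eq] at h3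
        have : (FreeGroup.mk [q]).norm ≤ 1 := FreeGroup.norm_mk_le
        omega
      simp only [List.length_cons] at hv
      have h4 := ih v (by rw [← hu]; omega)
      rw [← hu] at h4
      have h5 : (t (FreeGroup.mk [q] • u))⁻¹ * FreeGroup.mk [q] * t u ∈
          Subgroup.closure ((fun i : ι => X i.1) '' {i | L i.1 ≤ B}) := by
        obtain ⟨a, _ | _⟩ := q
        · have hq : FreeGroup.mk [(a, false)] = (FreeGroup.of a)⁻¹ := rfl
          rw [hq] at hv ⊢
          have := inv_mem (hX ((FreeGroup.of a)⁻¹ • u, a) (by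
            simp only [L, smul_inv_smul]; omega))
          simp only [X, smul_inv_smul] at this
          convert this using 1
          group
        · have hq : FreeGroup.mk [(a, true)] = FreeGroup.of a := rfl
          rw [hq] at hv ⊢
          exact hX (u, a) (by simp only [L]; omega)
      have h6 := mul_mem h5 h4
      convert h6 using 1
      group
  refine ⟨ι, fun i => X i.1, fun i => L i.1, fun g => φ g b, ?_, ?_, ?_, ?_, ?_⟩
  · rintro ⟨⟨v, a⟩, _⟩
    rw [← hb]
    simp only [X]
    rw [mul_smul, mul_smul, ht1, inv_smul_eq_iff, ht1]
  · rintro ⟨⟨v, a⟩, _⟩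
    simp only [X, L]
    have h1 := FreeGroup.norm_mul_le ((t (FreeGroup.of a • v))⁻¹ * FreeGroup.of a) (t v)
    have h2 := FreeGroup.norm_mul_le ((t (FreeGroup.of a • v))⁻¹) (FreeGroup.of a)
    rw [FreeGroup.norm_inv_eq, FreeGroup.norm_of] at h2
    have := ht2 v
    have := ht2 (FreeGroup.of a • v)
    omega
  · intro g hg
    have hgb := (hb g).2 hg
    have := hgen g.norm g.toWord b (by
      rw [FreeGroup.mk_toWord, hgb, hdb]; simp [FreeGroup.norm])
    rw [FreeGroup.mk_toWord, hgb, htb] at this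
    simpa using this
  · intro g hg h hh
    simp only
    rw [hφmul, (hb h).2 hh, add_comm]
  · rintro ⟨⟨v, a⟩, hi⟩
    simp only [X]
    rw [hφmul, hφmul, hφt, ht1, hφof, hφinv, inv_smul_eq_iff.2 (ht1 _).symm, hφt]
    simp only [neg_zero, zero_add, add_zero]
    simp only [c]
    rw [dif_pos hi]

theorem card_le_of_indep {G ι : Type} [Group G] (H : Subgroup G) (x : ι → G)
    (φ : G → (ι →₀ ℚ)) (hφ : ∀ g ∈ H, ∀ h ∈ H, φ (g * h) = φ g + φ h)
    (hx : ∀ i, φ (x i) = Finsupp.single i 1) (S : Finset G) (hS : (S : Set G) ⊆ H)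
    (Y : Finset ι) (hY : ∀ i ∈ Y, x i ∈ Subgroup.closure (S : Set G)) : Y.card ≤ S.card := by
  classical
  have h1 : φ 1 = 0 := by
    have := hφ 1 (one_mem _) 1 (one_mem _)
    rw [mul_one] at this
    simpa using this
  have hle : Subgroup.closure (S : Set G) ≤ H := (Subgroup.closure_le _).2 hS
  have hspan : ∀ g ∈ Subgroup.closure (S : Set G),
      φ g ∈ Submodule.span ℚ ((S.image φ : Finset (ι →₀ ℚ)) : Set (ι →₀ ℚ)) := by
    intro g hg
    induction hg using Subgroup.closure_induction with
    | mem g hg => exact Submodule.subset_span (by simpa using ⟨g, hg, rfl⟩)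
    | one => rw [h1]; exact zero_mem _
    | mul g h hg hh ig ih => rw [hφ g (hle hg) h (hle hh)]; exact add_mem ig ih
    | inv g hg ig =>
      have := hφ g (hle hg) g⁻¹ (inv_mem (hle hg))
      rw [mul_inv_cancel, h1] at this
      rw [eq_neg_of_add_eq_zero_right this.symm]
      exact neg_mem ig
  have hli : LinearIndependent ℚ (fun i : Y => (Finsupp.single i.1 1 : ι →₀ ℚ)) :=
    (Finsupp.basisSingleOne (R := ℚ) (ι := ι)).linearIndependent.comp
      (fun i : Y => i.1) Subtype.val_injective |> fun h => by simpa [Function.comp_def] using h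
  have hsub : Set.range (fun i : Y => (Finsupp.single i.1 1 : ι →₀ ℚ)) ⊆
      Submodule.span ℚ ((S.image φ : Finset (ι →₀ ℚ)) : Set (ι →₀ ℚ)) := by
    rintro _ ⟨i, rfl⟩
    have := hspan _ (hY i.1 i.2)
    rwa [hx] at this
  have := linearIndependent_le_span_aux' _ hli _ hsub
  simp at this
  exact this.trans Finset.card_image_le

open Classical in
theorem finite_ball {α : Type} (S : Finset (FreeGroup α)) (L : ℕ) :
    {g | g ∈ Subgroup.closure (S : Set (FreeGroup α)) ∧ g.norm ≤ L}.Finite := by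
  let A : Set α := {a | ∃ g ∈ S, ∃ q ∈ g.toWord, q.1 = a}
  have hA : A.Finite := by
    have : A = ⋃ g ∈ S, (Prod.fst '' {q | q ∈ g.toWord}) := by
      ext a; simp [A]
    rw [this]
    exact S.finite_toSet.biUnion fun g _ => (List.finite_toSet _).image _
  have hmem : ∀ g ∈ Subgroup.closure (S : Set (FreeGroup α)), ∀ q ∈ g.toWord, q.1 ∈ A := by
    intro g hg
    induction hg using Subgroup.closure_induction with
    | mem g hg => intro q hq; exact ⟨g, hg, q, hq, rfl⟩
    | one => intro q hq; simp at hq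
    | mul g h _ _ ig ih =>
      intro q hq
      have := (FreeGroup.toWord_mul_sublist g h).subset hq
      rcases List.mem_append.1 this with h | h
      · exact ig q h
      · exact ih q h
    | inv g _ ig =>
      intro q hq
      rw [FreeGroup.toWord_inv, FreeGroup.invRev] at hq
      simp only [List.mem_reverse, List.mem_map] at hq
      obtain ⟨r, hr, rfl⟩ := hq
      exact ig r hr
  have : Finite A := hA
  have hfin : {l : List (A × Bool) | l.length ≤ L}.Finite := List.finite_length_le _ _
  refine (hfin.image (fun l => FreeGroup.mk (l.map fun q => ((q.1 : α), q.2)))).subset ?_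
  rintro g ⟨hg, hL⟩
  refine ⟨g.toWord.attach.map fun q => (⟨q.1.1, hmem g hg q.1 q.2⟩, q.1.2), ?_, ?_⟩
  · simpa [FreeGroup.norm] using hL
  · simp [Function.comp_def, List.attach_map_subtype_val, FreeGroup.mk_toWord]

/-- Takahasi: a nested descending sequence of subgroups of a free group,
each of rank at most `n`, has intersection of rank at most `n`. -/
theorem stmt_3 {α : Type} (K : ℕ → Subgroup (FreeGroup α))
    (hdesc : ∀ i, K (i + 1) ≤ K i) (n : ℕ) (hrk : ∀ i, rkLe (K i) n) :
    rkLe (⨅ i, K i) n := by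
  classical
  have hanti : Antitone K := antitone_nat_of_succ_le hdesc
  have hball : ∀ L : ℕ, ∃ i, ∀ g ∈ K i, g.norm ≤ L → g ∈ ⨅ i, K i := by
    intro L
    obtain ⟨S, _, hS⟩ := hrk 0
    have hfin := finite_ball S L
    rw [hS] at hfin
    have : ∀ g : FreeGroup α, ∃ i, g ∈ K i → g ∈ ⨅ i, K i := by
      intro g
      by_cases h : g ∈ ⨅ i, K i
      · exact ⟨0, fun _ => h⟩
      · have h' := h
        rw [Subgroup.mem_iInf] at h'
        push Not at h'
        obtain ⟨i, hi⟩ := h'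
        exact ⟨i, fun h => absurd h hi⟩
    choose f hf using this
    refine ⟨hfin.toFinset.sup f, fun g hg hL => hf g (hanti (Finset.le_sup ?_) hg)⟩
    simp only [Set.Finite.mem_toFinset, Set.mem_ofPred_eq]
    exact ⟨hanti (Nat.zero_le _) hg, hL⟩
  obtain ⟨ι, x, ℓ, φ, hx, hxl, hgen, hφ, hφx⟩ := exists_schreier (⨅ i, K i)
  have key : ∀ Y : Finset ι, Y.card ≤ n := by
    intro Y
    obtain ⟨i, hi⟩ := hball (Y.sup ℓ)
    obtain ⟨S, hSn, hS⟩ := hrk i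
    obtain ⟨ι', x', ℓ', φ', hx', hxl', hgen', hφ', hφx'⟩ := exists_schreier (K i)
    have hcard : ∀ Z : Finset ι', Z.card ≤ n := fun Z =>
      (card_le_of_indep (K i) x' φ' hφ' hφx' S (by rw [← hS]; exact Subgroup.subset_closure) Z
        (fun j _ => by rw [hS]; exact hx' j)).trans hSn
    have : Finite ι' := by
      by_contra hinf
      rw [not_finite_iff_infinite] at hinf
      obtain ⟨Z, hZ⟩ := Infinite.exists_subset_card_eq ι' (n + 1)
      have := hcard Z
      omega
    have := Fintype.ofFinite ι'
    let Z : Finset ι' := Finset.univ.filter fun j => ℓ' j ≤ Y.sup ℓ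
    refine (card_le_of_indep (⨅ i, K i) x φ hφ hφx (Z.image x') ?_ Y ?_).trans
      (Finset.card_image_le.trans (hcard Z))
    · intro g hg
      simp only [Finset.coe_image, Set.mem_image, Finset.mem_coe] at hg
      obtain ⟨j, hj, rfl⟩ := hg
      exact hi _ (hx' j) ((hxl' j).trans (by simpa [Z] using hj))
    · intro j hj
      have h1 : x j ∈ K i := (Subgroup.mem_iInf.1 (hx j)) i
      refine Subgroup.closure_mono ?_ (hgen' _ h1)
      rintro _ ⟨k, hk, rfl⟩
      simp only [Finset.coe_image]
      refine ⟨k, ?_, rfl⟩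
      simp only [Z, Finset.coe_filter, Finset.mem_univ, true_and]
      exact le_trans hk ((hxl j).trans (Finset.le_sup hj))
  have : Finite ι := by
    by_contra hinf
    rw [not_finite_iff_infinite] at hinf
    obtain ⟨Z, hZ⟩ := Infinite.exists_subset_card_eq ι (n + 1)
    have := key Z
    omega
  have := Fintype.ofFinite ι
  refine ⟨Finset.univ.image x, Finset.card_image_le.trans (key _), le_antisymm ?_ ?_⟩
  · rw [Subgroup.closure_le]
    intro g hg
    simp only [Finset.coe_image, Set.mem_image] at hg
    obtain ⟨j, _, rfl⟩ := hg
    exact hx j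
  · intro g hg
    refine Subgroup.closure_mono ?_ (hgen g hg)
    rintro _ ⟨k, _, rfl⟩
    simp
end

section
/- Let g, h : F(Σ) → F(Δ) be injective homomorphisms and suppose im(g) is an inert subgroup of the subgroup ⟨im(g) ∪ im(h)⟩. Then rk(SD(g,h)) ≤ |Σ| and rk(Eq(g,h)) ≤ |Σ|. -/
/-- `A` is inert in the subgroup `B`: `rk(A ∩ K) ≤ rk(K)` for every subgroup `K ≤ B`. -/
def InertIn {G : Type*} [Group G] (A B : Subgroup G) : Prop :=
  ∀ K : Subgroup G, K ≤ B → ∀ n : ℕ, rkLe K n → rkLe (A ⊓ K) n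

/-- The descending chain in the definition of the stable domain. -/
def SDChain {α β : Type} (g h : FreeGroup α →* FreeGroup β) : ℕ → Subgroup (FreeGroup α)
  | 0 => ⊤
  | i + 1 =>
      Subgroup.comap g (Subgroup.map g (SDChain g h i) ⊓ Subgroup.map h (SDChain g h i))

/-- The stable domain `SD(g,h)`. -/
def SD {α β : Type} (g h : FreeGroup α →* FreeGroup β) : Subgroup (FreeGroup α) :=
  ⨅ i, SDChain g h i


section SecA

variable {ι : Type*} {S : Type*} [MulAction (FreeGroup ι) S] {K : Type*} [AddCommGroup K]

/-- one step of the path integral -/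
def stepPerm (c : ι → S → K) (i : ι) : Equiv.Perm (S × K) where
  toFun q := (FreeGroup.of i • q.1, q.2 + c i q.1)
  invFun q := ((FreeGroup.of i)⁻¹ • q.1, q.2 - c i ((FreeGroup.of i)⁻¹ • q.1))
  left_inv q := by simp
  right_inv q := by simp

/-- path integral hom -/
def piHom (c : ι → S → K) : FreeGroup ι →* Equiv.Perm (S × K) := FreeGroup.lift (stepPerm c)

/-- path integral -/
def PI (c : ι → S → K) (x : FreeGroup ι) (s : S) : K := (piHom c x (s, 0)).2

theorem piHom_apply (c : ι → S → K) (x : FreeGroup ι) :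
    ∀ (s : S) (a : K), piHom c x (s, a) = (x • s, a + PI c x s) := by
  induction x using FreeGroup.induction_on with
  | C1 => intro s a; simp [PI]
  | of i => intro s a; simp [PI, piHom, stepPerm]
  | inv_of i h =>
    intro s a
    simp [PI, piHom, stepPerm, Equiv.Perm.inv_def, sub_eq_add_neg]
  | mul x y hx hy =>
    intro s a
    have e1 : ∀ (s : S) (a : K), piHom c (x * y) (s, a) = ((x * y) • s, a + PI c y s + PI c x (y • s)) := by
      intro s a
      rw [map_mul, Equiv.Perm.mul_apply, hy, hx, mul_smul]
    have e2 : PI c (x * y) s = PI c y s + PI c x (y • s) := by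
      rw [PI, e1]; simp
    rw [e1, e2, add_assoc]

@[simp] theorem PI_one (c : ι → S → K) (s : S) : PI c 1 s = 0 := by simp [PI]

@[simp] theorem PI_of (c : ι → S → K) (i : ι) (s : S) : PI c (FreeGroup.of i) s = c i s := by
  simp [PI, piHom, stepPerm]

theorem PI_mul (c : ι → S → K) (x y : FreeGroup ι) (s : S) :
    PI c (x * y) s = PI c y s + PI c x (y • s) := by
  have := piHom_apply c x (y • s) (PI c y s)
  simp only [PI, map_mul, Equiv.Perm.mul_apply]
  rw [piHom_apply c y, zero_add, this, PI]
  simp [PI]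

theorem PI_inv (c : ι → S → K) (x : FreeGroup ι) (s : S) :
    PI c x⁻¹ s = - PI c x (x⁻¹ • s) := by
  have := PI_mul c x x⁻¹ s
  rw [mul_inv_cancel, PI_one] at this
  exact eq_neg_of_add_eq_zero_left this.symm

/-- uniqueness of the path integral -/
theorem PI_unique (c : ι → S → K) (P : FreeGroup ι → S → K)
    (hmul : ∀ x y s, P (x * y) s = P y s + P x (y • s))
    (hof : ∀ i s, P (FreeGroup.of i) s = c i s) (x : FreeGroup ι) : ∀ s, P x s = PI c x s := by
  have h1 : ∀ s, P 1 s = 0 := by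
    intro s
    have := hmul 1 1 s
    simpa using this
  induction x using FreeGroup.induction_on with
  | C1 => intro s; simp [h1]
  | of i => intro s; simp [hof]
  | inv_of i h =>
    intro s
    have := hmul (FreeGroup.of i) (FreeGroup.of i)⁻¹ s
    rw [mul_inv_cancel, h1] at this
    rw [PI_inv, ← h]
    exact eq_neg_of_add_eq_zero_left this.symm
  | mul x y hx hy => intro s; rw [hmul, PI_mul, hx, hy]

theorem PI_equivar {S' : Type*} [MulAction (FreeGroup ι) S'] (f : S' → S)
    (hf : ∀ (x : FreeGroup ι) s, f (x • s) = x • f s) (c : ι → S → K) (x : FreeGroup ι) (s : S') :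
    PI c x (f s) = PI (fun i s => c i (f s)) x s := by
  refine PI_unique _ (fun x s => PI c x (f s)) ?_ ?_ x s
  · intro x y s; simp [PI_mul, hf]
  · intro i s; simp

theorem PI_potential (v : S → K) (x : FreeGroup ι) (s : S) :
    PI (fun i s => v (FreeGroup.of i • s) - v s) x s = v (x • s) - v s := by
  symm
  refine PI_unique _ (fun x s => v (x • s) - v s) ?_ ?_ x s
  · intro x y s; simp [mul_smul]
  · intro i s; simp

/-- Lemma I -/
theorem exists_potential (hfree : ∀ (x : FreeGroup ι) (s : S), x • s = s → x = 1)
    (c : ι → S → K) : ∃ v : S → K, ∀ i s, v (FreeGroup.of i • s) - v s = c i s := by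
  classical
  let rep : S → S := fun s => (Quotient.out (s := MulAction.orbitRel (FreeGroup ι) S) (Quotient.mk _ s))
  have hrep : ∀ s, ∃ x : FreeGroup ι, x • rep s = s := by
    intro s
    have : (MulAction.orbitRel (FreeGroup ι) S) (rep s) s := Quotient.mk_out (s := MulAction.orbitRel (FreeGroup ι) S) s
    have h2 := (MulAction.orbitRel (FreeGroup ι) S).symm' this
    rw [MulAction.orbitRel_apply] at h2
    exact h2
  have hrep2 : ∀ (x : FreeGroup ι) s, rep (x • s) = rep s := by
    intro x s
    have : Quotient.mk (MulAction.orbitRel (FreeGroup ι) S) (x • s) = Quotient.mk _ s := by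
      apply Quotient.sound
      exact ⟨x, rfl⟩
    simp only [rep, this]
  choose X hX using hrep
  have hXm : ∀ (x : FreeGroup ι) s, X (x • s) = x * X s := by
    intro x s
    have h1 := hX (x • s)
    rw [hrep2] at h1
    have h2 : (x * X s) • rep s = x • s := by rw [mul_smul, hX]
    have h3 : ((x * X s)⁻¹ * X (x • s)) • rep s = rep s := by
      rw [mul_smul, h1, ← h2, ← mul_smul]; simp
    have := hfree _ _ h3
    exact (inv_mul_eq_one.mp this).symm
  refine ⟨fun s => PI c (X s) (rep s), fun i s => ?_⟩
  simp only [hXm, hrep2, PI_mul, hX, PI_of]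
  abel

end SecA

/-- Fox derivative -/
noncomputable def foxD {ι : Type*} (y : FreeGroup ι) : (FreeGroup ι × ι) →₀ ℝ :=
  PI (S := FreeGroup ι) (fun i g => Finsupp.single (g, i) (1:ℝ)) y 1

theorem PI_fox_aux {ι : Type*} {S : Type*} [MulAction (FreeGroup ι) S] (c : ι → S → ℝ)
    (y : FreeGroup ι) (s : S) :
    PI c y s = (foxD y).sum (fun q a => a * c q.2 (q.1 • s)) := by
  have h := PI_equivar (S' := FreeGroup ι) (fun g => g • s) (fun x g => by simp [mul_smul]) c y 1
  simp only [one_smul] at h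
  rw [h]
  let T : ((FreeGroup ι × ι) →₀ ℝ) →+ ℝ :=
    Finsupp.liftAddHom (fun q : FreeGroup ι × ι => AddMonoidHom.mulRight (c q.2 (q.1 • s)))
  have hT : ∀ f, T f = f.sum (fun q a => a * c q.2 (q.1 • s)) := fun f => rfl
  rw [← hT, foxD]
  symm
  refine PI_unique _ (fun y g => T (PI (S := FreeGroup ι) (fun i g => Finsupp.single (g, i) (1:ℝ)) y g)) ?_ ?_ y 1
  · intro x y g; simp [PI_mul]
  · intro i g
    simp [hT]

theorem PI_fox {ι : Type*} {S : Type*} [MulAction (FreeGroup ι) S] (c : ι → S → ℝ)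
    (y : FreeGroup ι) (s : S) :
    PI c y s = ∑ q ∈ (foxD y).support, foxD y q * c q.2 (q.1 • s) := PI_fox_aux c y s


section SecB

variable {G : Type*} [Group G]

/-- `f` is additive on the subgroup `H` -/
def AddOn {K : Type*} [AddCommGroup K] (H : Subgroup G) (f : G → K) : Prop :=
  ∀ x ∈ H, ∀ y ∈ H, f (x * y) = f x + f y

theorem AddOn.one {K : Type*} [AddCommGroup K] {H : Subgroup G} {f : G → K} (h : AddOn H f) :
    f 1 = 0 := by
  have := h 1 H.one_mem 1 H.one_mem
  simpa using this

theorem AddOn.inv {K : Type*} [AddCommGroup K] {H : Subgroup G} {f : G → K} (h : AddOn H f)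
    {x : G} (hx : x ∈ H) : f x⁻¹ = - f x := by
  have := h x hx x⁻¹ (H.inv_mem hx)
  rw [mul_inv_cancel, h.one] at this
  exact (neg_eq_of_add_eq_zero_right this.symm).symm

theorem AddOn.mono {K : Type*} [AddCommGroup K] {B H : Subgroup G} {f : G → K} (h : AddOn H f)
    (hB : B ≤ H) : AddOn B f := fun x hx y hy => h x (hB hx) y (hB hy)

theorem AddOn.eqOn_closure {K : Type*} [AddCommGroup K] {S : Set G} {f g : G → K}
    (hf : AddOn (Subgroup.closure S) f) (hg : AddOn (Subgroup.closure S) g)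
    (h : ∀ s ∈ S, f s = g s) : ∀ x ∈ Subgroup.closure S, f x = g x := by
  intro x hx
  induction hx using Subgroup.closure_induction with
  | mem x hx => exact h x hx
  | one => rw [hf.one, hg.one]
  | mul x y hx hy h1 h2 => rw [hf x hx y hy, hg x hx y hy, h1, h2]
  | inv x hx h1 => rw [hf.inv hx, hg.inv hx, h1]

/-- B1 -/
theorem rk_dual_false {K : Type*} [Field K] {H : Subgroup G} {n : ℕ} (hH : rkLe H n)
    (f : Fin (n+1) → G → K) (hf : ∀ i, AddOn H (f i)) (y : Fin (n+1) → G) (hy : ∀ i, y i ∈ H)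
    (hd : ∀ i j, f i (y j) = if i = j then 1 else 0) : False := by
  classical
  obtain ⟨S, hS, rfl⟩ := hH
  let T : (Fin (n+1) → K) →ₗ[K] (S → K) :=
    { toFun := fun a s => ∑ i, a i * f i s
      map_add' := by intro a b; ext s; simp [add_mul, Finset.sum_add_distrib]
      map_smul' := by intro a b; ext s; simp [Finset.mul_sum, mul_assoc] }
  have hT : Function.Injective T := by
    rw [← LinearMap.ker_eq_bot, LinearMap.ker_eq_bot']
    intro a ha
    have hadd : AddOn (Subgroup.closure (S : Set G)) (fun x => ∑ i, a i * f i x) := by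
      intro x hx y hy
      simp only [hf _ x hx y hy, mul_add, Finset.sum_add_distrib]
    have h0 : AddOn (Subgroup.closure (S : Set G)) (fun _ => (0:K)) := by
      intro x hx y hy; simp
    have := hadd.eqOn_closure h0 (fun s hs => congrFun ha ⟨s, hs⟩)
    ext j
    have h2 := this (y j) (hy j)
    simpa [hd] using h2
  have := LinearMap.finrank_le_finrank_of_injective hT
  simp at this
  omega

theorem rkLe.mono {H : Subgroup G} {m n : ℕ} (h : rkLe H m) (hmn : m ≤ n) : rkLe H n := by
  obtain ⟨S, hS, h⟩ := h
  exact ⟨S, hS.trans hmn, h⟩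

theorem rkLe.map {G' : Type*} [Group G'] {H : Subgroup G} {n : ℕ} (h : rkLe H n) (f : G →* G') :
    rkLe (H.map f) n := by
  classical
  obtain ⟨S, hS, rfl⟩ := h
  refine ⟨S.image f, Finset.card_image_le.trans hS, ?_⟩
  rw [MonoidHom.map_closure]; simp

theorem rkLe.of_map {G' : Type*} [Group G'] {H : Subgroup G} {n : ℕ} (f : G →* G')
    (hf : Function.Injective f) (h : rkLe (H.map f) n) : rkLe H n := by
  classical
  obtain ⟨S, hS, h⟩ := h
  have hsub : ∀ s ∈ S, s ∈ H.map f := by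
    intro s hs; rw [← h]; exact Subgroup.subset_closure hs
  have : (S : Set G') ⊆ Set.range f := by
    intro s hs
    obtain ⟨x, hx, rfl⟩ := hsub s hs
    exact ⟨x, rfl⟩
  refine ⟨S.preimage f hf.injOn, ?_, ?_⟩
  · rw [Finset.card_preimage]; exact (Finset.card_filter_le _ _).trans hS
  · apply Subgroup.map_injective hf
    rw [MonoidHom.map_closure, ← h]
    congr 1
    rw [Finset.coe_preimage, Set.image_preimage_eq_of_subset this]

theorem rkLe_or_embed {Y : Type*} (H : Subgroup G) (b : FreeGroupBasis Y H) (n : ℕ) :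
    rkLe H n ∨ Nonempty (Fin (n+1) ↪ Y) := by
  classical
  have htop : Subgroup.closure (Set.range b) = ⊤ := by
    have h1 : Subgroup.closure (Set.range (FreeGroup.of : Y → FreeGroup Y)) = ⊤ :=
      FreeGroup.closure_range_of Y
    have h2 := congrArg (Subgroup.map b.repr.symm.toMonoidHom) h1
    rw [MonoidHom.map_closure, ← MonoidHom.range_eq_map, MonoidHom.range_eq_top.mpr
      b.repr.symm.surjective, ← Set.range_comp] at h2
    exact h2
  by_cases h : ∃ _ : Fintype Y, Fintype.card Y ≤ n
  · left
    obtain ⟨_, hc⟩ := h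
    refine ⟨Finset.univ.image (fun y => (b y : G)), Finset.card_image_le.trans hc, ?_⟩
    have h2 := congrArg (Subgroup.map H.subtype) htop
    rw [MonoidHom.map_closure, ← Set.range_comp] at h2
    simp only [Finset.coe_image, Finset.coe_univ, Set.image_univ]
    rw [← MonoidHom.range_eq_map, Subgroup.range_subtype] at h2
    exact h2
  · right
    by_cases hfin : Finite Y
    · have := Fintype.ofFinite Y
      have : n + 1 ≤ Fintype.card Y := by
        by_contra hlt
        exact h ⟨inferInstance, by omega⟩
      exact Function.Embedding.nonempty_of_card_le (by simpa using this)
    · have : Infinite Y := not_finite_iff_infinite.mp hfin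
      exact ⟨(Fin.valEmbedding).trans (Infinite.natEmbedding Y)⟩

/-- dual functionals of a basis of a subgroup -/
theorem exists_dual {Y : Type*} {H : Subgroup G} (b : FreeGroupBasis Y H) (K : Type*)
    [AddCommGroup K] (c : Y → K) : ∃ f : G → K, AddOn H f ∧ ∀ z, f (b z) = c z := by
  classical
  let F : H →* Multiplicative K := b.lift (fun z => Multiplicative.ofAdd (c z))
  refine ⟨fun x => if hx : x ∈ H then (F ⟨x, hx⟩).toAdd else 0, ?_, ?_⟩
  · intro x hx y hy
    simp only [hx, hy, H.mul_mem hx hy, dite_true]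
    rw [← toAdd_mul, ← map_mul]; rfl
  · intro z
    simp [F]

theorem rkLe_or_dual (H : Subgroup G) [IsFreeGroup H] (n : ℕ) (K : Type*) [Field K] :
    rkLe H n ∨ ∃ (f : Fin (n+1) → G → K) (y : Fin (n+1) → G), (∀ i, AddOn H (f i)) ∧
      (∀ i, y i ∈ H) ∧ ∀ i j, f i (y j) = if i = j then 1 else 0 := by
  classical
  rcases rkLe_or_embed H (IsFreeGroup.basis H) n with h | ⟨⟨e, he⟩⟩
  · exact Or.inl h
  · right
    have := fun i : Fin (n+1) => exists_dual (IsFreeGroup.basis H) K (fun z => if e i = z then 1 else 0)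
    choose f hf1 hf2 using this
    refine ⟨f, fun j => (IsFreeGroup.basis H) (e j), hf1, fun j => Subtype.property _, ?_⟩
    intro i j
    rw [hf2]
    simp [he.eq_iff]

/-- B3 -/
theorem rkLe_of_extend (K : Type*) [Field K] {B H : Subgroup G} [IsFreeGroup B] (hBH : B ≤ H) {n : ℕ}
    (hH : rkLe H n)
    (hext : ∀ χ : G → K, AddOn B χ → ∃ f : G → K, AddOn H f ∧ ∀ b ∈ B, f b = χ b) :
    rkLe B n := by
  rcases rkLe_or_dual B n K with h | ⟨f, y, hf, hy, hd⟩
  · exact h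
  · exfalso
    choose F hF1 hF2 using fun i => hext (f i) (hf i)
    exact rk_dual_false hH F hF1 y (fun i => hBH (hy i)) (fun i j => by rw [hF2 i _ (hy j), hd])

end SecB


section SecC

theorem mk_cons_true {ι : Type*} (i : ι) (L : List (ι × Bool)) :
    FreeGroup.mk ((i, true) :: L) = FreeGroup.of i * FreeGroup.mk L := by
  rw [FreeGroup.of, FreeGroup.mul_mk]; rfl

theorem mk_cons_false {ι : Type*} (i : ι) (L : List (ι × Bool)) :
    FreeGroup.mk ((i, false) :: L) = (FreeGroup.of i)⁻¹ * FreeGroup.mk L := by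
  rw [FreeGroup.of, FreeGroup.inv_mk, FreeGroup.mul_mk]; rfl

theorem const_of_step {ι : Type*} {X : Type*} (D : FreeGroup ι → X)
    (h : ∀ i g, D (FreeGroup.of i * g) = D g) : ∀ g, D g = D 1 := by
  have : ∀ x g, D (x * g) = D g := by
    intro x
    induction x using FreeGroup.induction_on with
    | C1 => intro g; simp
    | of i => exact h i
    | inv_of i _ => intro g; rw [← h i]; simp
    | mul x y hx hy => intro g; rw [mul_assoc, hx, hy]
  intro g; simpa using this g 1

variable {ι : Type*} [DecidableEq ι]

/-- C1 -/
theorem ball_extend {K : Type*} [AddCommGroup K] (H : Subgroup (FreeGroup ι)) (r : ℕ)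
    (B : Subgroup (FreeGroup ι))
    (hB : B = Subgroup.closure {x | x ∈ H ∧ FreeGroup.norm x ≤ 2 * r})
    (χ : FreeGroup ι → K) (hχ : AddOn B χ) :
    ∃ f : FreeGroup ι → K, AddOn H f ∧ ∀ b ∈ B, f b = χ b := by
  classical
  have hBH : B ≤ H := by
    rw [hB, Subgroup.closure_le]; intro x hx; exact hx.1
  let Y : Set (FreeGroup ι) := {g | ∃ b ∈ B, FreeGroup.norm (g * b) ≤ r}
  have hY : ∀ g, ∀ h ∈ H, g ∈ Y → g * h ∈ Y → h ∈ B := by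
    rintro g h hh ⟨b, hb, h1⟩ ⟨b', hb', h2⟩
    have h3 : (g * b)⁻¹ * (g * h * b') = b⁻¹ * h * b' := by group
    have h4 : b⁻¹ * h * b' ∈ B := by
      rw [hB]
      apply Subgroup.subset_closure
      refine ⟨H.mul_mem (H.mul_mem (H.inv_mem (hBH hb)) hh) (hBH hb'), ?_⟩
      rw [← h3]
      refine (FreeGroup.norm_mul_le _ _).trans ?_
      rw [FreeGroup.norm_inv_eq]; omega
    have h5 : h = b * (b⁻¹ * h * b') * b'⁻¹ := by group
    rw [h5]
    exact B.mul_mem (B.mul_mem hb h4) (B.inv_mem hb')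
  let θ : FreeGroup ι → FreeGroup ι := fun g => ((g : FreeGroup ι ⧸ B).out)⁻¹ * g
  have hθB : ∀ g, θ g ∈ B := by
    intro g
    rw [← QuotientGroup.eq]
    exact QuotientGroup.out_eq' _
  have hθm : ∀ g, ∀ b ∈ B, θ (g * b) = θ g * b := by
    intro g b hb
    have : ((g * b : FreeGroup ι) : FreeGroup ι ⧸ B) = (g : FreeGroup ι ⧸ B) :=
      QuotientGroup.mk_mul_of_mem g hb
    simp only [θ, this, mul_assoc]
  have hχθ : ∀ g, ∀ b ∈ B, χ (θ (g * b)) = χ (θ g) + χ b := by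
    intro g b hb
    rw [hθm g b hb, hχ _ (hθB g) _ hb]
  let P : ι → FreeGroup ι → FreeGroup ι → Prop := fun i g h =>
    h ∈ H ∧ g * h ∈ Y ∧ FreeGroup.of i * g * h ∈ Y
  let c : ι → FreeGroup ι → K := fun i g =>
    if hP : ∃ h, P i g h then χ (θ (FreeGroup.of i * g * hP.choose)) - χ (θ (g * hP.choose)) else 0
  have hc : ∀ i g h, P i g h → c i g = χ (θ (FreeGroup.of i * g * h)) - χ (θ (g * h)) := by
    intro i g h hh
    have hP : ∃ h, P i g h := ⟨h, hh⟩
    simp only [c, dif_pos hP]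
    set k := hP.choose with hk
    have hkP : P i g k := hP.choose_spec
    have hb : k⁻¹ * h ∈ B := by
      refine hY (g * k) _ (H.mul_mem (H.inv_mem hkP.1) hh.1) hkP.2.1 ?_
      have : g * k * (k⁻¹ * h) = g * h := by group
      rw [this]; exact hh.2.1
    have e1 : FreeGroup.of i * g * h = FreeGroup.of i * g * k * (k⁻¹ * h) := by group
    have e2 : g * h = g * k * (k⁻¹ * h) := by group
    rw [e1, e2, hχθ _ _ hb, hχθ _ _ hb]
    abel
  have hcinv : ∀ i g, ∀ k ∈ H, c i (g * k) = c i g := by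
    intro i g k hk
    by_cases hP : ∃ h, P i (g * k) h
    · obtain ⟨h, hh⟩ := hP
      have h2 : P i g (k * h) := by
        refine ⟨H.mul_mem hk hh.1, ?_, ?_⟩
        · have := hh.2.1; rwa [mul_assoc] at this
        · have := hh.2.2
          have e : FreeGroup.of i * (g * k) * h = FreeGroup.of i * g * (k * h) := by group
          rwa [e] at this
      rw [hc _ _ _ hh, hc _ _ _ h2]
      congr 3 <;> group
    · have hP2 : ¬ ∃ h, P i g h := by
        rintro ⟨h, hh⟩
        apply hP
        refine ⟨k⁻¹ * h, H.mul_mem (H.inv_mem hk) hh.1, ?_, ?_⟩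
        · have e : g * k * (k⁻¹ * h) = g * h := by group
          rw [e]; exact hh.2.1
        · have e : FreeGroup.of i * (g * k) * (k⁻¹ * h) = FreeGroup.of i * g * h := by group
          rw [e]; exact hh.2.2
      simp only [c, dif_neg hP, dif_neg hP2]
  obtain ⟨Ψ, hΨ⟩ := exists_potential (S := FreeGroup ι) (fun x s h => by simpa using h) c
  simp only [smul_eq_mul] at hΨ
  have hD : ∀ k ∈ H, ∀ g, Ψ (g * k) - Ψ g = Ψ k - Ψ 1 := by
    intro k hk g
    have := const_of_step (fun g => Ψ (g * k) - Ψ g) (fun i g => by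
      have h1 := hΨ i (g * k)
      have h2 := hΨ i g
      rw [hcinv i g k hk] at h1
      rw [← h2] at h1
      simp only [mul_assoc]
      rw [sub_eq_sub_iff_sub_eq_sub] at h1
      exact h1) g
    simpa using this
  have hf : AddOn H (fun k => Ψ k - Ψ 1) := by
    intro x hx y hy
    have := hD y hy x
    simp only
    rw [← this]; abel
  refine ⟨_, hf, ?_⟩
  have hstep : ∀ i g, g ∈ Y → FreeGroup.of i * g ∈ Y →
      Ψ (FreeGroup.of i * g) - χ (θ (FreeGroup.of i * g)) = Ψ g - χ (θ g) := by
    intro i g h1 h2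
    have h3 := hΨ i g
    rw [hc i g 1 ⟨H.one_mem, by simpa using h1, by simpa using h2⟩] at h3
    simp only [mul_one] at h3
    rw [sub_eq_sub_iff_sub_eq_sub]
    exact h3
  have hpath : ∀ L : List (ι × Bool), (∀ u, u <:+ L → FreeGroup.mk u ∈ Y) →
      Ψ (FreeGroup.mk L) - χ (θ (FreeGroup.mk L)) = Ψ 1 - χ (θ 1) := by
    intro L
    induction L with
    | nil => intro _; rfl
    | cons a L ih =>
      intro hu
      rw [← ih (fun u h => hu u (h.trans (List.suffix_cons a L)))]
      have h1 := hu _ (List.suffix_refl _)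
      have h2 := hu _ (List.suffix_cons a L)
      obtain ⟨i, b⟩ := a
      cases b
      · rw [mk_cons_false] at h1 ⊢
        have := hstep i _ h1 (by simpa using h2)
        simp only [mul_inv_cancel_left] at this
        exact this.symm
      · rw [mk_cons_true] at h1 ⊢
        exact hstep i _ h2 h1
  subst hB
  refine (hf.mono hBH).eqOn_closure hχ ?_
  rintro b ⟨hbH, hbn⟩
  have hbB : b ∈ Subgroup.closure {x | x ∈ H ∧ FreeGroup.norm x ≤ 2 * r} :=
    Subgroup.subset_closure ⟨hbH, hbn⟩
  have := hpath b.toWord (by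
    rintro u ⟨p, hp⟩
    have hl : p.length + u.length ≤ 2 * r := by
      rw [← List.length_append, hp]; exact hbn
    by_cases hur : u.length ≤ r
    · refine ⟨1, Subgroup.one_mem _, ?_⟩
      rw [mul_one]
      exact FreeGroup.norm_mk_le.trans hur
    · refine ⟨b⁻¹, Subgroup.inv_mem _ hbB, ?_⟩
      have : FreeGroup.mk u * b⁻¹ = (FreeGroup.mk p)⁻¹ := by
        have hb2 : b = FreeGroup.mk p * FreeGroup.mk u := by
          rw [FreeGroup.mul_mk, hp, FreeGroup.mk_toWord]
        rw [hb2]; group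
      rw [this, FreeGroup.norm_inv_eq]
      exact FreeGroup.norm_mk_le.trans (by omega))
  rw [FreeGroup.mk_toWord] at this
  have e := hχθ 1 b hbB
  rw [one_mul] at e
  rw [e] at this
  have h3 : Ψ b - Ψ 1 = χ b := by
    rw [sub_eq_sub_iff_sub_eq_sub] at this
    rw [this]; abel
  exact h3

theorem ball_finite [Finite ι] (k : ℕ) : {x : FreeGroup ι | FreeGroup.norm x ≤ k}.Finite := by
  refine Set.Finite.of_finite_image (f := FreeGroup.toWord) ?_ FreeGroup.toWord_injective.injOn
  refine (List.finite_length_le (ι × Bool) k).subset ?_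
  rintro _ ⟨x, hx, rfl⟩
  exact hx

/-- C2 -/
theorem rkLe_iInf [Finite ι] (H : ℕ → Subgroup (FreeGroup ι)) (hanti : Antitone H) (n : ℕ)
    (hrk : ∀ i, rkLe (H i) n) : rkLe (⨅ i, H i) n := by
  classical
  rcases rkLe_or_dual (⨅ i, H i) n ℝ with h | ⟨f, y, hf, hy, hd⟩
  · exact h
  exfalso
  obtain ⟨r, hr⟩ : ∃ r : ℕ, ∀ j, FreeGroup.norm (y j) ≤ 2 * r := by
    refine ⟨∑ j, FreeGroup.norm (y j), fun j => ?_⟩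
    have := Finset.single_le_sum (f := fun j => FreeGroup.norm (y j)) (fun _ _ => Nat.zero_le _)
      (Finset.mem_univ j)
    omega
  have hN : ∃ N, ∀ x : FreeGroup ι, FreeGroup.norm x ≤ 2 * r → x ∈ H N → ∀ i, x ∈ H i := by
    have hx : ∀ x : FreeGroup ι, ∃ N, x ∈ H N → ∀ i, x ∈ H i := by
      intro x
      by_cases h : ∀ i, x ∈ H i
      · exact ⟨0, fun _ => h⟩
      · push Not at h
        obtain ⟨i, hi⟩ := h
        exact ⟨i, fun h => absurd h hi⟩
    choose N hN using hx
    refine ⟨(ball_finite (ι := ι) (2 * r)).toFinset.sup N, fun x hx hxN => hN x ?_⟩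
    exact hanti (Finset.le_sup (f := N) (by simpa using hx)) hxN
  obtain ⟨N, hN⟩ := hN
  let B := Subgroup.closure {x | x ∈ H N ∧ FreeGroup.norm x ≤ 2 * r}
  have hBrk : rkLe B n := rkLe_of_extend ℝ (H := H N)
    ((Subgroup.closure_le _).mpr (fun x hx => hx.1)) (hrk N)
    (fun χ hχ => ball_extend (H N) r B rfl χ hχ)
  have hBI : B ≤ ⨅ i, H i := by
    rw [Subgroup.closure_le]
    intro x hx
    exact Subgroup.mem_iInf.mpr (hN x hx.2 hx.1)
  refine rk_dual_false hBrk f (fun i => (hf i).mono hBI) y (fun j => ?_) hd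
  exact Subgroup.subset_closure ⟨Subgroup.mem_iInf.mp (hy j) N, hr j⟩

end SecC


section SecD1

/-- residual finiteness with invariance -/
theorem exists_fin_quot {ι : Type*} [Finite ι] (ψ : FreeGroup ι ≃* FreeGroup ι)
    (T : Finset (FreeGroup ι)) :
    ∃ N : Subgroup (FreeGroup ι), N.Normal ∧ N.FiniteIndex ∧ (∀ g, ψ g ∈ N ↔ g ∈ N) ∧
      ∀ g ∈ T, g ∈ N → g = 1 := by
  classical
  let ℓ := T.sup FreeGroup.norm
  let V := {x : FreeGroup ι // FreeGroup.norm x ≤ ℓ}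
  have : Finite V := ball_finite (ι := ι) ℓ
  have : Fintype V := Fintype.ofFinite V
  let N : Subgroup (FreeGroup ι) := ⨅ ρ : FreeGroup ι →* Equiv.Perm V, ρ.ker
  have hfin : Finite (FreeGroup ι →* Equiv.Perm V) := Finite.of_equiv _ FreeGroup.lift
  refine ⟨N, ?_, ?_, ?_, ?_⟩
  · exact Subgroup.normal_iInf_normal (fun ρ => inferInstance)
  · have : ∀ ρ : FreeGroup ι →* Equiv.Perm V, ρ.ker.FiniteIndex := fun ρ => inferInstance
    exact Subgroup.finiteIndex_iInf this
  · intro g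
    simp only [N, Subgroup.mem_iInf, MonoidHom.mem_ker]
    constructor
    · intro h ρ
      simpa using h (ρ.comp ψ.symm.toMonoidHom)
    · intro h ρ
      simpa using h (ρ.comp ψ.toMonoidHom)
  · intro g hg hgN
    have hgl : FreeGroup.norm g ≤ ℓ := Finset.le_sup hg
    have hσ : ∀ i : ι, ∃ σ : Equiv.Perm V, ∀ x : V, ∀ h : FreeGroup.norm (FreeGroup.of i * x.1) ≤ ℓ,
        σ x = ⟨FreeGroup.of i * x.1, h⟩ := by
      intro i
      let e : {x : V // FreeGroup.norm (FreeGroup.of i * x.1) ≤ ℓ} ≃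
          {x : V // FreeGroup.norm ((FreeGroup.of i)⁻¹ * x.1) ≤ ℓ} :=
        { toFun := fun x => ⟨⟨FreeGroup.of i * x.1.1, x.2⟩, by simpa using x.1.2⟩
          invFun := fun x => ⟨⟨(FreeGroup.of i)⁻¹ * x.1.1, x.2⟩, by simpa using x.1.2⟩
          left_inv := fun x => by simp
          right_inv := fun x => by simp }
      refine ⟨e.extendSubtype, fun x h => ?_⟩
      rw [Equiv.extendSubtype_apply_of_mem e x h]
      rfl
    choose σ hσ using hσ
    have key : ∀ L : List (ι × Bool), ∀ hL : L.length ≤ ℓ,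
        FreeGroup.lift σ (FreeGroup.mk L) ⟨1, by simp⟩ = ⟨FreeGroup.mk L, FreeGroup.norm_mk_le.trans hL⟩ := by
      intro L
      induction L with
      | nil =>
        intro hL
        have : FreeGroup.mk ([] : List (ι × Bool)) = 1 := rfl
        simp [this]
      | cons a L ih =>
        intro hL
        have hL' : L.length ≤ ℓ := by simp at hL; omega
        have h3 := ih hL'
        have h4 : FreeGroup.norm (FreeGroup.mk (a :: L)) ≤ ℓ := FreeGroup.norm_mk_le.trans hL
        obtain ⟨i, b⟩ := a
        cases b
        · have e := mk_cons_false i L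
          have : FreeGroup.lift σ (FreeGroup.mk ((i, false) :: L)) = (σ i)⁻¹ * FreeGroup.lift σ (FreeGroup.mk L) := by
            rw [e, map_mul, map_inv, FreeGroup.lift_apply_of]
          rw [this, Equiv.Perm.mul_apply, h3, Equiv.Perm.inv_eq_iff_eq]
          rw [hσ i ⟨FreeGroup.mk ((i, false) :: L), h4⟩ (by
            simp only [e, mul_inv_cancel_left]; exact FreeGroup.norm_mk_le.trans hL')]
          simp only [e, mul_inv_cancel_left]
        · have e := mk_cons_true i L
          have : FreeGroup.lift σ (FreeGroup.mk ((i, true) :: L)) = (σ i) * FreeGroup.lift σ (FreeGroup.mk L) := by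
            rw [e, map_mul, FreeGroup.lift_apply_of]
          rw [this, Equiv.Perm.mul_apply, h3, hσ i _ (by rw [← e]; exact h4)]
          simp only [e]
    have h1 := key g.toWord hgl
    have h2 : FreeGroup.lift σ g = 1 := (Subgroup.mem_iInf.mp hgN) (FreeGroup.lift σ)
    simp only [FreeGroup.mk_toWord, h2, Equiv.Perm.one_apply] at h1
    exact (Subtype.mk.inj h1).symm

open scoped InnerProductSpace in
/-- projection kernel on a finite set -/
theorem exists_proj_kernel {X : Type*} [Fintype X] (S : Submodule ℝ (X → ℝ)) :
    ∃ p : X → X → ℝ, (∀ b, ∑ a, p a b ^ 2 ≤ 1) ∧ (∀ b, ∀ s ∈ S, ∑ a, p a b * s a = 0) ∧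
      (∑ a, p a a + Module.finrank ℝ S = Fintype.card X) ∧
      (∀ σ : Equiv.Perm X, (∀ s ∈ S, s ∘ σ ∈ S) → (∀ s ∈ S, s ∘ σ.symm ∈ S) →
        ∀ a b, p (σ a) (σ b) = p a b) := by
  classical
  let e : EuclideanSpace ℝ X ≃ₗ[ℝ] (X → ℝ) := WithLp.linearEquiv 2 ℝ (X → ℝ)
  let S' : Submodule ℝ (EuclideanSpace ℝ X) := S.comap (e : EuclideanSpace ℝ X →ₗ[ℝ] (X → ℝ))
  let W := S'ᗮ
  let P := W.starProjection
  have hS' : ∀ x, x ∈ S' ↔ (e x) ∈ S := fun x => Iff.rfl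
  have hinner : ∀ x y : EuclideanSpace ℝ X, ⟪x, y⟫_ℝ = ∑ a, x a * y a := by
    intro x y
    simp [PiLp.inner_apply, mul_comm]
  refine ⟨fun a b => (P (EuclideanSpace.single b 1)) a, ?_, ?_, ?_, ?_⟩
  · intro b
    have h1 : ‖P (EuclideanSpace.single b (1:ℝ))‖ ≤ 1 := by
      have := W.norm_starProjection_apply_le (EuclideanSpace.single b (1:ℝ))
      simpa using this
    have h2 := EuclideanSpace.real_norm_sq_eq (P (EuclideanSpace.single b (1:ℝ)))
    rw [← h2]
    exact pow_le_one₀ (norm_nonneg _) h1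
  · intro b s hs
    have h1 : P (EuclideanSpace.single b (1:ℝ)) ∈ S'ᗮ := Submodule.starProjection_apply_mem _ _
    have h2 := Submodule.inner_left_of_mem_orthogonal (u := e.symm s) (K := S') (by simpa [hS'] using hs) h1
    rw [hinner] at h2
    exact h2
  · have htr : LinearMap.trace ℝ _ (P : EuclideanSpace ℝ X →ₗ[ℝ] EuclideanSpace ℝ X) = Module.finrank ℝ W := by
      apply LinearMap.IsProj.trace
      constructor
      · intro x; exact Submodule.starProjection_apply_mem _ _
      · intro x hx; exact Submodule.starProjection_eq_self_iff.mpr hx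
    have htr2 := LinearMap.trace_eq_sum_inner (P : EuclideanSpace ℝ X →ₗ[ℝ] EuclideanSpace ℝ X) (EuclideanSpace.basisFun X ℝ)
    rw [htr] at htr2
    have e1 : ∑ a, (P (EuclideanSpace.single a 1)) a = Module.finrank ℝ W := by
      rw [htr2]
      apply Finset.sum_congr rfl
      intro a _
      rw [hinner]
      simp [EuclideanSpace.basisFun_apply]
    have e2 : Module.finrank ℝ S' = Module.finrank ℝ S := by
      apply LinearEquiv.finrank_eq
      exact (e.ofSubmodule' S)
    have e3 := Submodule.finrank_add_finrank_orthogonal S'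
    rw [e1, ← e2]
    rw [finrank_euclideanSpace] at e3
    have : Module.finrank ℝ W = Module.finrank ℝ S'ᗮ := rfl
    rw [this]
    exact_mod_cast (by omega : Module.finrank ℝ S'ᗮ + Module.finrank ℝ S' = Fintype.card X)
  · intro σ h1 h2 a b
    let v : EuclideanSpace ℝ X := P (EuclideanSpace.single (σ b) 1)
    let v' : EuclideanSpace ℝ X := e.symm (fun a => v (σ a))
    have hv : v ∈ S'ᗮ := Submodule.starProjection_apply_mem _ _
    have hv2 : EuclideanSpace.single (σ b) (1:ℝ) - v ∈ S'ᗮᗮ := Submodule.sub_starProjection_mem_orthogonal _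
    have hv' : v' ∈ S'ᗮ := by
      rw [Submodule.mem_orthogonal]
      intro s hs
      have h3 := Submodule.inner_right_of_mem_orthogonal (u := e.symm ((e s) ∘ σ.symm)) (K := S')
        (by rw [hS']; simpa using h2 _ hs) hv
      rw [hinner] at h3 ⊢
      rw [← h3]
      symm
      rw [← Equiv.sum_comp σ]
      apply Finset.sum_congr rfl
      intro x _
      simp [v', e]
    have hv'2 : EuclideanSpace.single b (1:ℝ) - v' ∈ S'ᗮᗮ := by
      rw [Submodule.orthogonal_orthogonal] at hv2 ⊢
      rw [hS'] at hv2 ⊢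
      have := h1 _ hv2
      convert this using 1
      ext x
      simp [v', e, Pi.single_apply]
    have := Submodule.eq_starProjection_of_mem_orthogonal hv' hv'2
    have h5 : P (EuclideanSpace.single b 1) = v' := this
    simp only [h5]
    rfl

end SecD1


section SecD2

theorem fin_approx {ι : Type*} [Fintype ι] [DecidableEq ι] (ψ : FreeGroup ι ≃* FreeGroup ι) (m : ℕ)
    (hm : Fintype.card ι + 1 ≤ m) (y : Fin m → FreeGroup ι) (hy : ∀ j, ψ (y j) = y j)
    (T : Finset (FreeGroup ι)) :
    ∃ W : Fin m → Fin m → FreeGroup ι → ℝ,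
      (∀ j0 j g, W j0 j (ψ g) = W j0 j g) ∧
      (∀ A : Finset (FreeGroup ι), (∀ g ∈ A, ∀ g' ∈ A, g⁻¹ * g' ∈ T) →
        ∀ j0 j, ∑ g ∈ A, W j0 j g ^ 2 ≤ 1) ∧
      (∀ j0 v i, ∑ j, ∑ q ∈ (foxD (y j)).support, foxD (y j) q *
        (if q.2 = i then W j0 j (q.1⁻¹ * v) else 0) = 0) ∧
      1 ≤ ∑ j, W j j 1 ∧ (∀ j0 j g, |W j0 j g| ≤ 1) := by
  classical
  obtain ⟨N, hN, hNf, hψN, hT⟩ := exists_fin_quot ψ T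
  let Q := FreeGroup ι ⧸ N
  have : Finite Q := inferInstanceAs (Finite (FreeGroup ι ⧸ N))
  have : Fintype Q := Fintype.ofFinite Q
  let D : (ι × Q → ℝ) →ₗ[ℝ] (Fin m × Q → ℝ) :=
    { toFun := fun c a => PI (S := Q) (fun i s => c (i, s)) (y a.1) a.2
      map_add' := by
        intro c d
        ext a
        simp only [PI_fox, Pi.add_apply, mul_add, Finset.sum_add_distrib]
      map_smul' := by
        intro c d
        ext a
        simp only [PI_fox, Pi.smul_apply, smul_eq_mul, Finset.mul_sum, RingHom.id_apply]
        refine Finset.sum_congr rfl (fun q _ => by ring) }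
  have hD : ∀ c a, D c a = PI (S := Q) (fun i s => c (i, s)) (y a.1) a.2 := fun _ _ => rfl
  obtain ⟨p, hp1, hp2, hp3, hp4⟩ := exists_proj_kernel (LinearMap.range D)
  -- equivariant perms
  have hUgen : ∀ (χ : FreeGroup ι ≃* FreeGroup ι) (hχ : ∀ j, χ (y j) = y j) (τ : Q → Q)
      (hτ : ∀ g : FreeGroup ι, τ (g : Q) = ((χ g : FreeGroup ι) : Q)),
      ∀ s ∈ LinearMap.range D, (fun a : Fin m × Q => s (a.1, τ a.2)) ∈ LinearMap.range D := by
    rintro χ hχ τ hτ _ ⟨c, rfl⟩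
    refine ⟨fun a => PI (S := Q) (fun i s => c (i, s)) (χ (FreeGroup.of a.1)) (τ a.2), ?_⟩
    ext ⟨j, q⟩
    simp only [hD]
    have hτm : ∀ (x : FreeGroup ι) (q : Q), τ (x • q) = χ x • τ q := by
      intro x q
      induction q using QuotientGroup.induction_on with
      | H z =>
        have : x • (z : Q) = ((x * z : FreeGroup ι) : Q) := rfl
        rw [this, hτ, hτ, map_mul]; rfl
    have := PI_unique (S := Q) (fun i s => PI (S := Q) (fun i s => c (i, s)) (χ (FreeGroup.of i)) (τ s))
      (fun x s => PI (S := Q) (fun i s => c (i, s)) (χ x) (τ s))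
      (fun x y s => by simp only [map_mul, PI_mul, hτm]) (fun i s => rfl) (y j) q
    rw [← this, hχ]
  have hmap : ∀ (χ : FreeGroup ι ≃* FreeGroup ι), (∀ g, χ g ∈ N ↔ g ∈ N) →
      ∃ τ : Q → Q, ∀ g : FreeGroup ι, τ (g : Q) = ((χ g : FreeGroup ι) : Q) := by
    intro χ hχ
    refine ⟨QuotientGroup.map N N χ.toMonoidHom (fun g hg => (hχ g).mpr hg), fun g => rfl⟩
  obtain ⟨τ, hτ⟩ := hmap ψ hψN
  obtain ⟨τ', hτ'⟩ := hmap ψ.symm (fun g => by rw [← hψN]; simp)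
  have hττ' : ∀ q, τ (τ' q) = q := by
    intro q
    induction q using QuotientGroup.induction_on with
    | H z => rw [hτ', hτ]; simp
  have hτ'τ : ∀ q, τ' (τ q) = q := by
    intro q
    induction q using QuotientGroup.induction_on with
    | H z => rw [hτ, hτ']; simp
  let U : Equiv.Perm (Fin m × Q) :=
    { toFun := fun a => (a.1, τ a.2)
      invFun := fun a => (a.1, τ' a.2)
      left_inv := fun a => by simp [hτ'τ]
      right_inv := fun a => by simp [hττ'] }
  have hU := hp4 U (hUgen ψ hy τ hτ) (hUgen ψ.symm (fun j => by rw [MulEquiv.symm_apply_eq, hy]) τ' hτ')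
  let Rt : Q → Equiv.Perm (Fin m × Q) := fun k =>
    { toFun := fun a => (a.1, a.2 * k)
      invFun := fun a => (a.1, a.2 * k⁻¹)
      left_inv := fun a => by simp
      right_inv := fun a => by simp }
  have hRgen : ∀ k : Q, ∀ s ∈ LinearMap.range D, (fun a : Fin m × Q => s (a.1, a.2 * k)) ∈ LinearMap.range D := by
    rintro k _ ⟨c, rfl⟩
    refine ⟨fun a => c (a.1, a.2 * k), ?_⟩
    ext ⟨j, q⟩
    simp only [hD]
    symm
    refine PI_equivar (S := Q) (S' := Q) (fun q => q * k) ?_ _ _ _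
    intro x s
    induction s using QuotientGroup.induction_on with
    | H z =>
      induction k using QuotientGroup.induction_on with
      | H k => exact congrArg (QuotientGroup.mk (s := N)) (mul_assoc x z k)
  have hR : ∀ k a b, p (Rt k a) (Rt k b) = p a b := fun k =>
    hp4 (Rt k) (hRgen k) (fun s hs => hRgen k⁻¹ s hs)
  refine ⟨fun j0 j g => p (j, (g : Q)) (j0, 1), ?_, ?_, ?_, ?_, ?_⟩
  · intro j0 j g
    have := hU (j, (g : Q)) (j0, 1)
    have e1 : U (j, (g : Q)) = (j, ((ψ g : FreeGroup ι) : Q)) := by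
      change (j, τ (g : Q)) = _
      rw [hτ]
    have e2 : U (j0, (1 : Q)) = (j0, 1) := by
      change (j0, τ ((1 : FreeGroup ι) : Q)) = _
      rw [hτ, map_one]; rfl
    rw [e1, e2] at this
    exact this
  · intro A hA j0 j
    refine le_trans ?_ (hp1 (j0, 1))
    have : ∑ g ∈ A, p (j, (g : Q)) (j0, 1) ^ 2 = ∑ a ∈ Finset.image (fun g : FreeGroup ι => ((j, (QuotientGroup.mk g : Q)) : Fin m × Q)) A, p a (j0, 1) ^ 2 := by
      rw [Finset.sum_image]
      intro g hg g' hg' h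
      have h1 : (g : Q) = (g' : Q) := (Prod.mk.inj h).2
      have h2 : g⁻¹ * g' ∈ N := QuotientGroup.eq.mp h1
      have := hT _ (hA g hg g' hg') h2
      exact inv_mul_eq_one.mp this
    rw [this]
    exact Finset.sum_le_sum_of_subset_of_nonneg (Finset.subset_univ _) (fun _ _ _ => sq_nonneg _)
  · intro j0 v i
    let c : ι × Q → ℝ := fun a => if a = (i, (v : Q)) then 1 else 0
    have h1 := hp2 (j0, 1) (D c) ⟨c, rfl⟩
    rw [Fintype.sum_prod_type] at h1
    refine Eq.trans ?_ h1
    refine Finset.sum_congr rfl (fun j _ => ?_)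
    simp only [hD, PI_fox, Finset.mul_sum]
    refine Eq.trans ?_ Finset.sum_comm
    refine Finset.sum_congr rfl (fun q _ => ?_)
    by_cases hq : q.2 = i
    · rw [if_pos hq, Finset.sum_eq_single ((q.1⁻¹ * v : FreeGroup ι) : Q)]
      · have e : q.1 • ((q.1⁻¹ * v : FreeGroup ι) : Q) = (v : Q) := by
          change ((q.1 * (q.1⁻¹ * v) : FreeGroup ι) : Q) = _
          rw [mul_inv_cancel_left]
        simp only [c, e, hq, if_true]
        ring
      · intro b _ hb
        have : ¬ ((q.2, q.1 • b) = (i, (v : Q))) := by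
          intro h
          apply hb
          have h2 := (Prod.mk.inj h).2
          rw [← inv_smul_eq_iff.mpr h2.symm]
          rfl
        simp [c, this]
      · intro h; exact absurd (Finset.mem_univ _) h
    · rw [if_neg hq]
      symm
      rw [mul_zero]
      apply Finset.sum_eq_zero
      intro b _
      have : ¬ ((q.2, q.1 • b) = (i, (v : Q))) := fun h => hq (Prod.mk.inj h).1
      simp [c, this]
  · have h1 : ∀ j (q : Q), p (j, q) (j, q) = p (j, ((1 : FreeGroup ι) : Q)) (j, 1) := by
      intro j q
      have := hR q (j, 1) (j, 1)
      have e : Rt q (j, 1) = (j, q) := by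
        change (j, 1 * q) = _
        rw [one_mul]
      rw [e] at this
      exact this
    rw [Fintype.sum_prod_type] at hp3
    simp only [h1, Finset.sum_const, Finset.card_univ, nsmul_eq_mul] at hp3
    rw [← Finset.mul_sum] at hp3
    have hdim : Module.finrank ℝ (LinearMap.range D) ≤ Fintype.card ι * Fintype.card Q := by
      have := LinearMap.finrank_range_le D
      simpa using this
    have hcard : Fintype.card (Fin m × Q) = m * Fintype.card Q := by simp
    rw [hcard] at hp3
    have hQ : (0:ℝ) < Fintype.card Q := by
      exact_mod_cast Fintype.card_pos_iff.mpr ⟨(1 : Q)⟩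
    have h3 : ((Module.finrank ℝ (LinearMap.range D) : ℕ) : ℝ) ≤ Fintype.card ι * Fintype.card Q := by
      exact_mod_cast hdim
    have h4 : ((Fintype.card ι + 1 : ℕ) : ℝ) ≤ m := by exact_mod_cast hm
    push_cast at hp3 h4
    have h5 : (Fintype.card Q : ℝ) * 1 ≤ Fintype.card Q * ∑ j, p (j, ((1 : FreeGroup ι) : Q)) (j, 1) := by
      nlinarith
    exact le_of_mul_le_mul_left h5 hQ
  · intro j0 j g
    have h1 := hp1 (j0, 1)
    have h2 := Finset.single_le_sum (f := fun a => p a (j0, (1:Q)) ^ 2) (fun _ _ => sq_nonneg _)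
      (Finset.mem_univ (j, (g : Q)))
    have h3 : p (j, (g : Q)) (j0, 1) ^ 2 ≤ 1 := h2.trans h1
    exact (sq_le_one_iff_abs_le_one _).mp h3

/-- limit objects -/
theorem lim_approx {ι : Type*} [Fintype ι] [DecidableEq ι] (ψ : FreeGroup ι ≃* FreeGroup ι) (m : ℕ)
    (hm : Fintype.card ι + 1 ≤ m) (y : Fin m → FreeGroup ι) (hy : ∀ j, ψ (y j) = y j) :
    ∃ W : Fin m → Fin m → FreeGroup ι → ℝ,
      (∀ j0 j g, W j0 j (ψ g) = W j0 j g) ∧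
      (∀ A : Finset (FreeGroup ι), ∀ j0 j, ∑ g ∈ A, W j0 j g ^ 2 ≤ 1) ∧
      (∀ j0 v i, ∑ j, ∑ q ∈ (foxD (y j)).support, foxD (y j) q *
        (if q.2 = i then W j0 j (q.1⁻¹ * v) else 0) = 0) ∧
      1 ≤ ∑ j, W j j 1 := by
  classical
  choose W h1 h2 h3 h4 h5 using fin_approx ψ m hm y hy
  let 𝒰 : Ultrafilter (Finset (FreeGroup ι)) := Ultrafilter.of Filter.atTop
  have hlim : ∀ j0 j g, ∃ x : ℝ, Filter.Tendsto (fun T => W T j0 j g) 𝒰 (nhds x) := by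
    intro j0 j g
    have hc : IsCompact (Set.Icc (-1:ℝ) 1) := isCompact_Icc
    obtain ⟨x, _, hx⟩ := hc.ultrafilter_le_nhds (𝒰.map (fun T => W T j0 j g)) (by
      rw [Filter.le_principal_iff]
      change ∀ᶠ T in (𝒰 : Filter _), W T j0 j g ∈ Set.Icc (-1:ℝ) 1
      exact Filter.Eventually.of_forall (fun T => abs_le.mp (h5 T j0 j g)))
    exact ⟨x, hx⟩
  choose w hw using hlim
  refine ⟨w, ?_, ?_, ?_, ?_⟩
  · intro j0 j g
    refine tendsto_nhds_unique (hw j0 j (ψ g)) ?_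
    simp only [h1]
    exact hw j0 j g
  · intro A j0 j
    have ht : Filter.Tendsto (fun T => ∑ g ∈ A, W T j0 j g ^ 2) 𝒰 (nhds (∑ g ∈ A, w j0 j g ^ 2)) :=
      tendsto_finsetSum _ (fun g _ => (hw j0 j g).pow 2)
    refine le_of_tendsto ht ?_
    have hev : ∀ᶠ T in (Filter.atTop : Filter (Finset (FreeGroup ι))),
        (A ×ˢ A).image (fun q => q.1⁻¹ * q.2) ⊆ T := Filter.eventually_ge_atTop _
    have hev2 := (Ultrafilter.of_le (Filter.atTop : Filter (Finset (FreeGroup ι)))) hev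
    filter_upwards [hev2] with T hT
    refine h2 T A ?_ j0 j
    intro g hg g' hg'
    apply hT
    exact Finset.mem_image.mpr ⟨(g, g'), by simp [hg, hg'], rfl⟩
  · intro j0 v i
    have ht : Filter.Tendsto (fun T => ∑ j, ∑ q ∈ (foxD (y j)).support, foxD (y j) q *
        (if q.2 = i then W T j0 j (q.1⁻¹ * v) else 0)) 𝒰 (nhds (∑ j, ∑ q ∈ (foxD (y j)).support, foxD (y j) q *
        (if q.2 = i then w j0 j (q.1⁻¹ * v) else 0))) := by
      refine tendsto_finsetSum _ (fun j _ => tendsto_finsetSum _ (fun q _ => ?_))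
      refine Filter.Tendsto.const_mul _ ?_
      split_ifs
      · exact hw _ _ _
      · exact tendsto_const_nhds
    simp only [h3] at ht
    exact (tendsto_nhds_unique ht tendsto_const_nhds)
  · have ht : Filter.Tendsto (fun T => ∑ j, W T j j 1) 𝒰 (nhds (∑ j, w j j 1)) :=
      tendsto_finsetSum _ (fun j _ => hw j j 1)
    exact ge_of_tendsto ht (Filter.Eventually.of_forall (fun T => h4 T))

end SecD2


section SecD3

theorem supp_finite_orbit {G : Type*} [Group G] (ψ : G ≃* G) (w : G → ℝ)
    (hinv : ∀ g, w (ψ g) = w g) (hb : ∀ A : Finset G, ∑ g ∈ A, w g ^ 2 ≤ 1) (g : G)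
    (hg : w g ≠ 0) : ∃ k : ℕ, 0 < k ∧ (ψ ^ k) g = g := by
  classical
  by_contra hcon
  push Not at hcon
  have hinvk : ∀ k : ℕ, w ((ψ ^ k) g) = w g := by
    intro k
    induction k with
    | zero => simp
    | succ k ih => rw [pow_succ', MulAut.mul_apply, hinv, ih]
  have hinj : Function.Injective (fun k : ℕ => (ψ ^ k) g) := by
    have key : ∀ a b : ℕ, a < b → (ψ ^ a) g ≠ (ψ ^ b) g := by
      intro a b hab h
      apply hcon (b - a) (by omega)
      have e : ψ ^ b = ψ ^ a * ψ ^ (b - a) := by rw [← pow_add]; congr 1; omega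
      rw [e, MulAut.mul_apply] at h
      exact ((ψ ^ a).injective h).symm
    intro a b h
    rcases lt_trichotomy a b with h1 | h1 | h1
    · exact absurd h (key a b h1)
    · exact h1
    · exact absurd h.symm (key b a h1)
  have hpos : 0 < w g ^ 2 := by positivity
  obtain ⟨n, hn⟩ := exists_nat_gt (1 / w g ^ 2)
  have := hb ((Finset.range n).image (fun k : ℕ => (ψ ^ k) g))
  rw [Finset.sum_image hinj.injOn] at this
  simp only [hinvk, Finset.sum_const, Finset.card_range, nsmul_eq_mul] at this
  rw [div_lt_iff₀ hpos] at hn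
  linarith

theorem edge_vanish {ι : Type*} [Fintype ι] [DecidableEq ι] {m : ℕ} (R : Subgroup (FreeGroup ι))
    {Y : Type*} (b : FreeGroupBasis Y R) (e : Fin m ↪ Y) (w : Fin m → FreeGroup ι → ℝ)
    (hsupp : ∀ j g, w j g ≠ 0 → g ∈ R)
    (hedge : ∀ v i, ∑ j, ∑ q ∈ (foxD (b (e j) : FreeGroup ι)).support,
      foxD (b (e j) : FreeGroup ι) q * (if q.2 = i then w j (q.1⁻¹ * v) else 0) = 0)
    (j0 : Fin m) : w j0 1 = 0 := by
  classical
  -- potential on R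
  let cY : Y → FreeGroup Y → ℝ := fun z x => if z = e j0 ∧ x = 1 then 1 else 0
  obtain ⟨Θ, hΘ⟩ := exists_potential (S := FreeGroup Y) (fun x s h => by simpa using h) cY
  have hcY : cY = fun i s => Θ (FreeGroup.of i • s) - Θ s := by
    funext i s; rw [hΘ]
  have hfin : ∀ d : FreeGroup Y, {z | Θ (d * z) - Θ z ≠ 0}.Finite := by
    intro d
    refine (((foxD d).support.image (fun q => q.1⁻¹)).finite_toSet).subset ?_
    intro z hz
    have h1 := PI_potential (S := FreeGroup Y) Θ d z
    rw [← hcY, PI_fox] at h1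
    have hz' : Θ (d • z) - Θ z ≠ 0 := hz
    rw [← h1] at hz'
    obtain ⟨q, hq, hq2⟩ := Finset.exists_ne_zero_of_sum_ne_zero hz'
    have h3 : cY q.2 (q.1 • z) ≠ 0 := right_ne_zero_of_mul hq2
    simp only [cY, ne_eq, ite_eq_right_iff, not_forall] at h3
    obtain ⟨⟨_, h4⟩, _⟩ := h3
    simp only [Finset.coe_image, Set.mem_image]
    refine ⟨q, hq, ?_⟩
    rw [smul_eq_mul] at h4
    exact (eq_inv_of_mul_eq_one_right h4).symm
  -- equivariant map to R
  let ρ0 : FreeGroup ι → FreeGroup ι := fun g => ((g : FreeGroup ι ⧸ R).out)⁻¹ * g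
  have hρ0 : ∀ g, ρ0 g ∈ R := by
    intro g
    rw [← QuotientGroup.eq]
    exact QuotientGroup.out_eq' _
  have hρ0m : ∀ g, ∀ r ∈ R, ρ0 (g * r) = ρ0 g * r := by
    intro g r hr
    have : ((g * r : FreeGroup ι) : FreeGroup ι ⧸ R) = (g : FreeGroup ι ⧸ R) :=
      QuotientGroup.mk_mul_of_mem g hr
    simp only [ρ0, this, mul_assoc]
  let ρ : FreeGroup ι → R := fun g => ⟨(ρ0 1)⁻¹ * ρ0 g, R.mul_mem (R.inv_mem (hρ0 1)) (hρ0 g)⟩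
  have hρm : ∀ g (r : R), ρ (g * r) = ρ g * r := by
    intro g r
    apply Subtype.ext
    simp only [ρ, hρ0m g r r.2, mul_assoc, Subgroup.coe_mul]
  have hρR : ∀ r : R, ρ r = r := by
    intro r
    have h1 := hρm 1 r
    have h2 : ρ 1 = 1 := by apply Subtype.ext; simp [ρ]
    rwa [one_mul, h2, one_mul] at h1
  let Ω : FreeGroup ι → ℝ := fun g => Θ (b.repr (ρ g))
  let c0 : ι → FreeGroup ι → ℝ := fun i v => Ω (FreeGroup.of i * v) - Ω v
  have hPI : ∀ j g, g ∈ R → PI (S := FreeGroup ι) c0 (b (e j)) g = if j = j0 ∧ g = 1 then 1 else 0 := by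
    intro j g hg
    have h1 := PI_potential (S := FreeGroup ι) Ω (b (e j) : FreeGroup ι) g
    have h2 : PI (S := FreeGroup ι) c0 (b (e j)) g = Ω ((b (e j) : FreeGroup ι) * g) - Ω g := h1
    rw [h2]
    have h3 : ρ ((b (e j) : FreeGroup ι) * g) = b (e j) * ⟨g, hg⟩ := hρR (b (e j) * ⟨g, hg⟩)
    have h4 : ρ g = ⟨g, hg⟩ := hρR ⟨g, hg⟩
    simp only [Ω, h3, h4, map_mul, FreeGroupBasis.repr_apply_coe]
    have h5 := hΘ (e j) (b.repr ⟨g, hg⟩)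
    rw [smul_eq_mul] at h5
    rw [h5]
    have h6 : b.repr ⟨g, hg⟩ = 1 ↔ g = 1 := by
      rw [map_eq_one_iff b.repr b.repr.injective]
      constructor
      · intro h; exact congrArg Subtype.val h
      · intro h; exact Subtype.ext h
    simp only [cY, h6, e.injective.eq_iff]
  have hfin2 : ∀ i u, {v | u⁻¹ * v ∈ R ∧ c0 i v ≠ 0}.Finite := by
    intro i u
    let a : R := ρ (FreeGroup.of i * u)
    let d : FreeGroup Y := b.repr (a * (ρ u)⁻¹)
    refine ((hfin d).image (fun z => u * ((ρ u)⁻¹ * b.repr.symm z : R))).subset ?_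
    rintro v ⟨hv, hv2⟩
    let g : R := ⟨u⁻¹ * v, hv⟩
    have hvg : v = u * g := by simp [g]
    refine ⟨b.repr (ρ u * g), ?_, ?_⟩
    · have e1 : ρ v = ρ u * g := by rw [hvg, hρm]
      have e2 : ρ (FreeGroup.of i * v) = a * g := by rw [hvg, ← mul_assoc, hρm]
      have h7 : c0 i v = Θ (b.repr (a * g)) - Θ (b.repr (ρ u * g)) := by
        simp only [c0, Ω, e1, e2]
      rw [h7] at hv2
      have e3 : d * b.repr (ρ u * g) = b.repr (a * g) := by
        simp only [d]; rw [← map_mul]; congr 1; group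
      change Θ (d * b.repr (ρ u * g)) - Θ (b.repr (ρ u * g)) ≠ 0
      rw [e3]; exact hv2
    · simp [hvg]
  let y : Fin m → FreeGroup ι := fun j => b (e j)
  -- finite vertex set
  let Vs : Set (FreeGroup ι) := ⋃ j, ⋃ q ∈ (foxD (y j)).support, {v | q.1⁻¹ * v ∈ R ∧ c0 q.2 v ≠ 0}
  have hVs : Vs.Finite := by
    refine Set.finite_iUnion (fun j => ?_)
    exact Set.Finite.biUnion (Finset.finite_toSet _) (fun q _ => hfin2 _ _)
  let V := hVs.toFinset
  let Gs : Finset (FreeGroup ι) := insert 1 (Finset.univ.biUnion (fun j =>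
    (foxD (y j)).support.biUnion (fun q => V.image (fun v => q.1⁻¹ * v))))
  have hin : ∀ j, ∀ q ∈ (foxD (y j)).support,
      ∑ v ∈ V, c0 q.2 v * w j (q.1⁻¹ * v) = ∑ g ∈ Gs, c0 q.2 (q.1 * g) * w j g := by
    intro j q hq
    have hs : ∀ v, c0 q.2 v * w j (q.1⁻¹ * v) ≠ 0 → v ∈ V := by
      intro v hv
      have h1 := left_ne_zero_of_mul hv
      have h2 := hsupp _ _ (right_ne_zero_of_mul hv)
      simp only [V, Set.Finite.mem_toFinset, Vs, Set.mem_iUnion]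
      exact ⟨j, q, hq, h2, h1⟩
    rw [← finsum_eq_sum_of_support_subset (s := V) (fun v => c0 q.2 v * w j (q.1⁻¹ * v)) (fun v hv => hs v hv)]
    rw [← finsum_comp_equiv (Equiv.mulLeft q.1)]
    simp only [Equiv.coe_mulLeft, inv_mul_cancel_left]
    refine finsum_eq_sum_of_support_subset _ ?_
    intro g hg
    have h3 := hs (q.1 * g) (by simpa using hg)
    simp only [Gs, Finset.coe_insert, Set.mem_insert_iff]
    right
    simp only [Finset.coe_biUnion, Set.mem_iUnion]
    refine ⟨j, by simp, q, hq, ?_⟩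
    simp only [Finset.coe_image]
    exact ⟨q.1 * g, h3, by simp⟩
  have htot : (0:ℝ) = ∑ j, ∑ g ∈ Gs, w j g * PI (S := FreeGroup ι) c0 (y j) g := by
    calc (0:ℝ) = ∑ v ∈ V, ∑ i, c0 i v * ∑ j, ∑ q ∈ (foxD (y j)).support,
          foxD (y j) q * (if q.2 = i then w j (q.1⁻¹ * v) else 0) := by
            symm
            refine Finset.sum_eq_zero (fun v _ => Finset.sum_eq_zero (fun i _ => ?_))
            rw [hedge v i, mul_zero]
      _ = ∑ v ∈ V, ∑ j, ∑ q ∈ (foxD (y j)).support, foxD (y j) q * (c0 q.2 v * w j (q.1⁻¹ * v)) := by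
            refine Finset.sum_congr rfl (fun v _ => ?_)
            simp only [Finset.mul_sum]
            rw [Finset.sum_comm]
            refine Finset.sum_congr rfl (fun j _ => ?_)
            rw [Finset.sum_comm]
            refine Finset.sum_congr rfl (fun q _ => ?_)
            rw [Finset.sum_eq_single q.2]
            · simp only [if_true]; ring
            · intro i _ hi; rw [if_neg (Ne.symm hi)]; ring
            · intro h; exact absurd (Finset.mem_univ _) h
      _ = ∑ j, ∑ q ∈ (foxD (y j)).support, foxD (y j) q * ∑ v ∈ V, (c0 q.2 v * w j (q.1⁻¹ * v)) := by
            rw [Finset.sum_comm]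
            refine Finset.sum_congr rfl (fun j _ => ?_)
            rw [Finset.sum_comm]
            refine Finset.sum_congr rfl (fun q _ => ?_)
            rw [Finset.mul_sum]
      _ = ∑ j, ∑ q ∈ (foxD (y j)).support, foxD (y j) q * ∑ g ∈ Gs, (c0 q.2 (q.1 * g) * w j g) := by
            refine Finset.sum_congr rfl (fun j _ => Finset.sum_congr rfl (fun q hq => ?_))
            rw [hin j q hq]
      _ = _ := by
            refine Finset.sum_congr rfl (fun j _ => ?_)
            simp only [PI_fox, Finset.mul_sum]
            rw [Finset.sum_comm]
            refine Finset.sum_congr rfl (fun g _ => Finset.sum_congr rfl (fun q _ => ?_))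
            rw [smul_eq_mul]; ring
  have hval : ∀ j g, w j g * PI (S := FreeGroup ι) c0 (y j) g = w j g * (if j = j0 ∧ g = 1 then 1 else 0) := by
    intro j g
    by_cases h : w j g = 0
    · simp [h]
    · rw [hPI j g (hsupp _ _ h)]
  simp only [hval] at htot
  rw [Finset.sum_eq_single j0, Finset.sum_eq_single 1] at htot
  · simpa using htot.symm
  · intro g _ hg; simp [hg]
  · intro h; exact absurd (Finset.mem_insert_self _ _) h
  · intro j _ hj; simp [hj]
  · intro h; exact absurd (Finset.mem_univ _) h

/-- periodic elements -/
def perSub {G : Type*} [Group G] (φ : G ≃* G) : Subgroup G where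
  carrier := {g | ∃ k : ℕ, 0 < k ∧ (φ ^ k) g = g}
  one_mem' := ⟨1, one_pos, by simp⟩
  mul_mem' := by
    rintro a b ⟨k, hk, hka⟩ ⟨l, hl, hlb⟩
    refine ⟨k * l, Nat.mul_pos hk hl, ?_⟩
    have h1 : ∀ (χ : G ≃* G) (x : G), χ x = x → ∀ n : ℕ, (χ ^ n) x = x := by
      intro χ x h n
      induction n with
      | zero => simp
      | succ n ih => rw [pow_succ, MulAut.mul_apply, h, ih]
    rw [map_mul]
    have e1 : (φ ^ (k * l)) a = a := by rw [pow_mul]; exact h1 _ _ hka _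
    have e2 : (φ ^ (k * l)) b = b := by rw [mul_comm, pow_mul]; exact h1 _ _ hlb _
    rw [e1, e2]
  inv_mem' := by
    rintro a ⟨k, hk, hka⟩
    exact ⟨k, hk, by rw [map_inv, hka]⟩

theorem pow_fix {G : Type*} [Group G] (χ : G ≃* G) (x : G) (h : χ x = x) (n : ℕ) :
    (χ ^ n) x = x := by
  induction n with
  | zero => simp
  | succ n ih => rw [pow_succ, MulAut.mul_apply, h, ih]

/-- Section D -/
theorem rkLe_per {ι : Type*} [Fintype ι] (φ : FreeGroup ι ≃* FreeGroup ι) :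
    rkLe (perSub φ) (Fintype.card ι) := by
  classical
  rcases rkLe_or_embed (perSub φ) (IsFreeGroup.basis (perSub φ)) (Fintype.card ι) with h | h
  · exact h
  exfalso
  obtain ⟨e⟩ := h
  set b := IsFreeGroup.basis (perSub φ) with hb
  have hper : ∀ j, ∃ k : ℕ, 0 < k ∧ (φ ^ k) (b (e j) : FreeGroup ι) = (b (e j) : FreeGroup ι) :=
    fun j => (b (e j)).2
  choose k hk hk2 using hper
  let n := ∏ j, k j
  have hn : 0 < n := Finset.prod_pos (fun j _ => hk j)
  let ψ := φ ^ n
  have hψ : ∀ j, ψ (b (e j) : FreeGroup ι) = (b (e j) : FreeGroup ι) := by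
    intro j
    obtain ⟨d, hd⟩ : k j ∣ n := Finset.dvd_prod_of_mem k (Finset.mem_univ j)
    simp only [ψ, hd, pow_mul]
    exact pow_fix _ _ (hk2 j) d
  obtain ⟨W, h1, h2, h3, h4⟩ := lim_approx ψ (Fintype.card ι + 1) le_rfl
    (fun j => (b (e j) : FreeGroup ι)) hψ
  have h0 : ∀ j, W j j 1 = 0 := by
    intro j
    refine edge_vanish (perSub φ) b e (W j) ?_ (h3 j) j
    intro j' g hg
    obtain ⟨l, hl, hl2⟩ := supp_finite_orbit ψ (W j j') (h1 j j') (fun A => h2 A j j') g hg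
    refine ⟨n * l, Nat.mul_pos hn hl, ?_⟩
    rw [pow_mul]; exact hl2
  simp only [h0, Finset.sum_const_zero] at h4
  linarith

end SecD3


section SecE1

variable {X : Type*} {K : Type*} [AddCommGroup K]

/-- coboundary on lists -/
def cob : (List X → K) → List X → K
  | _, [] => 0
  | φ, a :: l => φ l - cob (fun m => φ (a :: m)) l

/-- prism -/
def prism (f g : X → X) : (List X → K) → List X → K
  | _, [] => 0
  | φ, a :: l => φ (f a :: g a :: l.map g) - prism f g (fun m => φ (f a :: m)) l

/-- pull back -/
def pull (f : X → X) (φ : List X → K) : List X → K := fun l => φ (l.map f)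

@[simp] theorem cob_nil (φ : List X → K) : cob φ [] = 0 := rfl
theorem cob_cons (φ : List X → K) (a : X) (l : List X) :
    cob φ (a :: l) = φ l - cob (fun m => φ (a :: m)) l := rfl

theorem cob_add (φ ψ : List X → K) (l : List X) : cob (φ + ψ) l = cob φ l + cob ψ l := by
  induction l generalizing φ ψ with
  | nil => simp
  | cons a l ih =>
    have := ih (fun m => φ (a :: m)) (fun m => ψ (a :: m))
    simp only [cob_cons, Pi.add_apply]
    have e : (fun m => φ (a :: m) + ψ (a :: m)) = (fun m => φ (a :: m)) + (fun m => ψ (a :: m)) := rfl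
    rw [e, this]; abel

theorem cob_zero (l : List X) : cob (0 : List X → K) l = 0 := by
  have := cob_add (0 : List X → K) 0 l
  simpa using this

theorem cob_neg (φ : List X → K) (l : List X) : cob (-φ) l = - cob φ l := by
  have := cob_add φ (-φ) l
  rw [add_neg_cancel, cob_zero] at this
  exact (neg_eq_of_add_eq_zero_right this.symm).symm

theorem cob_sub (φ ψ : List X → K) (l : List X) : cob (φ - ψ) l = cob φ l - cob ψ l := by
  rw [sub_eq_add_neg, cob_add, cob_neg, ← sub_eq_add_neg]

theorem cob_sum {s : Finset ℕ} (φ : ℕ → List X → K) (l : List X) :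
    cob (fun m => ∑ n ∈ s, φ n m) l = ∑ n ∈ s, cob (φ n) l := by
  classical
  induction s using Finset.induction_on with
  | empty => simp only [Finset.sum_empty]; exact cob_zero l
  | insert a s ha ih =>
    simp only [Finset.sum_insert ha]
    rw [← ih]
    exact cob_add (φ a) (fun m => ∑ n ∈ s, φ n m) l

theorem cob_congr {φ ψ : List X → K} {l : List X}
    (h : ∀ m, m.Sublist l → m.length + 1 = l.length → φ m = ψ m) : cob φ l = cob ψ l := by
  induction l generalizing φ ψ with
  | nil => rfl
  | cons a l ih =>
    rw [cob_cons, cob_cons, h l (List.sublist_cons_self a l) rfl]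
    congr 1
    apply ih
    intro m hm hl
    exact h _ (hm.cons_cons a) (by simp [hl])

theorem cob_pull (f : X → X) (φ : List X → K) (l : List X) :
    cob (pull f φ) l = cob φ (l.map f) := by
  induction l generalizing φ with
  | nil => rfl
  | cons a l ih =>
    rw [List.map_cons, cob_cons, cob_cons, ← ih]
    rfl

theorem cob_cob (φ : List X → K) (l : List X) : cob (cob φ) l = 0 := by
  induction l generalizing φ with
  | nil => rfl
  | cons a l ih =>
    rw [cob_cons]
    have e : (fun m => cob φ (a :: m)) = φ - cob (fun m => φ (a :: m)) := by
      funext m; rw [cob_cons]; rfl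
    rw [e, cob_sub, ih]; simp

theorem prism_sub (f g : X → X) (φ ψ : List X → K) (l : List X) :
    prism f g (φ - ψ) l = prism f g φ l - prism f g ψ l := by
  induction l generalizing φ ψ with
  | nil => simp [prism]
  | cons a l ih =>
    have := ih (fun m => φ (f a :: m)) (fun m => ψ (f a :: m))
    simp only [prism, Pi.sub_apply]
    have e : (fun m => φ (f a :: m) - ψ (f a :: m)) = (fun m => φ (f a :: m)) - (fun m => ψ (f a :: m)) := rfl
    rw [e, this]; abel

theorem prism_id (f g : X → X) (φ : List X → K) (l : List X) :
    cob (prism f g φ) l + prism f g (cob φ) l = φ (l.map g) - φ (l.map f) := by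
  induction l generalizing φ with
  | nil => simp [prism]
  | cons a l ih =>
    have e1 : (fun m => prism f g φ (a :: m)) =
        pull g (fun m => φ (f a :: g a :: m)) - prism f g (fun m => φ (f a :: m)) := by
      funext m; rfl
    have e2 : (fun m => cob φ (f a :: m)) = φ - cob (fun m => φ (f a :: m)) := by
      funext m; rfl
    have ih' := ih (fun m => φ (f a :: m))
    rw [cob_cons, e1, cob_sub, cob_pull]
    have e3 : prism f g (cob φ) (a :: l) = cob φ (f a :: g a :: l.map g)
      - prism f g (fun m => cob φ (f a :: m)) l := rfl
    rw [e3, e2, prism_sub, cob_cons, cob_cons]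
    simp only [List.map_cons]
    have e4 : cob (prism f g (fun m => φ (f a :: m))) l =
      φ (f a :: l.map g) - φ (f a :: l.map f) - prism f g (cob (fun m => φ (f a :: m))) l := by
      rw [← ih']; abel
    rw [e4]
    abel

theorem prism_eq_zero (f g : X → X) {φ : List X → K} {l : List X}
    (h : ∀ l1 a l2, l = l1 ++ a :: l2 → φ (l1.map f ++ f a :: g a :: l2.map g) = 0) :
    prism f g φ l = 0 := by
  induction l generalizing φ with
  | nil => rfl
  | cons a l ih =>
    have h1 := h [] a l rfl
    simp only [List.map_nil, List.nil_append] at h1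
    have h2 := ih (φ := fun m => φ (f a :: m)) (fun l1 b l2 hl => by
      have := h (a :: l1) b l2 (by rw [hl]; rfl)
      simpa using this)
    change φ (f a :: g a :: l.map g) - prism f g (fun m => φ (f a :: m)) l = 0
    rw [h1, h2, sub_zero]

theorem cob_repeat {φ : List X → K} (h : ∀ l : List X, ¬ l.IsChain (· ≠ ·) → φ l = 0) (l : List X)
    (hl : ¬ l.IsChain (· ≠ ·)) : cob φ l = 0 := by
  induction l generalizing φ with
  | nil => simp at hl
  | cons a l ih =>
    have hφa : ∀ m : List X, ¬ m.IsChain (· ≠ ·) → φ (a :: m) = 0 := by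
      intro m hm
      apply h
      intro hc
      exact hm hc.tail
    by_cases hl2 : l.IsChain (· ≠ ·)
    · cases l with
      | nil => simp at hl
      | cons b l =>
        have hab : a = b := by
          by_contra hne
          exact hl (List.IsChain.cons_cons hne hl2)
        subst hab
        rw [cob_cons, cob_cons]
        have : (fun m => φ (a :: a :: m)) = (0 : List X → K) := by
          funext m
          apply h
          intro hc
          rw [List.isChain_cons_cons] at hc
          exact hc.1 rfl
        rw [this, cob_zero]; simp
    · rw [cob_cons, ih hφa hl2, h l hl2, sub_zero]

variable [PartialOrder X]

/-- cochain supported on strict chains of length more than `k` -/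
def Sup (k : ℕ) (φ : List X → K) : Prop := ∀ l, φ l ≠ 0 → l.Pairwise (· < ·) ∧ k < l.length

open Classical in
/-- restricted coboundary -/
noncomputable def dd (φ : List X → K) : List X → K :=
  fun l => if l.Pairwise (· < ·) then cob φ l else 0

theorem dd_of {φ : List X → K} {l : List X} (h : l.Pairwise (· < ·)) : dd φ l = cob φ l := if_pos h
theorem dd_not {φ : List X → K} {l : List X} (h : ¬ l.Pairwise (· < ·)) : dd φ l = 0 := if_neg h

theorem dd_add (φ ψ : List X → K) : dd (φ + ψ) = dd φ + dd ψ := by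
  funext l
  by_cases h : l.Pairwise (· < ·)
  · simp only [Pi.add_apply, dd_of h, cob_add]
  · simp only [Pi.add_apply, dd_not h, add_zero]

theorem dd_sub (φ ψ : List X → K) : dd (φ - ψ) = dd φ - dd ψ := by
  funext l
  by_cases h : l.Pairwise (· < ·)
  · simp only [Pi.sub_apply, dd_of h, cob_sub]
  · simp only [Pi.sub_apply, dd_not h, sub_zero]

theorem dd_zero : dd (0 : List X → K) = 0 := by
  have := dd_add (0 : List X → K) 0
  simpa using this

theorem dd_dd (φ : List X → K) : dd (dd φ) = 0 := by
  funext l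
  by_cases h : l.Pairwise (· < ·)
  · rw [dd_of h, Pi.zero_apply, ← cob_cob φ l]
    exact cob_congr (fun m hm _ => dd_of (h.sublist hm))
  · exact dd_not h

theorem dd_pull (f : X → X) (hf : ∀ a b, f a < f b ↔ a < b) (φ : List X → K) :
    dd (pull f φ) = pull f (dd φ) := by
  funext l
  have e : (l.map f).Pairwise (· < ·) ↔ l.Pairwise (· < ·) := by
    rw [List.pairwise_map]; simp only [hf]
  by_cases h : l.Pairwise (· < ·)
  · rw [dd_of h, pull, dd_of (e.mpr h), cob_pull]
  · rw [dd_not h, pull, dd_not (fun h' => h (e.mp h'))]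

theorem Sup.dd {k : ℕ} {φ : List X → K} (h : Sup k φ) : Sup (k+1) (dd φ) := by
  intro l hl
  have h1 : l.Pairwise (· < ·) := by
    by_contra hc; exact hl (dd_not hc)
  refine ⟨h1, ?_⟩
  by_contra hlen
  apply hl
  rw [dd_of h1, ← cob_zero l]
  apply cob_congr
  intro m hm hml
  by_contra hne
  have := (h m hne).2
  omega

theorem Sup.add {k : ℕ} {φ ψ : List X → K} (h : Sup k φ) (h' : Sup k ψ) : Sup k (φ + ψ) := by
  intro l hl
  by_cases h1 : φ l = 0
  · exact h' l (fun h2 => hl (by simp [h1, h2]))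
  · exact h l h1

theorem Sup.sub {k : ℕ} {φ ψ : List X → K} (h : Sup k φ) (h' : Sup k ψ) : Sup k (φ - ψ) := by
  intro l hl
  by_cases h1 : φ l = 0
  · exact h' l (fun h2 => hl (by simp [h1, h2]))
  · exact h l h1

theorem Sup.mono {k k' : ℕ} {φ : List X → K} (h : Sup k φ) (hk : k' ≤ k) : Sup k' φ := by
  intro l hl
  have := h l hl
  exact ⟨this.1, by omega⟩

theorem Sup.zero_of {k : ℕ} {φ : List X → K} (h : Sup k φ) {l : List X}
    (hl : ¬ l.Pairwise (· < ·) ∨ l.length ≤ k) : φ l = 0 := by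
  by_contra hc
  have := h l hc
  rcases hl with h1 | h1
  · exact h1 this.1
  · omega

theorem Sup.pull {k : ℕ} {φ : List X → K} (h : Sup k φ) (f : X → X)
    (hf : ∀ a b, f a < f b ↔ a < b) : Sup k (pull f φ) := by
  intro l hl
  have := h _ hl
  rw [List.pairwise_map, List.length_map] at this
  simpa only [hf] using this

/-- a contraction of a poset -/
structure Contr (ρ : ℕ → X → X) (o : X) : Prop where
  mono : ∀ n, Monotone (ρ n)
  cmp : ∀ n, (∀ a, ρ n a ≤ ρ (n+1) a) ∨ (∀ a, ρ (n+1) a ≤ ρ n a)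
  zero : ∀ a, ρ 0 a = o
  ev : ∀ a, ∃ N, ∀ n, N ≤ n → ρ n a = a

theorem Contr.connected {ρ : ℕ → X → X} {o : X} (hρ : Contr ρ o) {Z : Type*} (D : X → Z)
    (hD : ∀ a b, a ≤ b → D a = D b) (a : X) : D a = D o := by
  have h1 : ∀ n, D (ρ n a) = D o := by
    intro n
    induction n with
    | zero => rw [hρ.zero]
    | succ n ih =>
      rw [← ih]
      rcases hρ.cmp n with h | h
      · exact (hD _ _ (h a)).symm
      · exact hD _ _ (h a)
  obtain ⟨N, hN⟩ := hρ.ev a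
  rw [← h1 N, hN N le_rfl]

theorem strict_of_weak {l : List X} (h : l.Pairwise (· ≤ ·)) (h2 : l.IsChain (· ≠ ·)) :
    l.Pairwise (· < ·) := by
  rw [← List.isChain_iff_pairwise] at h ⊢
  induction l with
  | nil => simp
  | cons a l ih =>
    cases l with
    | nil => simp
    | cons b l =>
      rw [List.isChain_cons_cons] at h h2 ⊢
      exact ⟨lt_of_le_of_ne h.1 h2.1, ih h.2 h2.2⟩

theorem weak_cocycle {k : ℕ} {φ : List X → K} (h : Sup k φ) (hd : dd φ = 0) {l : List X}
    (hl : l.Pairwise (· ≤ ·)) : cob φ l = 0 := by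
  by_cases hs : l.Pairwise (· < ·)
  · rw [← dd_of hs, hd]; rfl
  · apply cob_repeat
    · intro m hm
      by_contra hc
      apply hm
      have h1 := (h m hc).1
      have h2 : m.IsChain (· < ·) := h1.isChain
      exact h2.imp (fun a b hab => ne_of_lt hab)
    · intro hc
      exact hs (strict_of_weak hl hc)

theorem prism_weak (f g : X → X) (hf : Monotone f) (hg : Monotone g) (hfg : ∀ a, f a ≤ g a)
    {l1 l2 : List X} {a : X} (h : (l1 ++ a :: l2).Pairwise (· ≤ ·)) :
    (l1.map f ++ f a :: g a :: l2.map g).Pairwise (· ≤ ·) := by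
  rw [List.pairwise_append, List.pairwise_cons] at h
  obtain ⟨h1, ⟨h2, h3⟩, h4⟩ := h
  rw [List.pairwise_append, List.pairwise_cons, List.pairwise_cons, List.pairwise_map, List.pairwise_map]
  refine ⟨h1.imp (fun h => hf h), ⟨?_, ?_, h3.imp (fun h => hg h)⟩, ?_⟩
  · intro x hx
    rcases List.mem_cons.mp hx with rfl | hx
    · exact hfg a
    · obtain ⟨y, hy, rfl⟩ := List.mem_map.mp hx
      exact (hfg a).trans (hg (h2 y hy))
  · intro x hx
    obtain ⟨y, hy, rfl⟩ := List.mem_map.mp hx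
    exact hg (h2 y hy)
  · intro x hx y hy
    obtain ⟨x, hx', rfl⟩ := List.mem_map.mp hx
    have hxa := h4 x hx' a (by simp)
    rcases List.mem_cons.mp hy with rfl | hy
    · exact hf hxa
    rcases List.mem_cons.mp hy with rfl | hy
    · exact (hf hxa).trans (hfg a)
    · obtain ⟨z, hz, rfl⟩ := List.mem_map.mp hy
      exact (hfg x).trans (hg (h4 x hx' z (by simp [hz])))

theorem prism_len (f g : X → X) {k : ℕ} {φ : List X → K} (h : Sup k φ) {l : List X}
    (hl : l.length + 1 ≤ k) : prism f g φ l = 0 := by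
  apply prism_eq_zero
  intro l1 a l2 e
  apply h.zero_of
  right
  rw [e] at hl
  simp at hl ⊢
  omega

theorem prism_rep (f g : X → X) {k : ℕ} {φ : List X → K} (h : Sup k φ) {l : List X}
    (hl : ∀ a ∈ l, f a = g a) : prism f g φ l = 0 := by
  apply prism_eq_zero
  intro l1 a l2 e
  apply h.zero_of
  left
  rw [hl a (by rw [e]; simp)]
  intro hp
  rw [List.pairwise_append, List.pairwise_cons] at hp
  exact lt_irrefl _ (hp.2.1.1 (g a) (by simp))

theorem prism_cocycle (f g : X → X) (hf : Monotone f) (hg : Monotone g) (hfg : ∀ a, f a ≤ g a)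
    {k : ℕ} {φ : List X → K} (h : Sup k φ) (hd : dd φ = 0) {l : List X}
    (hl : l.Pairwise (· ≤ ·)) : cob (prism f g φ) l = φ (l.map g) - φ (l.map f) := by
  rw [← prism_id]
  have : prism f g (cob φ) l = 0 := by
    apply prism_eq_zero
    rintro l1 a l2 rfl
    exact weak_cocycle h hd (prism_weak f g hf hg hfg hl)
  rw [this, add_zero]

theorem acyclic {ρ : ℕ → X → X} {o : X} (hρ : Contr ρ o) {k : ℕ} (hk : 1 ≤ k) {φ : List X → K}
    (h : Sup k φ) (hd : dd φ = 0) : ∃ ψ : List X → K, Sup (k-1) ψ ∧ dd ψ = φ := by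
  classical
  have hstep : ∀ n, ∃ P : List X → K, (∀ l, l.Pairwise (· < ·) →
      cob P l = φ (l.map (ρ (n+1))) - φ (l.map (ρ n))) ∧ (∀ l, l.length + 1 ≤ k → P l = 0) ∧
      (∀ l, (∀ a ∈ l, ρ n a = ρ (n+1) a) → P l = 0) := by
    intro n
    rcases hρ.cmp n with hc | hc
    · refine ⟨prism (ρ n) (ρ (n+1)) φ, ?_, ?_, ?_⟩
      · intro l hl
        exact prism_cocycle _ _ (hρ.mono _) (hρ.mono _) hc h hd (hl.imp le_of_lt)
      · intro l hl; exact prism_len _ _ h hl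
      · intro l hl; exact prism_rep _ _ h hl
    · refine ⟨- prism (ρ (n+1)) (ρ n) φ, ?_, ?_, ?_⟩
      · intro l hl
        rw [cob_neg, prism_cocycle _ _ (hρ.mono _) (hρ.mono _) hc h hd (hl.imp le_of_lt)]
        abel
      · intro l hl; rw [Pi.neg_apply, prism_len _ _ h hl, neg_zero]
      · intro l hl
        rw [Pi.neg_apply, prism_rep _ _ h (fun a ha => (hl a ha).symm), neg_zero]
  choose P hP1 hP2 hP3 using hstep
  choose B hB using hρ.ev
  let b : List X → ℕ := fun l => (l.map B).sum
  have hbmem : ∀ l, ∀ a ∈ l, B a ≤ b l := by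
    intro l a ha
    exact List.single_le_sum (fun _ _ => Nat.zero_le _) _ (List.mem_map_of_mem ha)
  have hPb : ∀ (l : List X) n, (∀ a ∈ l, B a ≤ n) → P n l = 0 := by
    intro l n hn
    apply hP3
    intro a ha
    rw [hB a n (hn a ha), hB a (n+1) ((hn a ha).trans (Nat.le_succ n))]
  let ψ0 : List X → K := fun l => ∑ n ∈ Finset.range (b l), P n l
  have hψ0 : ∀ l M, b l ≤ M → ψ0 l = ∑ n ∈ Finset.range M, P n l := by
    intro l M hM
    apply Finset.sum_subset (Finset.range_mono hM)
    intro n _ hn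
    apply hPb
    intro a ha
    have := hbmem l a ha
    simp at hn
    omega
  let ψ : List X → K := fun l => if l.Pairwise (· < ·) then ψ0 l else 0
  refine ⟨ψ, ?_, ?_⟩
  · intro l hl
    have h1 : l.Pairwise (· < ·) := by
      by_contra hc; exact hl (if_neg hc)
    refine ⟨h1, ?_⟩
    by_contra hlen
    apply hl
    simp only [ψ, h1, if_true, ψ0]
    apply Finset.sum_eq_zero
    intro n _
    apply hP2; omega
  · funext l
    by_cases hs : l.Pairwise (· < ·)
    · rw [dd_of hs]
      have e1 : cob ψ l = cob (fun m => ∑ n ∈ Finset.range (b l), P n m) l := by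
        apply cob_congr
        intro m hm _
        simp only [ψ, if_pos (hs.sublist hm)]
        apply hψ0
        exact List.Sublist.sum_le_sum (hm.map B) (fun _ _ => Nat.zero_le _)
      rw [e1, cob_sum]
      simp only [hP1 _ l hs]
      rw [Finset.sum_range_sub (fun n => φ (l.map (ρ n)))]
      have e2 : l.map (ρ (b l)) = l := by
        conv_rhs => rw [← List.map_id l]
        apply List.map_congr_left
        intro a ha
        exact hB a _ (hbmem l a ha)
      rw [e2]
      have e3 : φ (l.map (ρ 0)) = 0 := by
        apply h.zero_of
        by_cases hlen : l.length ≤ k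
        · right; simpa using hlen
        · left
          match l, hlen with
          | a :: c :: l, _ =>
            intro hp
            simp only [List.map_cons, List.pairwise_cons, hρ.zero] at hp
            exact lt_irrefl _ (hp.1 o (by simp))
          | [a], hlen => simp at hlen; omega
          | [], hlen => simp at hlen
      rw [e3, sub_zero]
    · rw [dd_not hs, h.zero_of (Or.inl hs)]

end SecE1


section SecE2
set_option linter.unusedSectionVars false
set_option linter.style.haveILetI false

variable {ι X : Type*} [PartialOrder X] [MulAction (FreeGroup ι) X]

/-- translate of a list -/
def tr (x : FreeGroup ι) (l : List X) : List X := l.map (fun a => x • a)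

theorem tr_mul (x y : FreeGroup ι) (l : List X) : tr (x * y) l = tr x (tr y l) := by
  simp [tr, mul_smul]

theorem tr_one (l : List X) : tr (1 : FreeGroup ι) l = l := by
  simp [tr]

theorem tr_inv_tr (x : FreeGroup ι) (l : List X) : tr x⁻¹ (tr x l) = l := by
  rw [← tr_mul, inv_mul_cancel, tr_one]

theorem tr_tr_inv (x : FreeGroup ι) (l : List X) : tr x (tr x⁻¹ l) = l := by
  rw [← tr_mul, mul_inv_cancel, tr_one]

/-- invariance -/
def Finv (ι : Type*) {X K : Type*} [MulAction (FreeGroup ι) X] (φ : List X → K) : Prop :=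
  ∀ (x : FreeGroup ι) (l : List X), φ (tr x l) = φ l

/-- action on nonempty lists -/
def nlAct : MulAction (FreeGroup ι) {l : List X // l ≠ []} where
  smul x l := ⟨tr x l.1, by
    intro h; apply l.2; simpa [tr] using h⟩
  one_smul l := Subtype.ext (tr_one l.1)
  mul_smul x y l := Subtype.ext (tr_mul x y l.1)

theorem Finv.dd {K : Type*} [AddCommGroup K] (hlt : ∀ (x : FreeGroup ι) (a b : X), x • a < x • b ↔ a < b)
    {φ : List X → K} (h : Finv ι φ) : Finv ι (dd φ) := by
  intro x l
  have h1 : pull (fun a => x • a) φ = φ := by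
    funext l; exact h x l
  have := congrFun (dd_pull (fun a => x • a) (hlt x) φ) l
  rw [h1] at this
  exact this.symm

theorem Finv.sub {K : Type*} [AddCommGroup K] {φ ψ : List X → K} (h : Finv ι φ) (h' : Finv ι ψ) :
    Finv ι (φ - ψ) := by
  intro x l
  rw [Pi.sub_apply, Pi.sub_apply, h x l, h' x l]

theorem Finv.of_gen {K : Type*} {φ : List X → K} (h : ∀ i l, φ (tr (FreeGroup.of i : FreeGroup ι) l) = φ l) :
    Finv ι φ := by
  intro x
  induction x using FreeGroup.induction_on with
  | C1 => intro l; rw [tr_one]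
  | of i => exact h i
  | inv_of i _ =>
    intro l
    have := h i (tr (FreeGroup.of i)⁻¹ l)
    rw [tr_tr_inv] at this
    exact this.symm
  | mul x y hx hy =>
    intro l
    rw [tr_mul, hx, hy]

theorem tr_strict (hlt : ∀ (x : FreeGroup ι) (a b : X), x • a < x • b ↔ a < b) (x : FreeGroup ι) (l : List X) :
    (tr x l).Pairwise (· < ·) ↔ l.Pairwise (· < ·) := by
  rw [tr, List.pairwise_map]; simp only [hlt]

theorem tr_length (x : FreeGroup ι) (l : List X) : (tr x l).length = l.length := by simp [tr]

theorem inv_acyclic {K : Type*} [AddCommGroup K]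
    (hfree : ∀ (x : FreeGroup ι) (a : X), x • a = a → x = 1)
    (hlt : ∀ (x : FreeGroup ι) (a b : X), x • a < x • b ↔ a < b)
    {ρ : ℕ → X → X} {o : X} (hρ : Contr ρ o) {k : ℕ} (hk : 2 ≤ k) {φ : List X → K}
    (hi : Finv ι φ) (h : Sup k φ) (hd : dd φ = 0) :
    ∃ ψ : List X → K, Finv ι ψ ∧ Sup (k-1) ψ ∧ dd ψ = φ := by
  classical
  obtain ⟨ψ0, hs0, hd0⟩ := acyclic hρ (by omega) h hd
  have hv : ∀ i : ι, ∃ v : List X → K, Sup (k-2) v ∧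
      dd v = pull (fun a => (FreeGroup.of i : FreeGroup ι) • a) ψ0 - ψ0 := by
    intro i
    have h1 : Sup (k-1) (pull (fun a => (FreeGroup.of i : FreeGroup ι) • a) ψ0 - ψ0) :=
      (hs0.pull _ (hlt _)).sub hs0
    have h2 : dd (pull (fun a => (FreeGroup.of i : FreeGroup ι) • a) ψ0 - ψ0) = 0 := by
      rw [dd_sub, dd_pull _ (hlt _), hd0]
      funext l
      have := hi (FreeGroup.of i) l
      simp only [Pi.sub_apply, pull, Pi.zero_apply]
      exact sub_eq_zero.mpr this
    obtain ⟨v, hv1, hv2⟩ := acyclic hρ (by omega) h1 h2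
    exact ⟨v, hv1, hv2⟩
  choose v hv1 hv2 using hv
  letI := nlAct (ι := ι) (X := X)
  obtain ⟨V0, hV0⟩ := exists_potential (ι := ι) (S := {l : List X // l ≠ []}) (K := K) (by
    rintro x ⟨l, hl⟩ h
    have h' : tr x l = l := congrArg Subtype.val h
    match l, hl with
    | a :: l, _ =>
      simp only [tr, List.map_cons, List.cons.injEq] at h'
      exact hfree x a h'.1) (fun i s => v i s.1)
  let V : List X → K := fun l => if hl : l ≠ [] then (if l.Pairwise (· < ·) ∧ k - 2 < l.length then V0 ⟨l, hl⟩ else 0) else 0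
  have hVs : Sup (k-2) V := by
    intro l hl
    by_contra hc
    apply hl
    simp only [V]
    split_ifs <;> rfl
  have hV : ∀ i, pull (fun a => (FreeGroup.of i : FreeGroup ι) • a) V - V = v i := by
    intro i
    funext l
    by_cases hc : l.Pairwise (· < ·) ∧ k - 2 < l.length
    · have hl : l ≠ [] := by
        rintro rfl; simp at hc
      have hl' : tr (FreeGroup.of i : FreeGroup ι) l ≠ [] := by
        intro h; apply hl; simpa [tr] using h
      have hc' : (tr (FreeGroup.of i : FreeGroup ι) l).Pairwise (· < ·) ∧
          k - 2 < (tr (FreeGroup.of i : FreeGroup ι) l).length := by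
        rw [tr_strict hlt, tr_length]; exact hc
      have e1 : V l = V0 ⟨l, hl⟩ := by
        simp only [V]; rw [dif_pos hl, if_pos hc]
      have e2 : V (tr (FreeGroup.of i : FreeGroup ι) l) = V0 ⟨_, hl'⟩ := by
        simp only [V]; rw [dif_pos hl', if_pos hc']
      have := hV0 i ⟨l, hl⟩
      rw [Pi.sub_apply]
      change V (tr (FreeGroup.of i : FreeGroup ι) l) - V l = _
      rw [e1, e2]
      exact this
    · have hcc : ¬ (l.Pairwise (· < ·)) ∨ l.length ≤ k - 2 := by
        by_contra h; push Not at h; exact hc h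
      have hcc' : ¬ ((tr (FreeGroup.of i : FreeGroup ι) l).Pairwise (· < ·)) ∨ (tr (FreeGroup.of i : FreeGroup ι) l).length ≤ k - 2 := by
        rw [tr_strict hlt, tr_length]; exact hcc
      rw [(hv1 i).zero_of hcc, Pi.sub_apply, hVs.zero_of hcc]
      change V (tr (FreeGroup.of i : FreeGroup ι) l) - 0 = _
      rw [hVs.zero_of hcc', sub_zero]
  refine ⟨ψ0 - dd V, ?_, ?_, ?_⟩
  · apply Finv.of_gen
    intro i l
    have h1 := congrFun (hv2 i) l
    have h2 := congrArg dd (hV i)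
    rw [dd_sub, dd_pull _ (hlt _)] at h2
    have h3 := congrFun h2 l
    rw [h1] at h3
    simp only [Pi.sub_apply, pull] at h3 ⊢
    rw [← sub_eq_zero] at h3 ⊢
    simp only [tr]
    rw [← neg_eq_zero, ← h3]; abel
  · have := hVs.dd
    rw [show k - 2 + 1 = k - 1 by omega] at this
    exact hs0.sub this
  · rw [dd_sub, dd_dd, sub_zero, hd0]

/-- the equivariant setup -/
structure EqS (ι X : Type*) [PartialOrder X] [MulAction (FreeGroup ι) X] (p : ℕ) (t : X → X)
    (tF : FreeGroup ι ≃* FreeGroup ι) : Prop where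
  free : ∀ (x : FreeGroup ι) (a : X), x • a = a → x = 1
  lt : ∀ (x : FreeGroup ι) (a b : X), x • a < x • b ↔ a < b
  tlt : ∀ a b, t a < t b ↔ a < b
  tp : ∀ a, t^[p] a = a
  tF : ∀ (x : FreeGroup ι) (a : X), t (x • a) = tF x • t a
  contr : ∃ ρ o, Contr (X := X) ρ o

variable {p : ℕ} {t : X → X} {tF : FreeGroup ι ≃* FreeGroup ι}

/-- fixed up to translation -/
def Fx (ι : Type*) {X : Type*} [MulAction (FreeGroup ι) X] (t : X → X) (l : List X) : Prop :=
  ∃ g : FreeGroup ι, l.map t = tr g l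

theorem EqS.tlt_iter (hS : EqS ι X p t tF) (n : ℕ) (a b : X) : t^[n] a < t^[n] b ↔ a < b := by
  induction n with
  | zero => rfl
  | succ n ih => rw [Function.iterate_succ_apply', Function.iterate_succ_apply', hS.tlt, ih]

theorem EqS.map_tr (hS : EqS ι X p t tF) (x : FreeGroup ι) (l : List X) :
    (tr x l).map t = tr (tF x) (l.map t) := by
  simp only [tr, List.map_map]
  apply List.map_congr_left
  intro a _
  exact hS.tF x a

theorem map_iter_succ (n : ℕ) (l : List X) : l.map t^[n+1] = (l.map t^[n]).map t := by
  rw [List.map_map, Function.iterate_succ']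

theorem map_iter_succ' (n : ℕ) (l : List X) : l.map t^[n+1] = (l.map t).map t^[n] := by
  rw [List.map_map, Function.iterate_succ]

theorem map_iter_add (m n : ℕ) (l : List X) : l.map t^[m+n] = (l.map t^[n]).map t^[m] := by
  rw [List.map_map, Function.iterate_add]

theorem EqS.map_iter_tr (hS : EqS ι X p t tF) (n : ℕ) (x : FreeGroup ι) :
    ∃ y : FreeGroup ι, ∀ l : List X, (tr x l).map t^[n] = tr y (l.map t^[n]) := by
  induction n with
  | zero => exact ⟨x, fun l => by simp⟩
  | succ n ih =>
    obtain ⟨y, hy⟩ := ih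
    exact ⟨tF y, fun l => by rw [map_iter_succ, hy, hS.map_tr, map_iter_succ]⟩

theorem EqS.map_p (hS : EqS ι X p t tF) (l : List X) : l.map t^[p] = l := by
  conv_rhs => rw [← List.map_id l]
  exact List.map_congr_left (fun a _ => hS.tp a)

theorem EqS.map_pmul (hS : EqS ι X p t tF) (n : ℕ) (l : List X) : l.map t^[p * n] = l := by
  induction n with
  | zero => simp
  | succ n ih => rw [Nat.mul_succ, map_iter_add, hS.map_p, ih]

theorem EqS.map_mod (hS : EqS ι X p t tF) (n : ℕ) (l : List X) : l.map t^[n] = l.map t^[n % p] := by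
  conv_lhs => rw [← Nat.mod_add_div n p, map_iter_add, hS.map_pmul]

theorem EqS.Fx_tr (hS : EqS ι X p t tF) {l : List X} (h : Fx ι t l) (x : FreeGroup ι) :
    Fx ι t (tr x l) := by
  obtain ⟨g, hg⟩ := h
  refine ⟨tF x * g * x⁻¹, ?_⟩
  rw [hS.map_tr, hg, ← tr_mul, ← tr_mul]
  group

theorem EqS.Fx_t (hS : EqS ι X p t tF) {l : List X} (h : Fx ι t l) : Fx ι t (l.map t) := by
  obtain ⟨g, hg⟩ := h
  refine ⟨tF g, ?_⟩
  rw [← hS.map_tr, ← hg]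

theorem EqS.Fx_iter (hS : EqS ι X p t tF) {l : List X} (h : Fx ι t l) (n : ℕ) : Fx ι t (l.map t^[n]) := by
  induction n with
  | zero => simpa using h
  | succ n ih => rw [map_iter_succ]; exact hS.Fx_t ih

theorem EqS.Fx_tr_iff (hS : EqS ι X p t tF) {l : List X} (x : FreeGroup ι) :
    Fx ι t (tr x l) ↔ Fx ι t l :=
  ⟨fun h => by have := hS.Fx_tr h x⁻¹; rwa [tr_inv_tr] at this, fun h => hS.Fx_tr h x⟩

theorem EqS.Fx_t_iff (hS : EqS ι X p t tF) (hp : 0 < p) {l : List X} :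
    Fx ι t (l.map t) ↔ Fx ι t l := by
  refine ⟨fun h => ?_, hS.Fx_t⟩
  have := hS.Fx_iter h (p-1)
  rw [← map_iter_succ', show p - 1 + 1 = p by omega, hS.map_p] at this
  exact this

theorem Fx.sublist {l m : List X} (h : Fx ι t l) (hm : m.Sublist l) : Fx ι t m := by
  obtain ⟨g, hg⟩ := h
  refine ⟨g, ?_⟩
  apply List.map_congr_left
  intro a ha
  have h1 : ∀ a ∈ l, t a = g • a := List.map_inj_left.mp hg
  exact h1 a (hm.subset ha)

/-- nontrivial coincidences imply fixed -/
theorem EqS.Fx_of (hS : EqS ι X p t tF) (hp : p.Prime) {l : List X} {d : ℕ} (hd : ¬ p ∣ d) {g : FreeGroup ι}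
    (h : l.map t^[d] = tr g l) : Fx ι t l := by
  have hmul : ∀ n : ℕ, ∃ y : FreeGroup ι, l.map t^[d * n] = tr y l := by
    intro n
    induction n with
    | zero => exact ⟨1, by simp [tr_one]⟩
    | succ n ih =>
      obtain ⟨y, hy⟩ := ih
      obtain ⟨z, hz⟩ := hS.map_iter_tr d y
      refine ⟨z * g, ?_⟩
      rw [Nat.mul_succ, add_comm, map_iter_add, hy, hz, h, tr_mul]
  have hc : Nat.Coprime d p := ((Nat.Prime.coprime_iff_not_dvd hp).mpr hd).symm
  obtain ⟨e, he⟩ := Nat.exists_mul_mod_eq_one_of_coprime hc hp.one_lt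
  obtain ⟨y, hy⟩ := hmul e
  refine ⟨y, ?_⟩
  have e2 := hS.map_mod (d * e) l
  rw [show d * e % p = 1 from he.2] at e2
  rw [← hy, e2]; rfl

theorem EqS.diff (hS : EqS ι X p t tF) (hp : p.Prime) {r : List X} (hr : ¬ Fx ι t r) {i j : ℕ}
    {x y : FreeGroup ι} (h : tr x (r.map t^[i]) = tr y (r.map t^[j])) : (i : ZMod p) = j := by
  haveI := Fact.mk hp
  wlog hij : i ≤ j generalizing i j x y
  · exact (this h.symm (by omega)).symm
  obtain ⟨d, rfl⟩ := Nat.exists_eq_add_of_le hij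
  by_cases hd : p ∣ d
  · have := (ZMod.natCast_eq_zero_iff d p).mpr hd
    push_cast; rw [this, add_zero]
  · exfalso
    have h1 : (r.map t^[i]).map t^[d] = tr (y⁻¹ * x) (r.map t^[i]) := by
      rw [tr_mul, h, tr_inv_tr, ← map_iter_add, add_comm]
    have h2 := hS.Fx_of hp hd h1
    have h3 : ∀ n, Fx ι t (r.map t^[n]) → Fx ι t r := by
      intro n
      induction n with
      | zero => intro h; simpa using h
      | succ n ih => intro h; rw [map_iter_succ] at h; exact ih ((hS.Fx_t_iff hp.pos).mp h)
    exact hr (h3 i h2)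

theorem EqS.exists_J (hS : EqS ι X p t tF) (hp : p.Prime) : ∃ J : List X → ZMod p,
    (∀ (x : FreeGroup ι) l, J (tr x l) = J l) ∧ (∀ l, ¬ Fx ι t l → J (l.map t) = J l + 1) := by
  classical
  haveI := Fact.mk hp
  let R : List X → List X → Prop := fun r l => ∃ (x : FreeGroup ι) (i : ℕ), l = tr x (r.map t^[i])
  have R_tr : ∀ {r l} (x : FreeGroup ι), R r l → R r (tr x l) := by
    rintro r l x ⟨y, i, rfl⟩
    exact ⟨x * y, i, by rw [tr_mul]⟩
  have R_t : ∀ {r l}, R r l → R r (l.map t) := by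
    rintro r l ⟨y, i, rfl⟩
    exact ⟨tF y, i+1, by rw [hS.map_tr, map_iter_succ]⟩
  have R_it : ∀ {r l} n, R r l → R r (l.map t^[n]) := by
    intro r l n h
    induction n with
    | zero => simpa using h
    | succ n ih => rw [map_iter_succ]; exact R_t ih
  have R_refl : ∀ r, R r r := fun r => ⟨1, 0, by simp [tr_one]⟩
  have R_trans : ∀ {a b c}, R a b → R b c → R a c := by
    rintro a b c h ⟨x, i, rfl⟩
    exact R_tr x (R_it i h)
  have R_symm : ∀ {a b}, R a b → R b a := by
    rintro a b ⟨x, i, rfl⟩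
    have h1 : R (tr x (a.map t^[i])) (a.map t^[i]) := ⟨x⁻¹, 0, by simp [tr_inv_tr]⟩
    have h2 := R_it ((p-1)*i) h1
    rw [← map_iter_add, show (p-1)*i + i = p * i by
      obtain ⟨q, hq⟩ := Nat.exists_eq_add_of_le hp.pos
      rw [hq]; simp; ring, hS.map_pmul] at h2
    exact h2
  let s : Setoid (List X) := ⟨R, R_refl, R_symm, R_trans⟩
  let rep : List X → List X := fun l => (Quotient.mk s l).out
  have hrep : ∀ l, R (rep l) l := fun l => Quotient.mk_out (s := s) l
  have hrep_eq : ∀ {l m}, R l m → rep l = rep m := by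
    intro l m h
    have : Quotient.mk s l = Quotient.mk s m := Quotient.sound h
    simp only [rep, this]
  choose xx ii hxi using hrep
  have hnon : ∀ l, ¬ Fx ι t l → ¬ Fx ι t (rep l) := by
    intro l hl h
    apply hl
    rw [hxi l]
    exact hS.Fx_tr (hS.Fx_iter h _) _
  refine ⟨fun l => if Fx ι t l then 0 else (ii l : ZMod p), ?_, ?_⟩
  · intro x l
    beta_reduce
    by_cases h : Fx ι t l
    · rw [if_pos h, if_pos (hS.Fx_tr h x)]
    · rw [if_neg h, if_neg (fun h' => h ((hS.Fx_tr_iff x).mp h'))]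
      have e : rep l = rep (tr x l) := hrep_eq (R_tr x (R_refl l))
      have h1 := hxi (tr x l)
      rw [← e] at h1
      have h2 : tr x (tr (xx l) ((rep l).map t^[ii l])) = tr (xx (tr x l)) ((rep l).map t^[ii (tr x l)]) := by
        rw [← hxi l]; exact h1
      rw [← tr_mul] at h2
      exact (hS.diff hp (hnon l h) h2).symm
  · intro l h
    beta_reduce
    rw [if_neg h, if_neg (fun h' => h ((hS.Fx_t_iff hp.pos).mp h'))]
    have e : rep l = rep (l.map t) := hrep_eq (R_t (R_refl l))
    have h1 := hxi (l.map t)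
    rw [← e] at h1
    have h2 : (tr (xx l) ((rep l).map t^[ii l])).map t = tr (xx (l.map t)) ((rep l).map t^[ii (l.map t)]) := by
      rw [← hxi l]; exact h1
    rw [hS.map_tr, ← map_iter_succ] at h2
    have := hS.diff hp (hnon l h) h2
    push_cast at this
    exact this.symm

end SecE2


section SecE3
set_option linter.unusedSectionVars false
set_option linter.style.haveILetI false

variable {ι X : Type*} [PartialOrder X] [MulAction (FreeGroup ι) X]
variable {p : ℕ} {t : X → X} {tF : FreeGroup ι ≃* FreeGroup ι}

/-- difference operator -/
def tauOp (p : ℕ) (t : X → X) (φ : List X → ZMod p) : List X → ZMod p := pull t φ - φ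

/-- norm operator -/
def sigOp (p : ℕ) (t : X → X) (φ : List X → ZMod p) : List X → ZMod p :=
  fun l => ∑ i ∈ Finset.range p, φ (l.map t^[i])

/-- good operators -/
structure GoodOp (ι : Type*) {X : Type*} [PartialOrder X] [MulAction (FreeGroup ι) X] {p : ℕ} (t : X → X)
    (R : (List X → ZMod p) → List X → ZMod p) : Prop where
  sub : ∀ φ ψ, R (φ - ψ) = R φ - R ψ
  inv : ∀ φ, Finv ι φ → Finv ι (R φ)
  sup : ∀ k φ, Sup k φ → Sup k (R φ)
  comm : ∀ φ, dd (R φ) = R (dd φ)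
  kill : ∀ φ, Finv ι φ → ∀ l, Fx ι t l → R φ l = 0
  ext : ∀ φ, (∀ l, ¬ Fx ι t l → φ l = 0) → ∀ l, ¬ Fx ι t l → R φ l = 0

theorem EqS.pull_inv (hS : EqS ι X p t tF) {K : Type*} {φ : List X → K} (h : Finv ι φ) (n : ℕ) :
    Finv ι (pull t^[n] φ) := by
  intro x l
  obtain ⟨y, hy⟩ := hS.map_iter_tr n x
  simp only [pull]
  rw [hy, h]

theorem EqS.Fx_val (hS : EqS ι X p t tF) {K : Type*} {φ : List X → K} (h : Finv ι φ) {l : List X}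
    (hl : Fx ι t l) (n : ℕ) : φ (l.map t^[n]) = φ l := by
  induction n with
  | zero => simp
  | succ n ih =>
    obtain ⟨g, hg⟩ := hS.Fx_iter hl n
    rw [map_iter_succ, hg, h, ih]

theorem EqS.Fx_iter_iff (hS : EqS ι X p t tF) (hp : 0 < p) {l : List X} (n : ℕ) :
    Fx ι t (l.map t^[n]) ↔ Fx ι t l := by
  induction n with
  | zero => simp
  | succ n ih => rw [map_iter_succ, hS.Fx_t_iff hp, ih]

theorem EqS.good_tau (hS : EqS ι X p t tF) (hp : p.Prime) : GoodOp ι t (tauOp p t) where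
  sub φ ψ := by
    funext l; simp only [tauOp, pull, Pi.sub_apply]; abel
  inv φ h := (hS.pull_inv h 1).sub h
  sup k φ h := (h.pull t hS.tlt).sub h
  comm φ := by rw [tauOp, dd_sub, dd_pull t hS.tlt]; rfl
  kill φ h l hl := by
    have := hS.Fx_val h hl 1
    rw [Function.iterate_one] at this
    rw [tauOp, Pi.sub_apply, pull, this, sub_self]
  ext φ h l hl := by
    rw [tauOp, Pi.sub_apply, pull, h l hl, h _ (fun h' => hl ((hS.Fx_t_iff hp.pos).mp h')), sub_self]

theorem EqS.good_sig (hS : EqS ι X p t tF) (hp : p.Prime) : GoodOp ι t (sigOp p t) where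
  sub φ ψ := by
    funext l; simp only [sigOp, Pi.sub_apply, Finset.sum_sub_distrib]
  inv φ h := by
    intro x l
    apply Finset.sum_congr rfl
    intro i _
    exact hS.pull_inv h i x l
  sup k φ h := by
    intro l hl
    obtain ⟨i, _, hi⟩ := Finset.exists_ne_zero_of_sum_ne_zero hl
    exact h.pull t^[i] (hS.tlt_iter i) l hi
  comm φ := by
    funext l
    by_cases hl : l.Pairwise (· < ·)
    · rw [dd_of hl]
      have e : sigOp p t φ = fun m => ∑ i ∈ Finset.range p, (pull t^[i] φ) m := rfl
      rw [e, cob_sum]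
      apply Finset.sum_congr rfl
      intro i _
      rw [← dd_of hl, dd_pull _ (hS.tlt_iter i)]; rfl
    · rw [dd_not hl]
      symm
      apply Finset.sum_eq_zero
      intro i _
      have := congrFun (dd_pull _ (hS.tlt_iter i) φ) l
      rw [dd_not hl] at this
      exact this.symm
  kill φ h l hl := by
    simp only [sigOp, hS.Fx_val h hl]
    simp
  ext φ h l hl := by
    apply Finset.sum_eq_zero
    intro i _
    apply h
    rwa [hS.Fx_iter_iff hp.pos]

theorem EqS.tau_sig (hS : EqS ι X p t tF) (φ : List X → ZMod p) : tauOp p t (sigOp p t φ) = 0 := by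
  funext l
  simp only [tauOp, Pi.sub_apply, pull, sigOp, ← map_iter_succ', Pi.zero_apply]
  have h1 := Finset.sum_range_succ (fun i => φ (l.map t^[i])) p
  have h2 := Finset.sum_range_succ' (fun i => φ (l.map t^[i])) p
  rw [h1, hS.map_p] at h2
  have h3 : φ (l.map t^[0]) = φ l := by simp
  rw [h3] at h2
  rw [sub_eq_zero]
  exact (add_right_cancel h2).symm

theorem EqS.sig_tau (hS : EqS ι X p t tF) (φ : List X → ZMod p) : sigOp p t (tauOp p t φ) = 0 := by
  funext l
  simp only [tauOp, Pi.sub_apply, pull, sigOp, ← map_iter_succ, Pi.zero_apply]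
  rw [Finset.sum_range_sub (fun i => φ (l.map t^[i])), hS.map_p]
  simp

theorem EqS.exact_tau (hS : EqS ι X p t tF) (hp : p.Prime) {k : ℕ} {w : List X → ZMod p}
    (hi : Finv ι w) (hs : Sup k w) (hB : ∀ l, Fx ι t l → w l = 0) (hw : tauOp p t w = 0) :
    ∃ c, Finv ι c ∧ Sup k c ∧ w = sigOp p t c := by
  classical
  haveI := Fact.mk hp
  obtain ⟨J, hJ1, hJ2⟩ := hS.exists_J hp
  have hwt : ∀ n l, w (l.map t^[n]) = w l := by
    intro n l
    induction n with
    | zero => simp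
    | succ n ih =>
      rw [map_iter_succ, ← ih]
      exact sub_eq_zero.mp (congrFun hw (l.map t^[n]))
  have hJn : ∀ n l, ¬ Fx ι t l → J (l.map t^[n]) = J l + n := by
    intro n l hl
    induction n with
    | zero => simp
    | succ n ih =>
      rw [map_iter_succ, hJ2 _ (by rwa [hS.Fx_iter_iff hp.pos]), ih]; push_cast; ring
  refine ⟨fun l => if J l = 0 then w l else 0, ?_, ?_, ?_⟩
  · intro x l
    beta_reduce
    rw [hJ1, hi]
  · intro l hl
    apply hs
    intro h0
    apply hl
    simp [h0]
  · funext l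
    by_cases hl : Fx ι t l
    · rw [hB l hl]
      symm
      apply Finset.sum_eq_zero
      intro i _
      simp [hwt, hB l hl]
    · simp only [sigOp, hwt, hJn _ l hl]
      rw [Finset.sum_eq_single (ZMod.val (- J l))]
      · simp
      · intro i hi hne
        rw [if_neg]
        intro h
        apply hne
        have h2 : (i : ZMod p) = - J l := by rw [eq_neg_iff_add_eq_zero, add_comm]; exact h
        rw [← h2, ZMod.val_natCast, Nat.mod_eq_of_lt (Finset.mem_range.mp hi)]
      · intro h
        exact absurd (Finset.mem_range.mpr (ZMod.val_lt _)) h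

theorem EqS.exact_sig (hS : EqS ι X p t tF) (hp : p.Prime) {k : ℕ} {w : List X → ZMod p}
    (hi : Finv ι w) (hs : Sup k w) (hB : ∀ l, Fx ι t l → w l = 0) (hw : sigOp p t w = 0) :
    ∃ c, Finv ι c ∧ Sup k c ∧ w = tauOp p t c := by
  classical
  haveI := Fact.mk hp
  obtain ⟨J, hJ1, hJ2⟩ := hS.exists_J hp
  refine ⟨fun l => ∑ i ∈ Finset.range (J l).val, w (l.map t^[p - (J l).val + i]), ?_, ?_, ?_⟩
  · intro x l
    beta_reduce
    rw [hJ1]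
    apply Finset.sum_congr rfl
    intro i _
    exact hS.pull_inv hi _ x l
  · intro l hl
    obtain ⟨i, _, hi⟩ := Finset.exists_ne_zero_of_sum_ne_zero hl
    exact hs.pull _ (hS.tlt_iter _) l hi
  · funext l
    by_cases hl : Fx ι t l
    · rw [hB l hl]
      simp only [tauOp, Pi.sub_apply, pull, ← map_iter_succ', hS.Fx_val hi hl, hB l hl]
      simp
    · simp only [tauOp, Pi.sub_apply, pull, ← map_iter_succ', hJ2 l hl]
      have hlt := ZMod.val_lt (J l)
      by_cases hj : (J l).val = p - 1
      · have e0 : J l + 1 = 0 := by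
          have : ((J l).val : ZMod p) = J l := ZMod.natCast_zmod_val _
          rw [← this, hj, Nat.cast_sub hp.one_le]; simp
        rw [e0, hj]
        simp only [ZMod.val_zero, Finset.range_zero, Finset.sum_empty]
        have h1 := congrFun hw l
        simp only [sigOp, Pi.zero_apply] at h1
        have h2 := Finset.sum_range_succ' (fun i => w (l.map t^[i])) (p-1)
        rw [Nat.sub_add_cancel hp.one_le, h1] at h2
        have h3 : w (l.map t^[0]) = w l := by simp
        rw [h3] at h2
        have h4 : ∀ i, p - (p-1) + i = i + 1 := by
          intro i; have := hp.one_le; omega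
        simp only [h4, zero_sub]
        exact eq_neg_of_add_eq_zero_right h2.symm
      · have e0 : (J l + 1).val = (J l).val + 1 := by
          rw [ZMod.val_add, ZMod.val_one, Nat.mod_eq_of_lt]
          omega
        rw [e0, Finset.sum_range_succ]
        have h4 : ∀ i, p - ((J l).val + 1) + i + 1 = p - (J l).val + i := by
          intro i; omega
        simp only [h4]
        rw [Nat.sub_add_cancel hlt.le, hS.map_p]; abel

theorem EqS.step (hS : EqS ι X p t tF) {R R' : (List X → ZMod p) → List X → ZMod p}
    (hR : GoodOp ι t R) (hR' : GoodOp ι t R') (hRR : ∀ φ, R (R' φ) = 0)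
    (hex : ∀ (k : ℕ) (w : List X → ZMod p), Finv ι w → Sup k w → (∀ l, Fx ι t l → w l = 0) → R w = 0 →
      ∃ c, Finv ι c ∧ Sup k c ∧ w = R' c) {k : ℕ} (hk : 2 ≤ k)
    (ih : ∀ a, Finv ι a → Sup (k+1) a → dd (R' a) = 0 → ∃ v, Finv ι v ∧ Sup k v ∧ R' a = dd (R' v))
    (a : List X → ZMod p) (hi : Finv ι a) (hs : Sup k a) (hd : dd (R a) = 0) :
    ∃ v, Finv ι v ∧ Sup (k-1) v ∧ R a = dd (R v) := by
  classical
  obtain ⟨ρ, o, hρ⟩ := hS.contr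
  let a' : List X → ZMod p := fun l => if Fx ι t l then 0 else a l
  have hi' : Finv ι a' := by
    intro x l
    simp only [a', hS.Fx_tr_iff, hi x l]
  have hs' : Sup k a' := by
    intro l hl
    apply hs
    intro h0
    apply hl
    simp [a', h0]
  have haz : ∀ l, Fx ι t l → a' l = 0 := fun l hl => if_pos hl
  have hRa : R a' = R a := by
    have h1 : Finv ι (a - a') := hi.sub hi'
    have h2 : R (a - a') = 0 := by
      funext l
      by_cases hl : Fx ι t l
      · exact hR.kill _ h1 l hl
      · apply hR.ext _ _ l hl
        intro m hm
        simp [a', hm]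
    rw [hR.sub, sub_eq_zero] at h2
    exact h2.symm
  rw [← hRa] at hd ⊢
  have hdz : ∀ l, Fx ι t l → dd a' l = 0 := by
    intro l hl
    by_cases hst : l.Pairwise (· < ·)
    · rw [dd_of hst, ← cob_zero l]
      exact cob_congr (fun m hm _ => haz m (hl.sublist hm))
    · exact dd_not hst
  rw [hR.comm] at hd
  obtain ⟨c, hc1, hc2, hc3⟩ := hex (k+1) (dd a') (hi'.dd hS.lt) hs'.dd hdz hd
  obtain ⟨e, he1, he2, he3⟩ := ih c hc1 hc2 (by rw [← hc3, dd_dd])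
  have hz : dd (a' - R' e) = 0 := by
    rw [dd_sub, ← he3, hc3, sub_self]
  obtain ⟨f, hf1, hf2, hf3⟩ := inv_acyclic hS.free hS.lt hρ hk (hi'.sub (hR'.inv e he1))
    (hs'.sub (hR'.sup k e he2)) hz
  refine ⟨f, hf1, hf2, ?_⟩
  rw [hR.comm, hf3, hR.sub, hRR, sub_zero]

theorem EqS.claim (hS : EqS ι X p t tF) (hp : p.Prime) {D : ℕ}
    (hD : ∀ l : List X, l.Pairwise (· < ·) → l.length ≤ D) : ∀ (m k : ℕ), 2 ≤ k → D ≤ k + m →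
    (∀ a, Finv ι a → Sup k a → dd (tauOp p t a) = 0 →
      ∃ v, Finv ι v ∧ Sup (k-1) v ∧ tauOp p t a = dd (tauOp p t v)) ∧
    (∀ a, Finv ι a → Sup k a → dd (sigOp p t a) = 0 →
      ∃ v, Finv ι v ∧ Sup (k-1) v ∧ sigOp p t a = dd (sigOp p t v)) := by
  have hτ := hS.good_tau hp
  have hσ := hS.good_sig hp
  intro m
  induction m with
  | zero =>
    intro k hk hDk
    have key : ∀ a : List X → ZMod p, Sup k a → a = 0 := by
      intro a ha
      funext l
      by_contra hc
      have := ha l hc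
      have := hD l this.1
      omega
    have key2 : ∀ R : (List X → ZMod p) → List X → ZMod p, GoodOp ι t R → R 0 = 0 := by
      intro R hR
      have := hR.sub 0 0
      simpa using this
    constructor
    all_goals
      intro a _ hs _
      refine ⟨0, fun _ _ => rfl, fun l hl => absurd rfl hl, ?_⟩
      rw [key a hs]
    · rw [key2 _ hτ, dd_zero]
    · rw [key2 _ hσ, dd_zero]
  | succ m ih =>
    intro k hk hDk
    obtain ⟨ih1, ih2⟩ := ih (k+1) (by omega) (by omega)
    constructor
    · exact hS.step hτ hσ hS.tau_sig (fun k w => hS.exact_tau hp) hk ih2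
    · exact hS.step hσ hτ hS.sig_tau (fun k w => hS.exact_sig hp) hk ih1

end SecE3


section SecE4
set_option linter.unusedSectionVars false
set_option linter.style.haveILetI false

variable {ι X : Type*} [PartialOrder X] [MulAction (FreeGroup ι) X]
variable {p : ℕ} {t : X → X} {tF : FreeGroup ι ≃* FreeGroup ι}

/-- fixed subgroup -/
def fixS {G : Type*} [Group G] (φ : G ≃* G) : Subgroup G where
  carrier := {x | φ x = x}
  one_mem' := map_one φ
  mul_mem' := by
    intro a b ha hb
    simp only [Set.mem_ofPred_eq] at *
    rw [map_mul, ha, hb]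
  inv_mem' := by
    intro a ha
    simp only [Set.mem_ofPred_eq] at *
    rw [map_inv, ha]

theorem mem_fixS {G : Type*} [Group G] {φ : G ≃* G} {x : G} : x ∈ fixS φ ↔ φ x = x := Iff.rfl

theorem exists_theta (hfree : ∀ (x : FreeGroup ι) (a : X), x • a = a → x = 1) (H : Subgroup (FreeGroup ι)) :
    ∃ θ : X → FreeGroup ι, (∀ a, θ a ∈ H) ∧ ∀ h ∈ H, ∀ a, θ (h • a) = h * θ a := by
  classical
  let s := MulAction.orbitRel H X
  have h1 : ∀ a : X, ∃ h : H, (h : FreeGroup ι) • (Quotient.mk s a).out = a := by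
    intro a
    have : s ((Quotient.mk s a).out) a := Quotient.mk_out a
    have h2 := s.symm this
    obtain ⟨h, hh⟩ := h2
    exact ⟨h, hh⟩
  choose θ hθ using h1
  refine ⟨fun a => θ a, fun a => (θ a).2, ?_⟩
  intro h hh a
  have e : Quotient.mk s (h • a) = Quotient.mk s a := Quotient.sound ⟨⟨h, hh⟩, rfl⟩
  have h1 := hθ (h • a)
  rw [e] at h1
  have h2 := hθ a
  have h3 : ((h * (θ a : FreeGroup ι))⁻¹ * (θ (h • a) : FreeGroup ι)) • (Quotient.mk s a).out
      = (Quotient.mk s a).out := by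
    rw [mul_smul, h1, mul_inv_rev, mul_smul, inv_smul_smul, inv_smul_eq_iff, h2]
  have := hfree _ _ h3
  exact (inv_mul_eq_one.mp this).symm

theorem EqS.tinj (hS : EqS ι X p t tF) (hp : 0 < p) {a b : X} (h : t a = t b) : a = b := by
  have h1 := congrArg t^[p-1] h
  rw [← Function.iterate_succ_apply, ← Function.iterate_succ_apply, Nat.succ_eq_add_one,
    Nat.sub_add_cancel hp, hS.tp, hS.tp] at h1
  exact h1

theorem EqS.mem_fix (hS : EqS ι X p t tF) {h : FreeGroup ι} {c : X} (hc : t c = c) (hhc : t (h • c) = h • c) :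
    h ∈ fixS tF := by
  rw [hS.tF, hc] at hhc
  have : (h⁻¹ * tF h) • c = c := by rw [mul_smul, hhc, inv_smul_smul]
  have := hS.free _ _ this
  exact (inv_mul_eq_one.mp this).symm

/-- the basic edge cochain -/
theorem EqS.exists_E (hS : EqS ι X p t tF) (hp : 0 < p) {K : Type*} [AddCommGroup K] {χ : FreeGroup ι → K}
    (hχ : AddOn (fixS tF) χ) {θ : X → FreeGroup ι} (hθ1 : ∀ a, θ a ∈ fixS tF)
    (hθ2 : ∀ h ∈ fixS tF, ∀ a, θ (h • a) = h * θ a) :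
    ∃ E : X → X → K,
      (∀ a b (x : FreeGroup ι), t (x • a) = x • a → t (x • b) = x • b →
        E a b = χ (θ (x • b)) - χ (θ (x • a))) ∧
      (∀ a b, (¬ ∃ x : FreeGroup ι, t (x • a) = x • a ∧ t (x • b) = x • b) → E a b = 0) ∧
      (∀ (y : FreeGroup ι) a b, E (y • a) (y • b) = E a b) ∧
      (∀ a b, E (t a) (t b) = E a b) := by
  classical
  let E : X → X → K := fun a b =>
    if h : ∃ x : FreeGroup ι, t (x • a) = x • a ∧ t (x • b) = x • b then
      χ (θ (h.choose • b)) - χ (θ (h.choose • a)) else 0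
  have h1 : ∀ a b (x : FreeGroup ι), t (x • a) = x • a → t (x • b) = x • b →
        E a b = χ (θ (x • b)) - χ (θ (x • a)) := by
    intro a b x ha hb
    have h : ∃ x : FreeGroup ι, t (x • a) = x • a ∧ t (x • b) = x • b := ⟨x, ha, hb⟩
    have e : E a b = χ (θ (h.choose • b)) - χ (θ (h.choose • a)) := dif_pos h
    obtain ⟨hya, hyb⟩ := h.choose_spec
    rw [e]
    generalize h.choose = y at hya hyb ⊢
    have e2 : ∀ c : X, y • c = (y * x⁻¹) • (x • c) := by
      intro c; rw [← mul_smul, inv_mul_cancel_right]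
    have hm : y * x⁻¹ ∈ fixS tF := by
      apply hS.mem_fix ha
      rw [← e2, hya]
    rw [e2 a, e2 b, hθ2 _ hm, hθ2 _ hm, hχ _ hm _ (hθ1 _), hχ _ hm _ (hθ1 _)]
    abel
  have h2 : ∀ a b, (¬ ∃ x : FreeGroup ι, t (x • a) = x • a ∧ t (x • b) = x • b) → E a b = 0 :=
    fun a b h => dif_neg h
  refine ⟨E, h1, h2, ?_, ?_⟩
  · intro y a b
    by_cases h : ∃ x : FreeGroup ι, t (x • a) = x • a ∧ t (x • b) = x • b
    · obtain ⟨x, ha, hb⟩ := h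
      have e : ∀ c : X, (x * y⁻¹) • (y • c) = x • c := by
        intro c; rw [← mul_smul, inv_mul_cancel_right]
      rw [h1 a b x ha hb, h1 _ _ (x * y⁻¹) (by rw [e, ha]) (by rw [e, hb]), e, e]
    · rw [h2 _ _ h, h2]
      rintro ⟨x, ha, hb⟩
      exact h ⟨x * y, by rw [mul_smul]; exact ha, by rw [mul_smul]; exact hb⟩
  · intro a b
    by_cases h : ∃ x : FreeGroup ι, t (x • a) = x • a ∧ t (x • b) = x • b
    · obtain ⟨x, ha, hb⟩ := h
      have ha' := ha
      have hb' := hb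
      rw [hS.tF] at ha' hb'
      rw [h1 a b x ha hb, h1 _ _ (tF x) (by rw [ha', ha]) (by rw [hb', hb]), ha', hb']
    · rw [h2 _ _ h, h2]
      rintro ⟨x, ha, hb⟩
      apply h
      refine ⟨tF.symm x, ?_, ?_⟩
      · apply hS.tinj hp
        rw [hS.tF (tF.symm x) a, MulEquiv.apply_symm_apply]; exact ha
      · apply hS.tinj hp
        rw [hS.tF (tF.symm x) b, MulEquiv.apply_symm_apply]; exact hb

open Classical in
/-- the edge cochain as a list cochain -/
noncomputable def edgeC {K : Type*} [AddCommGroup K] (E : X → X → K) : List X → K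
  | [a, b] => if a < b then E a b else 0
  | _ => 0

theorem edgeC_len {K : Type*} [AddCommGroup K] (E : X → X → K) {l : List X} (h : l.length ≠ 2) : edgeC E l = 0 := by
  match l with
  | [] => rfl
  | [_] => rfl
  | [a, b] => simp at h
  | _ :: _ :: _ :: _ => rfl

theorem edgeC_two {K : Type*} [AddCommGroup K] (E : X → X → K) {a b : X} (h : a < b) : edgeC E [a, b] = E a b := by
  simp [edgeC, h]

theorem edgeC_sup {K : Type*} [AddCommGroup K] (E : X → X → K) : Sup 1 (edgeC E) := by
  intro l hl
  have h2 : l.length = 2 := by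
    by_contra h; exact hl (edgeC_len E h)
  obtain ⟨a, b, rfl⟩ := List.length_eq_two.mp h2
  have hab : a < b := by
    by_contra h
    apply hl
    simp [edgeC, h]
  simp [hab]

theorem edgeC_map {K : Type*} [AddCommGroup K] (E : X → X → K) (f : X → X) (hf : ∀ a b, f a < f b ↔ a < b)
    (hE : ∀ a b, E (f a) (f b) = E a b) (l : List X) : edgeC E (l.map f) = edgeC E l := by
  by_cases h2 : l.length = 2
  · obtain ⟨a, b, rfl⟩ := List.length_eq_two.mp h2
    by_cases hab : a < b
    · simp [edgeC, (hf a b).mpr hab, hab, hE]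
    · simp [edgeC, mt (hf a b).mp hab, hab]
  · rw [edgeC_len E h2, edgeC_len E (by simpa using h2)]

theorem EqS.fix_extend (hS : EqS ι X p t tF) (hp : p.Prime) {D : ℕ}
    (hD : ∀ l : List X, l.Pairwise (· < ·) → l.length ≤ D) {o : X} (ho : t o = o)
    (hconn : ∀ D : X → ZMod p, (∀ a b, t a = a → t b = b → a ≤ b → D a = D b) → ∀ a, t a = a → D a = D o)
    {χ : FreeGroup ι → ZMod p} (hχ : AddOn (fixS tF) χ) :
    ∃ f : FreeGroup ι → ZMod p, AddOn ⊤ f ∧ ∀ b ∈ fixS tF, f b = χ b := by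
  have hσ := hS.good_sig hp
  have hτ := hS.good_tau hp
  obtain ⟨ρ, o', hρ⟩ := hS.contr
  obtain ⟨θ, hθ1, hθ2⟩ := exists_theta hS.free (fixS tF)
  obtain ⟨E, hE1, hE2, hE3, hE4⟩ := hS.exists_E hp.pos hχ hθ1 hθ2
  have hi0 : Finv ι (edgeC E) := fun x l => edgeC_map E _ (hS.lt x) (hE3 x) l
  have ht0 : tauOp p t (edgeC E) = 0 := by
    funext l
    exact sub_eq_zero.mpr (edgeC_map E _ hS.tlt hE4 l)
  have hs0 : Sup 1 (edgeC E) := edgeC_sup E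
  have hB : ∀ l, Fx ι t l → dd (edgeC E) l = 0 := by
    intro l hl
    by_cases hst : l.Pairwise (· < ·)
    swap
    · exact dd_not hst
    by_cases h3 : l.length = 3
    swap
    · rw [dd_of hst, ← cob_zero l]
      apply cob_congr
      intro m _ hm
      exact edgeC_len E (by omega)
    obtain ⟨a, b, c, rfl⟩ := List.length_eq_three.mp h3
    rw [dd_of hst]
    simp only [List.pairwise_cons, List.mem_cons, List.not_mem_nil, or_false, forall_eq_or_imp, forall_eq] at hst
    obtain ⟨⟨hab, hac⟩, hbc, -⟩ := hst
    simp only [cob_cons, cob_nil, edgeC_two E hab, edgeC_two E hac, edgeC_two E hbc]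
    obtain ⟨g, hg⟩ := hl
    simp only [tr, List.map_cons, List.map_nil, List.cons.injEq, and_true] at hg
    obtain ⟨ga, gb, gc⟩ := hg
    have key : ∀ (u v : X) (x : FreeGroup ι), t u = g • u → t v = g • v → t (x • u) = x • u → t (x • v) = x • v := by
      intro u v x hu hv hx
      rw [hS.tF, hu, ← mul_smul] at hx
      have h1 : (x⁻¹ * (tF x * g)) • u = u := by rw [mul_smul, hx, inv_smul_smul]
      have h2 := inv_mul_eq_one.mp (hS.free _ _ h1)
      rw [hS.tF, hv, ← mul_smul, ← h2]
    by_cases hex : ∃ x : FreeGroup ι, t (x • a) = x • a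
    · obtain ⟨x, hxa⟩ := hex
      have hxb := key a b x ga gb hxa
      have hxc := key a c x ga gc hxa
      rw [hE1 a b x hxa hxb, hE1 a c x hxa hxc, hE1 b c x hxb hxc]
      abel
    · rw [hE2 a b, hE2 a c, hE2 b c]
      · simp
      · rintro ⟨x, h, -⟩
        exact hex ⟨x, key b a x gb ga h⟩
      · rintro ⟨x, h, -⟩
        exact hex ⟨x, h⟩
      · rintro ⟨x, h, -⟩
        exact hex ⟨x, h⟩
  have hτd : tauOp p t (dd (edgeC E)) = 0 := by rw [← hτ.comm, ht0, dd_zero]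
  obtain ⟨a, ha1, ha2, ha3⟩ := hS.exact_tau hp (hi0.dd hS.lt) hs0.dd hB hτd
  obtain ⟨v, hv1, hv2, hv3⟩ := (hS.claim hp hD D 2 le_rfl (by omega)).2 a ha1 ha2 (by rw [← ha3, dd_dd])
  have hΘd : dd (edgeC E - sigOp p t v) = 0 := by rw [dd_sub, ← hv3, ha3, sub_self]
  have hΘi : Finv ι (edgeC E - sigOp p t v) := hi0.sub (hσ.inv v hv1)
  have hΘf : ∀ l, Fx ι t l → (edgeC E - sigOp p t v) l = edgeC E l := by
    intro l hl
    rw [Pi.sub_apply, hσ.kill v hv1 l hl, sub_zero]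
  have hΘs : Sup 1 (edgeC E - sigOp p t v) := hs0.sub (hσ.sup 1 v hv2)
  generalize edgeC E - sigOp p t v = Θ at hΘd hΘi hΘf hΘs
  obtain ⟨Ψ, hΨs, hΨ⟩ := acyclic hρ le_rfl hΘs hΘd
  have hΨ2 : ∀ a b, a < b → Θ [a, b] = Ψ [b] - Ψ [a] := by
    intro a b hab
    rw [← hΨ, dd_of (by simp [hab])]
    have : Ψ [] = 0 := hΨs.zero_of (Or.inr (by simp))
    simp [cob_cons]
  have hDc : ∀ (x : FreeGroup ι) (a : X), Ψ [x • a] - Ψ [a] = Ψ [x • o] - Ψ [o] := by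
    intro x a
    have h1 : ∀ a b, a ≤ b → Ψ [x • a] - Ψ [a] = Ψ [x • b] - Ψ [b] := by
      intro a b hab
      rcases hab.eq_or_lt with rfl | hab
      · rfl
      · have h2 := hΨ2 a b hab
        have h3 := hΨ2 _ _ ((hS.lt x a b).mpr hab)
        have h4 : Θ [x • a, x • b] = Θ [a, b] := hΘi x [a, b]
        rw [h4, h2] at h3
        rw [sub_eq_sub_iff_add_eq_add] at h3 ⊢
        rw [add_comm, ← h3, add_comm]
    have h5 := hρ.connected (fun a => Ψ [x • a] - Ψ [a]) h1
    rw [h5 a, ← h5 o]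
  refine ⟨fun x => Ψ [x • o] - Ψ [o], ?_, ?_⟩
  · intro x _ y _
    beta_reduce
    rw [← hDc x (y • o), mul_smul]; abel
  · intro h hh
    beta_reduce
    have hho : t (h • o) = h • o := by rw [hS.tF, ho, mem_fixS.mp hh]
    have h1 : Ψ [h • o] - χ (θ (h • o)) = Ψ [o] - χ (θ o) := by
      apply hconn (fun c => Ψ [c] - χ (θ c)) _ _ hho
      intro a b ha hb hab
      rcases hab.eq_or_lt with rfl | hab
      · rfl
      · have h2 := hΨ2 a b hab
        rw [hΘf _ ⟨1, by simp [tr, ha, hb]⟩, edgeC_two E hab,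
          hE1 a b 1 (by simpa using ha) (by simpa using hb)] at h2
        simp only [one_smul] at h2
        beta_reduce
        rw [sub_eq_sub_iff_add_eq_add] at h2 ⊢
        rw [add_comm, h2, add_comm]
    rw [hθ2 h hh, hχ h hh _ (hθ1 o)] at h1
    rw [sub_eq_sub_iff_add_eq_add] at h1
    rw [sub_eq_iff_eq_add]
    have : Ψ [h • o] + χ (θ o) = (χ h + Ψ [o]) + χ (θ o) := by rw [h1]; abel
    exact add_right_cancel this

theorem EqS.rk_fix [Fintype ι] (hS : EqS ι X p t tF) (hp : p.Prime) {D : ℕ}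
    (hD : ∀ l : List X, l.Pairwise (· < ·) → l.length ≤ D) {o : X} (ho : t o = o)
    (hconn : ∀ D : X → ZMod p, (∀ a b, t a = a → t b = b → a ≤ b → D a = D b) → ∀ a, t a = a → D a = D o) :
    rkLe (fixS tF) (Fintype.card ι) := by
  classical
  haveI := Fact.mk hp
  refine rkLe_of_extend (ZMod p) (H := ⊤) le_top ?_ (fun χ hχ => hS.fix_extend hp hD ho hconn hχ)
  refine ⟨Finset.univ.image FreeGroup.of, Finset.card_image_le, ?_⟩
  rw [Finset.coe_image, Finset.coe_univ, Set.image_univ, FreeGroup.closure_range_of]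

end SecE4


section SecE5
set_option linter.unusedSectionVars false
set_option linter.style.haveILetI false

theorem contr_of_par {P : Type*} [PartialOrder P] (depth : P → ℕ) (par : P → P) (o : P)
    (h1 : ∀ c, depth (par c) = depth c - 1) (h2 : ∀ c, depth c = 0 → c = o)
    (h3 : ∀ c, Even (depth c) → c ≤ par c) (h3' : ∀ c, ¬ Even (depth c) → par c ≤ c)
    (h4 : ∀ a b, a < b → (par b = a ∧ depth b = depth a + 1) ∨ (par a = b ∧ depth a = depth b + 1)) :
    Contr (fun N c => par^[depth c - N] c) o := by
  have hdep : ∀ n c, depth (par^[n] c) = depth c - n := by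
    intro n
    induction n with
    | zero => intro c; rfl
    | succ n ih => intro c; rw [Function.iterate_succ_apply', h1, ih]; omega
  refine ⟨?_, ?_, ?_, ?_⟩
  · intro N a b hab
    rcases hab.eq_or_lt with rfl | hab
    · exact le_rfl
    have hle := hab.le
    beta_reduce
    rcases h4 a b hab with ⟨h5, h6⟩ | ⟨h5, h6⟩
    · by_cases hN : N ≤ depth a
      · rw [h6, show depth a + 1 - N = (depth a - N) + 1 by omega, Function.iterate_succ_apply, h5]
      · rw [show depth a - N = 0 by omega, show depth b - N = 0 by omega]
        exact hle
    · by_cases hN : N ≤ depth b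
      · rw [h6, show depth b + 1 - N = (depth b - N) + 1 by omega, Function.iterate_succ_apply, h5]
      · rw [show depth a - N = 0 by omega, show depth b - N = 0 by omega]
        exact hle
  · intro N
    have key : ∀ c, par^[depth c - N] c = par^[depth c - (N+1)] c ∨
        (depth (par^[depth c - (N+1)] c) = N + 1 ∧ par^[depth c - N] c = par (par^[depth c - (N+1)] c)) := by
      intro c
      by_cases hN : depth c ≤ N
      · left
        rw [show depth c - N = 0 by omega, show depth c - (N+1) = 0 by omega]
      · right
        rw [hdep, ← Function.iterate_succ_apply' par]
        refine ⟨by omega, ?_⟩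
        rw [show (depth c - (N+1)).succ = depth c - N by omega]
    by_cases hev : Even (N+1)
    · right
      intro c
      beta_reduce
      rcases key c with h | ⟨h, h'⟩
      · exact h.symm.le
      · rw [h']
        exact h3 _ (by rw [h]; exact hev)
    · left
      intro c
      beta_reduce
      rcases key c with h | ⟨h, h'⟩
      · exact h.le
      · rw [h']
        exact h3' _ (by rw [h]; exact hev)
  · intro c
    apply h2
    rw [hdep]; omega
  · intro c
    refine ⟨depth c, fun n hn => ?_⟩
    beta_reduce
    rw [Nat.sub_eq_zero_of_le hn]; rfl

/-- barycentric subdivision of the Cayley tree -/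
inductive Tre (ι : Type*) where
  | v (g : FreeGroup ι) : Tre ι
  | e (g : FreeGroup ι) (i : ι) : Tre ι

variable {ι : Type*}

/-- incidence -/
def Tre.inc : Tre ι → Tre ι → Prop
  | .v g, .e g' i => g = g' ∨ g = FreeGroup.of i * g'
  | _, _ => False

instance : PartialOrder (Tre ι) where
  le a b := a = b ∨ Tre.inc a b
  le_refl a := Or.inl rfl
  le_trans a b c hab hbc := by
    rcases hab with rfl | hab
    · exact hbc
    rcases hbc with rfl | hbc
    · exact Or.inr hab
    cases a <;> cases b <;> cases c <;> simp [Tre.inc] at hab hbc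
  le_antisymm a b hab hba := by
    rcases hab with rfl | hab
    · rfl
    rcases hba with rfl | hba
    · rfl
    cases a <;> cases b <;> simp [Tre.inc] at hab hba

theorem Tre.le_def {a b : Tre ι} : a ≤ b ↔ a = b ∨ Tre.inc a b := Iff.rfl

theorem Tre.lt_def {a b : Tre ι} : a < b ↔ Tre.inc a b := by
  rw [lt_iff_le_and_ne, Tre.le_def]
  constructor
  · rintro ⟨h | h, h'⟩
    · exact absurd h h'
    · exact h
  · intro h
    refine ⟨Or.inr h, ?_⟩
    rintro rfl
    cases a <;> simp [Tre.inc] at h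

/-- action -/
def Tre.act (x : FreeGroup ι) : Tre ι → Tre ι
  | .v g => .v (g * x⁻¹)
  | .e g i => .e (g * x⁻¹) i

theorem Tre.act_one (c : Tre ι) : Tre.act 1 c = c := by cases c <;> simp [Tre.act]
theorem Tre.act_mul (x y : FreeGroup ι) (c : Tre ι) : Tre.act (x * y) c = Tre.act x (Tre.act y c) := by
  cases c <;> simp [Tre.act, mul_assoc]
theorem Tre.act_free {x : FreeGroup ι} {c : Tre ι} (h : Tre.act x c = c) : x = 1 := by
  cases c <;> simpa [Tre.act] using h
theorem Tre.act_inj {x : FreeGroup ι} {a b : Tre ι} (h : Tre.act x a = Tre.act x b) : a = b := by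
  rw [← Tre.act_one a, ← Tre.act_one b, ← inv_mul_cancel x, Tre.act_mul, Tre.act_mul, h]
theorem Tre.act_le {x : FreeGroup ι} {a b : Tre ι} : Tre.act x a ≤ Tre.act x b ↔ a ≤ b := by
  rw [Tre.le_def, Tre.le_def]
  refine or_congr ⟨Tre.act_inj, fun h => by rw [h]⟩ ?_
  cases a <;> cases b <;> simp [Tre.act, Tre.inc, ← mul_assoc]

section tree
variable [DecidableEq ι]

/-- depth -/
def Tre.depth : Tre ι → ℕ
  | .v g => 2 * g.toWord.length
  | .e g i => 2 * min g.toWord.length (FreeGroup.of i * g).toWord.length + 1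

/-- parent -/
def Tre.par : Tre ι → Tre ι
  | .v g => match g.toWord with
    | [] => .v g
    | (i, true) :: L => .e (FreeGroup.mk L) i
    | (i, false) :: _ => .e g i
  | .e g i => if g.toWord.length ≤ (FreeGroup.of i * g).toWord.length then .v g else .v (FreeGroup.of i * g)

theorem toWord_tail {g : FreeGroup ι} {a : ι × Bool} {L : List (ι × Bool)} (h : g.toWord = a :: L) :
    (FreeGroup.mk L).toWord = L := by
  have hr : FreeGroup.IsReduced g.toWord := FreeGroup.isReduced_toWord
  rw [h] at hr
  have h2 : FreeGroup.IsReduced L := by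
    exact List.IsChain.tail hr
  rw [FreeGroup.toWord_mk, h2.reduce_eq]

theorem of_mul_cases (g : FreeGroup ι) (i : ι) :
    (FreeGroup.of i * g).toWord = (i, true) :: g.toWord ∨ g.toWord = (i, false) :: (FreeGroup.of i * g).toWord := by
  rcases hw : g.toWord with _ | ⟨⟨j, b⟩, L⟩
  · left
    have : g = 1 := FreeGroup.toWord_eq_nil_iff.mp hw
    rw [this]; simp
  · by_cases hc : j = i ∧ b = false
    · right
      obtain ⟨rfl, rfl⟩ := hc
      have e : FreeGroup.of j * g = FreeGroup.mk L := by
        conv_lhs => rw [← FreeGroup.mk_toWord (x := g), hw]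
        rw [FreeGroup.of, FreeGroup.mul_mk]
        apply Quot.sound
        exact FreeGroup.Red.Step.cons_not
      rw [e, toWord_tail hw]
    · left
      have e : FreeGroup.of i * g = FreeGroup.mk ((i, true) :: g.toWord) := by
        conv_lhs => rw [← FreeGroup.mk_toWord (x := g)]
        rfl
      rw [e, FreeGroup.toWord_mk, ← hw]
      apply FreeGroup.IsReduced.reduce_eq
      have hr : FreeGroup.IsReduced g.toWord := FreeGroup.isReduced_toWord
      rw [hw] at hr ⊢
      unfold FreeGroup.IsReduced at hr ⊢
      rw [List.isChain_cons_cons]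
      refine ⟨?_, hr⟩
      intro hij
      cases b
      · exact absurd ⟨hij.symm, rfl⟩ hc
      · rfl

theorem Tre.par_v_true {g : FreeGroup ι} {i : ι} {L : List (ι × Bool)} (h : g.toWord = (i, true) :: L) :
    Tre.par (.v g) = .e (FreeGroup.mk L) i ∧ FreeGroup.of i * FreeGroup.mk L = g := by
  refine ⟨by simp only [Tre.par]; rw [h], ?_⟩
  rw [← FreeGroup.mk_toWord (x := g), h]; rfl

theorem Tre.par_v_false {g : FreeGroup ι} {i : ι} {L : List (ι × Bool)} (h : g.toWord = (i, false) :: L) :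
    Tre.par (.v g) = .e g i ∧ FreeGroup.of i * g = FreeGroup.mk L := by
  refine ⟨by simp only [Tre.par]; rw [h], ?_⟩
  conv_lhs => rw [← FreeGroup.mk_toWord (x := g), h]
  rw [FreeGroup.of, FreeGroup.mul_mk]
  apply Quot.sound
  exact FreeGroup.Red.Step.cons_not

theorem Tre.contr : Contr (X := Tre ι) (fun N c => Tre.par^[Tre.depth c - N] c) (.v 1) := by
  apply contr_of_par
  · intro c
    cases c with
    | v g =>
      rcases hw : g.toWord with _ | ⟨⟨i, b⟩, L⟩
      · simp [Tre.par, Tre.depth, hw]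
      · cases b
        · obtain ⟨h1, h2⟩ := Tre.par_v_false hw
          rw [h1]
          simp only [Tre.depth, h2, toWord_tail hw, hw, List.length_cons]
          rw [min_eq_right (by omega)]; omega
        · obtain ⟨h1, h2⟩ := Tre.par_v_true hw
          rw [h1]
          simp only [Tre.depth, h2, toWord_tail hw, hw, List.length_cons]
          rw [min_eq_left (by omega)]; omega
    | e g i =>
      simp only [Tre.par]
      split_ifs with h
      · simp only [Tre.depth]; rw [min_eq_left h]; omega
      · simp only [Tre.depth]; rw [min_eq_right (by omega)]; omega
  · intro c hc
    cases c with
    | v g =>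
      simp only [Tre.depth] at hc
      have : g.toWord = [] := List.length_eq_zero_iff.mp (by omega)
      rw [FreeGroup.toWord_eq_nil_iff.mp this]
    | e g i => simp [Tre.depth] at hc
  · intro c hc
    cases c with
    | v g =>
      rcases hw : g.toWord with _ | ⟨⟨i, b⟩, L⟩
      · simp [Tre.par, hw]
      · cases b
        · obtain ⟨h1, h2⟩ := Tre.par_v_false hw
          rw [h1]; right; left; rfl
        · obtain ⟨h1, h2⟩ := Tre.par_v_true hw
          rw [h1]; right; right; exact h2.symm
    | e g i =>
      exfalso
      simp only [Tre.depth] at hc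
      obtain ⟨r, hr⟩ := hc
      omega
  · intro c hc
    cases c with
    | v g =>
      exfalso
      apply hc
      simp [Tre.depth]
    | e g i =>
      simp only [Tre.par]
      split_ifs with h
      · right; left; rfl
      · right; right; rfl
  · intro a b hab
    rw [Tre.lt_def] at hab
    match a, b, hab with
    | .v g, .e g' i, hab =>
      rcases of_mul_cases g' i with hA | hB
      · have hl : (FreeGroup.of i * g').toWord.length = g'.toWord.length + 1 := by rw [hA]; rfl
        rcases hab with rfl | rfl
        · left
          constructor
          · simp only [Tre.par]; rw [if_pos (by omega)]
          · simp only [Tre.depth]; rw [min_eq_left (by omega)]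
        · right
          have := Tre.par_v_true hA
          rw [FreeGroup.mk_toWord] at this
          refine ⟨this.1, ?_⟩
          simp only [Tre.depth]; rw [min_eq_left (by omega)]; omega
      · have hl : g'.toWord.length = (FreeGroup.of i * g').toWord.length + 1 := by
          conv_lhs => rw [hB]
          rfl
        rcases hab with rfl | rfl
        · right
          refine ⟨(Tre.par_v_false hB).1, ?_⟩
          simp only [Tre.depth]; rw [min_eq_right (by omega)]; omega
        · left
          constructor
          · simp only [Tre.par]; rw [if_neg (by omega)]
          · simp only [Tre.depth]; rw [min_eq_right (by omega)]

end tree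

/-- the edge indicator -/
def Tre.isE : Tre ι → ℕ
  | .v _ => 0
  | .e _ _ => 1

theorem Tre.isE_le {a b : Tre ι} (h : a ≤ b) : a.isE ≤ b.isE := by
  rcases h with rfl | h
  · rfl
  · cases a <;> cases b <;> simp [Tre.inc, Tre.isE] at h ⊢

theorem Tre.isE_lt {a b : Tre ι} (h : a < b) : a.isE < b.isE := by
  rw [Tre.lt_def] at h
  cases a <;> cases b <;> simp [Tre.inc, Tre.isE] at h ⊢

/-- the main rank bound for prime order automorphisms -/
theorem rk_fix_prime [Fintype ι] {p : ℕ} (hp : p.Prime) (φ : FreeGroup ι ≃* FreeGroup ι)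
    (hφ : φ ^ p = 1) : rkLe (fixS φ) (Fintype.card ι) := by
  classical
  haveI := Fact.mk hp
  let A : MulAction (FreeGroup ι) (ZMod p → Tre ι) :=
    { smul := fun x c j => Tre.act ((φ ^ j.val) x) (c j)
      one_smul := by
        intro c
        funext j
        change Tre.act ((φ ^ j.val) 1) (c j) = c j
        rw [map_one, Tre.act_one]
      mul_smul := by
        intro x y c
        funext j
        change Tre.act ((φ ^ j.val) (x * y)) (c j) = Tre.act ((φ ^ j.val) x) (Tre.act ((φ ^ j.val) y) (c j))
        rw [map_mul, Tre.act_mul] }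
  have hsm : ∀ (x : FreeGroup ι) (c : ZMod p → Tre ι) (j : ZMod p), (x • c) j = Tre.act ((φ ^ j.val) x) (c j) :=
    fun _ _ _ => rfl
  have hle : ∀ (x : FreeGroup ι) (a b : ZMod p → Tre ι), x • a ≤ x • b ↔ a ≤ b := by
    intro x a b
    rw [Pi.le_def, Pi.le_def]
    simp only [hsm, Tre.act_le]
  let t : (ZMod p → Tre ι) → (ZMod p → Tre ι) := fun c j => c (j + 1)
  have htle : ∀ a b, t a ≤ t b ↔ a ≤ b := by
    intro a b
    rw [Pi.le_def, Pi.le_def]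
    constructor
    · intro h j
      have := h (j - 1)
      simpa [t] using this
    · intro h j
      exact h (j+1)
  have hit : ∀ n c j, t^[n] c j = c (j + n) := by
    intro n
    induction n with
    | zero => intro c j; simp
    | succ n ih =>
      intro c j
      rw [Function.iterate_succ_apply', show t (t^[n] c) j = t^[n] c (j+1) from rfl, ih]
      push_cast
      congr 1; ring
  have hS : EqS ι (ZMod p → Tre ι) p t φ := by
    refine ⟨?_, ?_, ?_, ?_, ?_, ?_⟩
    · intro x c h
      have h0 := congrFun h 0
      rw [hsm] at h0
      have := Tre.act_free h0
      simpa using this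
    · intro x a b
      rw [lt_iff_le_not_ge, lt_iff_le_not_ge, hle, hle]
    · intro a b
      rw [lt_iff_le_not_ge, lt_iff_le_not_ge, htle, htle]
    · intro c
      funext j
      rw [hit]; simp
    · intro x c
      funext j
      change (x • c) (j+1) = (φ x • t c) j
      rw [hsm, hsm]
      change _ = Tre.act _ (c (j+1))
      congr 1
      have e1 : (j + 1).val = (j.val + 1) % p := by
        rw [ZMod.val_add, ZMod.val_one]
      have e2 : φ ^ (j+1).val = φ ^ (j.val + 1) := by
        rw [e1, ← pow_eq_pow_mod _ hφ]
      rw [e2, pow_succ]; rfl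
    · have hT := Tre.contr (ι := ι)
      generalize (fun N (c : Tre ι) => Tre.par^[Tre.depth c - N] c) = ρ at hT
      refine ⟨fun N c j => ρ N (c j), fun _ => .v 1, ?_, ?_, ?_, ?_⟩
      · intro N a b hab j
        exact hT.mono N (hab j)
      · intro N
        rcases hT.cmp N with h | h
        · exact Or.inl (fun a j => h (a j))
        · exact Or.inr (fun a j => h (a j))
      · intro a
        funext j
        exact hT.zero (a j)
      · intro a
        choose N hN using hT.ev
        refine ⟨∑ j, N (a j), fun n hn => ?_⟩
        funext j
        apply hN
        refine le_trans ?_ hn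
        exact Finset.single_le_sum (f := fun j => N (a j)) (fun _ _ => Nat.zero_le _) (Finset.mem_univ j)
  refine hS.rk_fix hp (D := p + 1) ?_ (o := fun _ => .v 1) rfl ?_
  · intro l hl
    let rk : (ZMod p → Tre ι) → ℕ := fun c => ∑ j, (c j).isE
    have h1 : ∀ a b : ZMod p → Tre ι, a < b → rk a < rk b := by
      intro a b hab
      rw [Pi.lt_def] at hab
      obtain ⟨h1, j, h2⟩ := hab
      exact Finset.sum_lt_sum (fun j _ => Tre.isE_le (h1 j)) ⟨j, Finset.mem_univ j, Tre.isE_lt h2⟩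
    have h2 : ∀ a, rk a ≤ p := by
      intro a
      calc rk a ≤ ∑ j : ZMod p, 1 := Finset.sum_le_sum (fun j _ => by cases a j <;> simp [Tre.isE])
        _ = p := by simp [ZMod.card]
    have h3 : (l.map rk).Nodup := by
      rw [List.Nodup, List.pairwise_map]
      exact hl.imp (fun h => (h1 _ _ h).ne)
    have h4 := List.toFinset_card_of_nodup h3
    have h5 : (l.map rk).toFinset ⊆ Finset.range (p+1) := by
      intro n hn
      rw [List.mem_toFinset, List.mem_map] at hn
      obtain ⟨a, _, rfl⟩ := hn
      rw [Finset.mem_range]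
      have := h2 a
      omega
    have h6 := Finset.card_le_card h5
    rw [h4, Finset.card_range, List.length_map] at h6
    exact h6
  · intro D hD a ha
    have hconst : ∀ n : ℕ, a (n : ZMod p) = a 0 := by
      intro n
      induction n with
      | zero => simp
      | succ n ih =>
        rw [← ih]
        push_cast
        exact congrFun ha n
    have ha2 : a = fun _ => a 0 := by
      funext j
      rw [← hconst j.val, ZMod.natCast_zmod_val]
    rw [ha2]
    apply Tre.contr.connected (fun c => D (fun _ => c))
    intro b c hbc
    exact hD _ _ rfl rfl (fun _ => hbc)

end SecE5


section SecF
set_option linter.unusedSectionVars false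
set_option linter.style.haveILetI false

theorem free_of_rk {G : Type*} [Group G] {N : Subgroup G} [IsFreeGroup N] {n : ℕ} (hN : rkLe N n) :
    ∃ r ≤ n, Nonempty (N ≃* FreeGroup (Fin r)) := by
  classical
  let b := IsFreeGroup.basis N
  have hno : ¬ Nonempty (Fin (n+1) ↪ IsFreeGroup.Generators N) := by
    rintro ⟨⟨e, he⟩⟩
    have := fun i : Fin (n+1) => exists_dual b ℚ (fun z => if e i = z then 1 else 0)
    choose f hf1 hf2 using this
    refine rk_dual_false hN f hf1 (fun j => b (e j)) (fun j => Subtype.property _) ?_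
    intro i j
    rw [hf2]
    simp [he.eq_iff]
  have hfin : Finite (IsFreeGroup.Generators N) := by
    by_contra h
    have : Infinite (IsFreeGroup.Generators N) := not_finite_iff_infinite.mp h
    exact hno ⟨(Fin.valEmbedding).trans (Infinite.natEmbedding _)⟩
  have := Fintype.ofFinite (IsFreeGroup.Generators N)
  refine ⟨Fintype.card (IsFreeGroup.Generators N), ?_, ?_⟩
  · by_contra hc
    apply hno
    apply Function.Embedding.nonempty_of_card_le
    rw [Fintype.card_fin]; omega
  · exact ⟨b.repr.trans (FreeGroup.freeGroupCongr (Fintype.equivFin _))⟩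

theorem transport {G G' : Type*} [Group G] [IsFreeGroup G] [Group G'] {N : Subgroup G} {n : ℕ} (hN : rkLe N n)
    (g h : G →* G') (hg : Function.Injective g) (hh : Function.Injective h)
    (hm : ∀ x ∈ N, ∃ y ∈ N, h y = g x) :
    ∃ r ≤ n, ∃ j : FreeGroup (Fin r) →* G, Function.Injective j ∧ j.range = N ∧
      ∃ φ : FreeGroup (Fin r) →* FreeGroup (Fin r), Function.Injective φ ∧
        ∀ x, h (j (φ x)) = g (j x) := by
  obtain ⟨r, hr, ⟨e⟩⟩ := free_of_rk hN
  let j : FreeGroup (Fin r) →* G := N.subtype.comp e.symm.toMonoidHom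
  have hj : Function.Injective j := Subtype.val_injective.comp e.symm.injective
  have hjr : j.range = N := by
    ext x
    constructor
    · rintro ⟨y, rfl⟩
      exact Subtype.property _
    · intro hx
      exact ⟨e ⟨x, hx⟩, by simp [j]⟩
  refine ⟨r, hr, j, hj, hjr, ?_⟩
  have hc : ∀ x, ∃ z, h (j z) = g (j x) := by
    intro x
    obtain ⟨y, hy, hyx⟩ := hm (j x) (by rw [← hjr]; exact ⟨x, rfl⟩)
    rw [← hjr] at hy
    obtain ⟨z, rfl⟩ := hy
    exact ⟨z, hyx⟩
  choose F hF using hc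
  refine ⟨MonoidHom.mk' F ?_, ?_, hF⟩
  · intro x y
    apply hj
    apply hh
    rw [hF, map_mul, map_mul, map_mul, map_mul, hF, hF]
  · intro x y hxy
    apply hj
    apply hg
    rw [← hF, ← hF]
    exact congrArg _ (congrArg _ hxy)

theorem fix_transport {G G' : Type*} [Group G] [Group G'] {N : Subgroup G} {n r : ℕ} (hr : r ≤ n)
    (g h : G →* G') (hh : Function.Injective h) (j : FreeGroup (Fin r) →* G) (hj : Function.Injective j)
    (hjr : j.range = N) (φ : FreeGroup (Fin r) →* FreeGroup (Fin r))
    (hφ : ∀ x, h (j (φ x)) = g (j x)) (hle : g.eqLocus h ≤ N)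
    (hrk : rkLe (φ.eqLocus (MonoidHom.id _)) r) : rkLe (g.eqLocus h) n := by
  have e : g.eqLocus h = (φ.eqLocus (MonoidHom.id _)).map j := by
    ext x
    constructor
    · intro hx
      have hxN := hle hx
      rw [← hjr] at hxN
      obtain ⟨z, rfl⟩ := hxN
      refine ⟨z, ?_, rfl⟩
      change φ z = z
      apply hj
      apply hh
      rw [hφ]
      exact hx
    · rintro ⟨z, hz, rfl⟩
      have hz' : φ z = z := hz
      change g (j z) = h (j z)
      rw [← hφ, hz']
  rw [e]
  exact (hrk.map j).mono hr

theorem fix_eq {G : Type*} [Group G] (φ : G ≃* G) : φ.toMonoidHom.eqLocus (MonoidHom.id _) = fixS φ := rfl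

theorem rk_top (r : ℕ) : rkLe (⊤ : Subgroup (FreeGroup (Fin r))) r := by
  classical
  refine ⟨Finset.univ.image FreeGroup.of, Finset.card_image_le.trans (by simp), ?_⟩
  rw [Finset.coe_image, Finset.coe_univ, Set.image_univ, FreeGroup.closure_range_of]

/-- transport for automorphisms -/
theorem transport_aut {r n : ℕ} (φ : FreeGroup (Fin r) ≃* FreeGroup (Fin r)) {N : Subgroup (FreeGroup (Fin r))}
    (hN : rkLe N n) (hm : ∀ x ∈ N, φ x ∈ N) (hs : ∀ x, φ x ∈ N → x ∈ N) (hle : fixS φ ≤ N) :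
    ∃ s ≤ n, ∃ ψ : FreeGroup (Fin s) ≃* FreeGroup (Fin s),
      (∀ k, (∀ x ∈ N, (φ ^ k) x = x) → ψ ^ k = 1) ∧ (rkLe (fixS ψ) s → rkLe (fixS φ) n) := by
  obtain ⟨s, hs1, j, hj, hjr, ψ0, hψ0, hψ⟩ := transport hN φ.toMonoidHom (MonoidHom.id _) φ.injective
    Function.injective_id (fun x hx => ⟨φ x, hm x hx, rfl⟩)
  have hψ' : ∀ x, j (ψ0 x) = φ (j x) := hψ
  have hsurj : Function.Surjective ψ0 := by
    intro y
    have h1 : φ.symm (j y) ∈ N := by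
      apply hs
      rw [MulEquiv.apply_symm_apply, ← hjr]
      exact ⟨y, rfl⟩
    rw [← hjr] at h1
    obtain ⟨x, hx⟩ := h1
    refine ⟨x, ?_⟩
    apply hj
    rw [hψ', hx, MulEquiv.apply_symm_apply]
  let ψ : FreeGroup (Fin s) ≃* FreeGroup (Fin s) := MulEquiv.ofBijective ψ0 ⟨hψ0, hsurj⟩
  refine ⟨s, hs1, ψ, ?_, ?_⟩
  · intro k hk
    have h1 : ∀ (k : ℕ) x, j ((ψ ^ k) x) = (φ ^ k) (j x) := by
      intro k
      induction k with
      | zero => intro x; simp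
      | succ k ih =>
        intro x
        rw [pow_succ, pow_succ, MulAut.mul_apply, MulAut.mul_apply, ih]
        exact congrArg _ (hψ' x)
    ext x
    apply hj
    rw [h1, hk _ (by rw [← hjr]; exact ⟨x, rfl⟩)]
    rfl
  · intro h
    exact fix_transport hs1 φ.toMonoidHom (MonoidHom.id _) Function.injective_id j hj hjr ψ0 hψ hle h

theorem rk_fix_fin (k : ℕ) : 0 < k → ∀ (r : ℕ) (φ : FreeGroup (Fin r) ≃* FreeGroup (Fin r)), φ ^ k = 1 →
    rkLe (fixS φ) r := by
  induction k using Nat.strong_induction_on with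
  | _ k ih =>
    intro hk r φ hφ
    by_cases h1 : k = 1
    · subst h1
      rw [pow_one] at hφ
      have : fixS φ = ⊤ := by
        rw [eq_top_iff]
        intro x _
        rw [mem_fixS, hφ]; rfl
      rw [this]
      exact rk_top r
    · have hp := Nat.minFac_prime h1
      obtain ⟨m, hm⟩ := Nat.minFac_dvd k
      have hm0 : 0 < m := by
        rcases Nat.eq_zero_or_pos m with h | h
        · rw [h] at hm; omega
        · exact h
      have hmk : m < k := by
        conv_rhs => rw [hm]
        exact lt_mul_of_one_lt_left hm0 hp.one_lt
      have h2 : rkLe (fixS (φ ^ m)) r := by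
        have h3 := rk_fix_prime hp (φ ^ m) (by rw [← pow_mul, mul_comm, ← hm, hφ])
        rwa [Fintype.card_fin] at h3
      have hcomm : ∀ x, (φ ^ m) (φ x) = φ ((φ ^ m) x) := by
        intro x
        rw [← MulAut.mul_apply, ← MulAut.mul_apply, ← pow_succ, ← pow_succ']
      obtain ⟨s, hs, ψ, hψ1, hψ2⟩ := transport_aut φ h2 (by
          intro x hx
          rw [mem_fixS] at hx ⊢
          rw [hcomm, hx]) (by
          intro x hx
          rw [mem_fixS] at hx ⊢
          rw [hcomm] at hx
          exact φ.injective hx) (by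
          intro x hx
          exact pow_fix φ x hx m)
      exact hψ2 (ih m hmk hm0 s ψ (hψ1 m (fun x hx => hx)))

theorem rk_fix_aut (r : ℕ) (φ : FreeGroup (Fin r) ≃* FreeGroup (Fin r)) : rkLe (fixS φ) r := by
  classical
  have h2 : rkLe (perSub φ) r := by
    have h3 := rkLe_per φ
    rwa [Fintype.card_fin] at h3
  have hcomm : ∀ (m : ℕ) x, (φ ^ m) (φ x) = φ ((φ ^ m) x) := by
    intro m x
    rw [← MulAut.mul_apply, ← MulAut.mul_apply, ← pow_succ, ← pow_succ']
  obtain ⟨s, hs, ψ, hψ1, hψ2⟩ := transport_aut φ h2 (by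
      rintro x ⟨k, hk, hx⟩
      exact ⟨k, hk, by rw [hcomm, hx]⟩) (by
      rintro x ⟨k, hk, hx⟩
      rw [hcomm] at hx
      exact ⟨k, hk, φ.injective hx⟩) (by
      intro x hx
      refine ⟨1, one_pos, ?_⟩
      rw [pow_one]; exact hx)
  apply hψ2
  obtain ⟨S, hS, hcl⟩ := h2
  have hper : ∀ x : S, ∃ k > 0, (φ ^ k) (x : FreeGroup (Fin r)) = x := by
    intro x
    have : (x : FreeGroup (Fin r)) ∈ perSub φ := by
      rw [← hcl]; exact Subgroup.subset_closure x.2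
    exact this
  choose K hK1 hK2 using hper
  have hpos : 0 < ∏ x, K x := Finset.prod_pos (fun x _ => hK1 x)
  refine rk_fix_fin (∏ x, K x) hpos s ψ (hψ1 _ ?_)
  have hle : perSub φ ≤ fixS (φ ^ (∏ x, K x)) := by
    rw [← hcl, Subgroup.closure_le]
    intro x hx
    obtain ⟨m, hm⟩ := Finset.dvd_prod_of_mem K (Finset.mem_univ (⟨x, hx⟩ : S))
    change (φ ^ (∏ x, K x)) x = x
    rw [hm, pow_mul]
    exact pow_fix _ x (hK2 ⟨x, hx⟩) m
  intro x hx
  exact hle hx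

theorem rk_fix_endo (r : ℕ) (φ : FreeGroup (Fin r) →* FreeGroup (Fin r)) (hφ : Function.Injective φ) :
    rkLe (φ.eqLocus (MonoidHom.id _)) r := by
  classical
  let H : ℕ → Subgroup (FreeGroup (Fin r)) := fun k => Nat.rec ⊤ (fun _ K => K.map φ) k
  have H0 : H 0 = ⊤ := rfl
  have Hs : ∀ k, H (k+1) = (H k).map φ := fun k => rfl
  have hanti : Antitone H := by
    apply antitone_nat_of_succ_le
    intro k
    induction k with
    | zero => rw [H0]; exact le_top
    | succ k ih =>
      change (H (k+1)).map φ ≤ (H k).map φ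
      exact Subgroup.map_mono ih
  have hrk : ∀ k, rkLe (H k) r := by
    intro k
    induction k with
    | zero => exact rk_top r
    | succ k ih => rw [Hs]; exact ih.map φ
  have hR := rkLe_iInf H hanti r hrk
  have hmem : ∀ x, x ∈ (⨅ i, H i) ↔ ∀ i, x ∈ H i := fun x => Subgroup.mem_iInf
  obtain ⟨s, hs, j, hj, hjr, ψ, hψ, hψ2⟩ := transport hR φ (MonoidHom.id _) hφ Function.injective_id (by
    intro x hx
    refine ⟨φ x, ?_, rfl⟩
    rw [hmem] at hx ⊢
    intro i
    have : φ x ∈ H (i+1) := by rw [Hs]; exact ⟨x, hx i, rfl⟩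
    exact hanti (Nat.le_succ i) this)
  have hψ3 : ∀ x, j (ψ x) = φ (j x) := hψ2
  have hsurj : Function.Surjective ψ := by
    intro y
    have hy : j y ∈ (⨅ i, H i) := by rw [← hjr]; exact ⟨y, rfl⟩
    rw [hmem] at hy
    have hy1 : j y ∈ (H 0).map φ := hy 1
    obtain ⟨x, -, hx⟩ := hy1
    have hxR : x ∈ (⨅ i, H i) := by
      rw [hmem]
      intro i
      have hi := hy (i+1)
      rw [Hs] at hi
      obtain ⟨x', hx', hxx⟩ := hi
      rw [← hx] at hxx
      rw [← hφ hxx]; exact hx'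
    rw [← hjr] at hxR
    obtain ⟨z, rfl⟩ := hxR
    exact ⟨z, hj (by rw [hψ3, hx])⟩
  refine fix_transport hs φ (MonoidHom.id _) Function.injective_id j hj hjr ψ hψ2 ?_ 
    (rk_fix_aut s (MulEquiv.ofBijective ψ ⟨hψ, hsurj⟩))
  intro x hx
  have hx' : φ x = x := hx
  rw [hmem]
  intro i
  induction i with
  | zero => rw [H0]; trivial
  | succ i ih => rw [Hs]; exact ⟨x, ih, hx'⟩

end SecF

theorem stmt_7 {α β : Type} [Fintype α] (g h : FreeGroup α →* FreeGroup β)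
    (hg : Function.Injective g) (hh : Function.Injective h)
    (hin : InertIn g.range (g.range ⊔ h.range)) :
    rkLe (SD g h) (Fintype.card α) ∧ rkLe (g.eqLocus h) (Fintype.card α) := by
  classical
  have hmem0 : ∀ i x, x ∈ SDChain g h (i+1) ↔ x ∈ SDChain g h i ∧ ∃ y ∈ SDChain g h i, h y = g x := by
    intro i x
    change g x ∈ Subgroup.map g (SDChain g h i) ⊓ Subgroup.map h (SDChain g h i) ↔ _
    rw [Subgroup.mem_inf]
    apply and_congr
    · constructor
      · rintro ⟨y, hy, hyx⟩
        rw [← hg hyx]; exact hy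
      · intro hx; exact ⟨x, hx, rfl⟩
    · rfl
  have hanti : Antitone (SDChain g h) := by
    apply antitone_nat_of_succ_le
    intro i x hx
    exact ((hmem0 i x).mp hx).1
  have hmem : ∀ i x, x ∈ SDChain g h (i+1) ↔ ∃ y ∈ SDChain g h i, h y = g x := by
    intro i
    induction i with
    | zero =>
      intro x
      rw [hmem0]
      exact ⟨fun h => h.2, fun h => ⟨trivial, h⟩⟩
    | succ i ih =>
      intro x
      rw [hmem0]
      refine ⟨fun h => h.2, fun h => ⟨?_, h⟩⟩
      obtain ⟨y, hy, hyx⟩ := h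
      rw [ih]
      exact ⟨y, hanti (Nat.le_succ i) hy, hyx⟩
  have hrk : ∀ i, rkLe (SDChain g h i) (Fintype.card α) := by
    intro i
    induction i with
    | zero =>
      refine ⟨Finset.univ.image FreeGroup.of, Finset.card_image_le, ?_⟩
      rw [Finset.coe_image, Finset.coe_univ, Set.image_univ, FreeGroup.closure_range_of]
      rfl
    | succ i ih =>
      apply rkLe.of_map g hg
      have e : (SDChain g h (i+1)).map g = g.range ⊓ (SDChain g h i).map h := by
        ext z
        rw [Subgroup.mem_inf]
        constructor
        · rintro ⟨x, hx, rfl⟩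
          obtain ⟨y, hy, hyx⟩ := (hmem i x).mp hx
          exact ⟨⟨x, rfl⟩, ⟨y, hy, hyx⟩⟩
        · rintro ⟨⟨x, rfl⟩, ⟨y, hy, hyx⟩⟩
          exact ⟨x, (hmem i x).mpr ⟨y, hy, hyx⟩, rfl⟩
      rw [e]
      apply hin _ _ _ (ih.map h)
      refine le_trans ?_ le_sup_right
      rintro z ⟨y, -, rfl⟩
      exact ⟨y, rfl⟩
  have hSD : rkLe (SD g h) (Fintype.card α) := rkLe_iInf (SDChain g h) hanti _ hrk
  refine ⟨hSD, ?_⟩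
  have hmemS : ∀ x, x ∈ SD g h ↔ ∀ i, x ∈ SDChain g h i := fun x => Subgroup.mem_iInf
  obtain ⟨r, hr, j, hj, hjr, φ, hφ, hφ2⟩ := transport hSD g h hg hh (by
    intro x hx
    rw [hmemS] at hx
    obtain ⟨y, -, hyx⟩ := (hmem 0 x).mp (hx 1)
    refine ⟨y, ?_, hyx⟩
    rw [hmemS]
    intro i
    obtain ⟨y', hy', hyx'⟩ := (hmem i x).mp (hx (i+1))
    rw [← hyx'] at hyx
    rw [hh hyx]; exact hy')
  refine fix_transport hr g h hh j hj hjr φ hφ2 ?_ (rk_fix_endo r φ hφ)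
  intro x hx
  have hx' : g x = h x := hx
  rw [hmemS]
  intro i
  induction i with
  | zero => trivial
  | succ i ih => rw [hmem]; exact ⟨x, ih, hx'.symm⟩
end
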